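/- Suppose that λ is a singular cardinal which is not a strong limit (i.e., there is μ < λ with 2^μ ≥ λ), and that either (a) λ < ℵ_λ (λ is not a fixed point of the aleph function), or (b) λ = ℵ_λ but the set {μ < λ : μ = ℵ_μ} has cardinality less than λ, and in addition either cf(λ) = ℵ₀ or 2^{<cf(λ)} < λ. Then there is no universal linear order of cardinality λ. -/

import Mathlib

section

open Cardinal Ordinal Set Order Filter

/-- Recursion along the ordinals with a non-unique choice at every stage. -/
theorem exists_dependent_choice {A : Type*} [Nonempty A] (o : Ordinal.{0})
    (P : Ordinal.{0} → (Ordinal.{0} → A) → A → Prop)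
    (hloc : ∀ α < o, ∀ H H' : Ordinal.{0} → A, (∀ β < α, H β = H' β) → ∀ a, P α H a → P α H' a)
    (hex : ∀ α < o, ∀ H : Ordinal.{0} → A, (∀ β < α, P β H (H β)) → ∃ a, P α H a) :
    ∃ H : Ordinal.{0} → A, ∀ α < o, P α H (H α) := by
  classical
  let a₀ : A := Classical.arbitrary A
  let S : ∀ α : Ordinal.{0}, (∀ β : Ordinal.{0}, β < α → A) → A := fun α hist =>
    Classical.epsilon (fun a => P α (fun β => if h : β < α then hist β h else a₀) a)
  let H : Ordinal.{0} → A := WellFounded.fix (r := (· < ·)) wellFounded_lt S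
  have hH : ∀ α, H α = S α (fun β _ => H β) := fun α =>
    WellFounded.fix_eq (r := (· < ·)) wellFounded_lt S α
  refine ⟨H, ?_⟩
  intro α
  induction α using WellFoundedLT.induction with
  | ind α ih =>
  intro hα
  obtain ⟨a, ha⟩ := hex α hα H (fun β hβ => ih β hβ (hβ.trans hα))
  have hl : ∀ β < α, H β = (fun β => if _ : β < α then H β else a₀) β := by
    intro β hβ; simp [hβ]
  have h1 := hloc α hα H _ hl a ha
  have h2 := Classical.epsilon_spec (p := fun a => P α (fun β => if h : β < α then H β else a₀) a)
    ⟨a, h1⟩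
  rw [hH α]
  exact hloc α hα _ H (fun β hβ => (hl β hβ).symm) _ h2

theorem exists_bound_of_regular {κ : Cardinal.{0}} (hκ : κ.IsRegular) {K : Type}
    (hK : #K < κ) (f : K → Ordinal.{0}) (hf : ∀ k, f k < κ.ord) :
    ∃ b < κ.ord, ∀ k, f k < b := by
  have hlim : IsSuccLimit κ.ord := isSuccLimit_ord hκ.aleph0_le
  refine ⟨succ (⨆ k, f k), hlim.succ_lt (iSup_lt_of_lt_cof (by rwa [hκ.cof_ord]) hf), fun k => ?_⟩
  exact lt_succ_of_le (le_ciSup Ordinal.bddAbove_of_small k)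

theorem mk_toType' (o : Ordinal.{0}) : #o.ToType = o.card := by simp

theorem exists_bound_of_regular_ordinal {κ : Cardinal.{0}} (hκ : κ.IsRegular) {a : Ordinal.{0}}
    (ha : a < κ.ord) (f : Ordinal.{0} → Ordinal.{0}) (hf : ∀ β < a, f β < κ.ord) :
    ∃ b < κ.ord, ∀ β < a, f β < b := by
  obtain ⟨b, hb, h⟩ := exists_bound_of_regular hκ (K := a.ToType)
    (by rw [mk_toType']; exact lt_ord.1 ha)
    (fun k => f (ToType.mk.symm k).1) (fun k => hf _ (ToType.mk.symm k).2)
  refine ⟨b, hb, fun β hβ => ?_⟩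
  simpa using h (ToType.mk ⟨β, hβ⟩)

/-- A type of size `< κ` cannot receive an injection from the ordinals below `κ.ord`. -/
theorem exists_eq_of_card_lt {κ : Cardinal.{0}} {ι : Type} (hι : #ι < κ) (y : Ordinal.{0} → ι) :
    ∃ α β, α < β ∧ β < κ.ord ∧ y α = y β := by
  by_contra! hcon
  have hinj : Function.Injective (fun k : κ.ord.ToType => y (ToType.mk.symm k).1) := by
    intro k l hkl
    rcases lt_trichotomy (ToType.mk.symm k).1 (ToType.mk.symm l).1 with h | h | h
    · exact absurd hkl (hcon _ _ h (ToType.mk.symm l).2)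
    · simpa using Subtype.ext h
    · exact absurd hkl.symm (hcon _ _ h (ToType.mk.symm k).2)
  have := mk_le_of_injective hinj
  rw [mk_toType', card_ord] at this
  exact absurd hι (not_lt.2 this)

theorem exists_cofinal_family (o : Ordinal.{0}) :
    ∃ (K : Type) (f : K → Ordinal.{0}), #K = o.cof ∧ (∀ k, f k < o) ∧ ∀ a < o, ∃ k, a ≤ f k := by
  obtain ⟨s, hs, hcard⟩ := Order.exists_cof_eq (α := o.ToType)
  rw [cof_toType] at hcard
  refine ⟨s, fun k => (ToType.mk.symm k.1).1, hcard, fun k => (ToType.mk.symm k.1).2, ?_⟩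
  intro a ha
  obtain ⟨b, hb, hab⟩ := hs (ToType.mk ⟨a, ha⟩)
  refine ⟨⟨b, hb⟩, ?_⟩
  have h1 : (⟨a, ha⟩ : Iio o) ≤ ToType.mk.symm b := by
    simpa using ToType.mk.symm.monotone hab
  exact h1

theorem exists_bound_of_lt_cof {o : Ordinal.{0}} {K : Type} (hK : #K < o.cof)
    (f : K → Ordinal.{0}) (hf : ∀ k, f k < o) : ∃ b < o, ∀ k, f k ≤ b :=
  ⟨⨆ k, f k, iSup_lt_of_lt_cof hK hf, fun k => le_ciSup Ordinal.bddAbove_of_small k⟩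

theorem exists_bound_of_lt_cof_ordinal {o a : Ordinal.{0}} (ha : a.card < o.cof)
    (f : Ordinal.{0} → Ordinal.{0}) (hf : ∀ β < a, f β < o) : ∃ b < o, ∀ β < a, f β ≤ b := by
  obtain ⟨b, hb, h⟩ := exists_bound_of_lt_cof (o := o) (K := a.ToType) (by rwa [mk_toType'])
    (fun k => f (ToType.mk.symm k).1) (fun k => hf _ (ToType.mk.symm k).2)
  refine ⟨b, hb, fun β hβ => ?_⟩
  simpa using h (ToType.mk ⟨β, hβ⟩)

/-- Enumerate a small nonempty type by the ordinals below a given cardinal. -/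
theorem exists_enumeration {K : Type} [Nonempty K] {c : Cardinal.{0}} (hK : #K ≤ c) :
    ∃ f : Ordinal.{0} → K, ∀ k, ∃ ξ < c.ord, f ξ = k := by
  classical
  rw [← card_ord c, ← mk_toType', Cardinal.le_def] at hK
  obtain ⟨e⟩ := hK
  refine ⟨fun ξ => if h : ξ < c.ord then Function.invFun e (ToType.mk ⟨ξ, h⟩)
    else Classical.arbitrary K, fun k => ⟨(ToType.mk.symm (e k)).1, (ToType.mk.symm (e k)).2, ?_⟩⟩
  have h : (ToType.mk.symm (e k)).1 < c.ord := (ToType.mk.symm (e k)).2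
  simp only [h, dite_true]
  have : ToType.mk ⟨(ToType.mk.symm (e k)).1, h⟩ = e k := ToType.mk.apply_symm_apply (e k)
  rw [this]
  exact Function.leftInverse_invFun e.injective k

/-- `s` is a coordinatewise continuous increasing chain of ordinals, starting at `h₀` and
exceeding `step` at successors. -/
structure ContinuousChain {ι : Type} (h₀ : ι → Ordinal.{0})
    (step : Ordinal.{0} → (Ordinal.{0} → ι → Ordinal.{0}) → ι → Ordinal.{0})
    (s : Ordinal.{0} → ι → Ordinal.{0}) : Prop where
  zero : s 0 = h₀
  lt : ∀ i α β, β < α → s β i < s α i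
  step_lt : ∀ i α β, β < α → step β s i < s α i
  exists_le : ∀ i α, ∀ a < s α i, a < h₀ i ∨ ∃ β < α, a ≤ max (s β i) (step β s i)

/-- A family of coordinatewise continuous increasing chains of ordinals. -/
theorem exists_continuous_chain {ι : Type} (h₀ : ι → Ordinal.{0})
    (step : Ordinal.{0} → (Ordinal.{0} → ι → Ordinal.{0}) → ι → Ordinal.{0})
    (hloc : ∀ β s s', (∀ γ ≤ β, s γ = s' γ) → step β s = step β s') :
    ∃ s : Ordinal.{0} → ι → Ordinal.{0}, ContinuousChain h₀ step s := by
  let S : ∀ α : Ordinal.{0}, (∀ β : Ordinal.{0}, β < α → ι → Ordinal.{0}) → ι → Ordinal.{0} :=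
    fun α hist i => max (h₀ i) (⨆ β : α.ToType,
      succ (max (hist (ToType.mk.symm β).1 (ToType.mk.symm β).2 i)
        (step (ToType.mk.symm β).1 (fun γ => if h : γ < α then hist γ h else h₀) i)))
  let s : Ordinal.{0} → ι → Ordinal.{0} := WellFounded.fix (r := (· < ·)) wellFounded_lt S
  have hs : ∀ α i, s α i = max (h₀ i) (⨆ β : α.ToType, succ (max (s (ToType.mk.symm β).1 i)
      (step (ToType.mk.symm β).1 s i))) := by
    intro α i
    have h1 : s α = S α (fun β _ => s β) := WellFounded.fix_eq (r := (· < ·)) wellFounded_lt S α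
    rw [h1]
    have : ∀ β : α.ToType, step (ToType.mk.symm β).1
        (fun γ => if _ : γ < α then s γ else h₀) = step (ToType.mk.symm β).1 s := by
      intro β
      refine hloc _ _ _ (fun γ hγ => ?_)
      have : γ < α := hγ.trans_lt (ToType.mk.symm β).2
      simp [this]
    simp only [S, this]
  have hlt : ∀ i α β, β < α → max (s β i) (step β s i) < s α i := by
    intro i α β hβ
    rw [hs α i, lt_max_iff]
    right
    refine succ_le_iff.1 ?_
    have := le_ciSup (f := fun β : α.ToType => succ (max (s (ToType.mk.symm β).1 i)
      (step (ToType.mk.symm β).1 s i))) Ordinal.bddAbove_of_small (ToType.mk ⟨β, hβ⟩)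
    simpa using this
  refine ⟨s, ?_, fun i α β hβ => (max_lt_iff.1 (hlt i α β hβ)).1,
    fun i α β hβ => (max_lt_iff.1 (hlt i α β hβ)).2, ?_⟩
  · ext i
    rw [hs]
    have : IsEmpty (0 : Ordinal.{0}).ToType := by simp
    rw [ciSup_of_empty]; simp
  · intro i α a ha
    rw [hs, lt_max_iff] at ha
    refine ha.imp id (fun ha => ?_)
    obtain ⟨β, hβ⟩ := exists_lt_of_lt_ciSup' ha
    exact ⟨_, (ToType.mk.symm β).2, lt_succ_iff.1 hβ⟩

/-- `exists_continuous_chain` staying inside a product of regular cardinals. -/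
theorem ContinuousChain.lt_of_step_lt {ι : Type} {h₀ : ι → Ordinal.{0}}
    {step : Ordinal.{0} → (Ordinal.{0} → ι → Ordinal.{0}) → ι → Ordinal.{0}}
    {s : Ordinal.{0} → ι → Ordinal.{0}} (hs : ContinuousChain h₀ step s)
    {o : Ordinal.{0}} (b : ι → Ordinal.{0}) (hb : ∀ i, o ≤ (b i).cof.ord) (h₀b : ∀ i, h₀ i < b i)
    (hstep : ∀ β < o, (∀ γ ≤ β, ∀ i, s γ i < b i) → ∀ i, step β s i < b i) :
    ∀ α < o, ∀ i, s α i < b i := by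
  intro α
  induction α using WellFoundedLT.induction with
  | ind α ih =>
  intro hα i
  rcases eq_or_ne α 0 with rfl | hne
  · rw [hs.zero]; exact h₀b i
  obtain ⟨c, hc, hcb⟩ := exists_bound_of_lt_cof_ordinal (o := b i) (a := α)
    (lt_ord.1 (hα.trans_le (hb i))) (fun β => max (s β i) (step β s i))
    (fun β hβ => max_lt (ih β hβ (hβ.trans hα) i)
      (hstep β (hβ.trans hα) (fun γ hγ => ih γ (hγ.trans_lt hβ) ((hγ.trans_lt hβ).trans hα)) i))
  by_contra! hcon
  rcases hs.exists_le i α (max c (h₀ i)) ((max_lt hc (h₀b i)).trans_le hcon) with h | ⟨β, hβ, h⟩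
  · exact absurd h (not_lt.2 (le_max_right _ _))
  · have h1 := hcb β hβ
    have h2 : c = max (s β i) (step β s i) := le_antisymm ((le_max_left _ _).trans h) h1
    rcases hs.exists_le i α (max (succ c) (h₀ i)) (by
      refine (max_lt ?_ (h₀b i)).trans_le hcon
      have hlim : IsSuccLimit (b i) := by
        rw [← one_lt_cof_iff]
        by_contra! h3
        have h4 : α < 1 := hα.trans_le ((hb i).trans (by simpa using ord_le_ord.2 h3))
        exact hne (Order.lt_one_iff.1 h4)
      exact hlim.succ_lt hc) with h | ⟨β', hβ', h⟩
    · exact absurd h (not_lt.2 (le_max_right _ _))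
    · exact absurd ((le_max_left _ _).trans (h.trans (hcb β' hβ'))) (not_le.2 (lt_succ c))

theorem ContinuousChain.exists_lt {ι : Type} {h₀ : ι → Ordinal.{0}}
    {step : Ordinal.{0} → (Ordinal.{0} → ι → Ordinal.{0}) → ι → Ordinal.{0}}
    {s : Ordinal.{0} → ι → Ordinal.{0}} (hs : ContinuousChain h₀ step s)
    {α : Ordinal.{0}} (hα : IsSuccLimit α) (i : ι) {a : Ordinal.{0}} (ha : a < s α i) :
    ∃ β < α, a < s β i := by
  rcases hs.exists_le i α a ha with h | ⟨β, hβ, h⟩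
  · exact ⟨0, hα.bot_lt, by rw [hs.zero]; exact h⟩
  · exact ⟨succ β, hα.succ_lt hβ, h.trans_lt (max_lt (hs.lt i _ β (lt_succ β))
      (hs.step_lt i _ β (lt_succ β)))⟩

/-- `C` is unbounded in `o` and contains its limit points below `o`. -/
def IsClubIn (o : Ordinal.{0}) (C : Set Ordinal.{0}) : Prop :=
  (∀ a < o, ∃ c ∈ C, a < c ∧ c < o) ∧
    ∀ x < o, 0 < x → (∀ a < x, ∃ c ∈ C, a < c ∧ c < x) → x ∈ C

theorem isSuccLimit_of_aleph0_lt_cof {o : Ordinal.{0}} (ho : ℵ₀ ≤ o.cof) : IsSuccLimit o :=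
  one_lt_cof_iff.1 (one_lt_aleph0.trans_le ho)

theorem exists_closed_above {o : Ordinal.{0}} (ho : ℵ₀ < o.cof) (M : Ordinal.{0} → Ordinal.{0})
    (hM : ∀ x < o, x < M x ∧ M x < o) {a : Ordinal.{0}} (ha : a < o) :
    ∃ b < o, a < b ∧ ∀ y < b, ∃ z < o, y < z ∧ M z < b := by
  let u : ℕ → Ordinal.{0} := fun n => M^[n] a
  have hu : ∀ n, u n < o := by
    intro n
    induction n with
    | zero => exact ha
    | succ n ih => simp only [u, Function.iterate_succ_apply']; exact (hM _ ih).2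
  have hs : ∀ n, u (n + 1) = M (u n) := fun n => Function.iterate_succ_apply' ..
  have hlt : ∀ n, u n < u (n + 1) := fun n => by rw [hs]; exact (hM _ (hu n)).1
  have hle : ∀ n, u n ≤ ⨆ n, u n := fun n => le_ciSup Ordinal.bddAbove_of_small n
  refine ⟨⨆ n, u n, iSup_lt_of_lt_cof (by simpa using ho) hu, (hlt 0).trans_le (hle 1), ?_⟩
  intro y hy
  obtain ⟨n, hn⟩ := exists_lt_of_lt_ciSup' hy
  refine ⟨u n, hu n, hn, ?_⟩
  rw [← hs]
  exact (hlt _).trans_le (hle _)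

theorem IsClubIn.iInter {o : Ordinal.{0}} (ho : ℵ₀ < o.cof) {K : Type} (hK : #K < o.cof)
    {C : K → Set Ordinal.{0}} (hC : ∀ k, IsClubIn o (C k)) : IsClubIn o {x | ∀ k, x ∈ C k} := by
  have hlim := isSuccLimit_of_aleph0_lt_cof ho.le
  have h1 : ∀ x, ∃ y, x < o → (x < y ∧ y < o ∧ ∀ k, ∃ c ∈ C k, x < c ∧ c ≤ y) := by
    intro x
    by_cases hx : x < o
    · choose c hc using fun k => (hC k).1 x hx
      obtain ⟨b, hb, hcb⟩ := exists_bound_of_lt_cof hK c (fun k => (hc k).2.2)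
      exact ⟨max b (succ x), fun _ => ⟨(lt_succ x).trans_le (le_max_right _ _),
        max_lt hb (hlim.succ_lt hx), fun k =>
          ⟨c k, (hc k).1, (hc k).2.1, (hcb k).trans (le_max_left _ _)⟩⟩⟩
    · exact ⟨0, fun h => absurd h hx⟩
  choose M hM using h1
  refine ⟨fun a ha => ?_, fun x hx h0 h k => (hC k).2 x hx h0 fun a ha => ?_⟩
  · obtain ⟨b, hb, hab, h⟩ := exists_closed_above ho M
      (fun x hx => ⟨(hM x hx).1, (hM x hx).2.1⟩) ha
    refine ⟨b, fun k => (hC k).2 b hb (by exact (zero_le (a := a)).trans_lt hab) fun y hy => ?_,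
      hab, hb⟩
    obtain ⟨z, hzo, hyz, hz⟩ := h y hy
    obtain ⟨c, hc, h1, h2⟩ := (hM z hzo).2.2 k
    exact ⟨c, hc, hyz.trans h1, h2.trans_lt hz⟩
  · obtain ⟨c, hc, h1, h2⟩ := h a ha
    exact ⟨c, hc k, h1, h2⟩

theorem IsClubIn.diagonal {κ : Cardinal.{0}} (hκ : κ.IsRegular) (hκ' : ℵ₀ < κ)
    {C : Ordinal.{0} → Set Ordinal.{0}} (hC : ∀ γ < κ.ord, IsClubIn κ.ord (C γ)) :
    IsClubIn κ.ord {x | 0 < x ∧ ∀ γ < x, x ∈ C γ} := by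
  have ho : ℵ₀ < κ.ord.cof := by rwa [hκ.cof_ord]
  have hlim := isSuccLimit_of_aleph0_lt_cof ho.le
  have h1 : ∀ x, ∃ y, x < κ.ord → (x < y ∧ y < κ.ord ∧ ∀ γ ≤ x, ∃ c ∈ C γ, x < c ∧ c ≤ y) := by
    intro x
    by_cases hx : x < κ.ord
    · have : ∀ γ, ∃ c, γ ≤ x → (c ∈ C γ ∧ x < c ∧ c < κ.ord) := by
        intro γ
        by_cases hγ : γ ≤ x
        · obtain ⟨c, hc⟩ := (hC γ (hγ.trans_lt hx)).1 x hx
          exact ⟨c, fun _ => hc⟩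
        · exact ⟨0, fun h => absurd h hγ⟩
      choose c hc using this
      obtain ⟨b, hb, hcb⟩ := exists_bound_of_regular_ordinal hκ (hlim.succ_lt hx) c
        (fun γ hγ => (hc γ (lt_succ_iff.1 hγ)).2.2)
      exact ⟨max b (succ x), fun _ => ⟨(lt_succ x).trans_le (le_max_right _ _),
        max_lt hb (hlim.succ_lt hx), fun γ hγ =>
          ⟨c γ, (hc γ hγ).1, (hc γ hγ).2.1,
            (hcb γ (lt_succ_iff.2 hγ)).le.trans (le_max_left _ _)⟩⟩⟩
    · exact ⟨0, fun h => absurd h hx⟩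
  choose M hM using h1
  refine ⟨fun a ha => ?_, fun x hx h0 h => ⟨h0, fun γ hγ =>
    (hC γ (hγ.trans hx)).2 x hx h0 fun a ha => ?_⟩⟩
  · obtain ⟨b, hb, hab, h⟩ := exists_closed_above ho M
      (fun x hx => ⟨(hM x hx).1, (hM x hx).2.1⟩) ha
    have h0 : 0 < b := (zero_le (a := a)).trans_lt hab
    refine ⟨b, ⟨h0, fun γ hγ => (hC γ (hγ.trans hb)).2 b hb h0 fun y hy => ?_⟩, hab, hb⟩
    obtain ⟨z, hzo, hyz, hz⟩ := h (max y γ) (max_lt hy hγ)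
    obtain ⟨c, hc, h1, h2⟩ := (hM z hzo).2.2 γ ((le_max_right _ _).trans hyz.le)
    exact ⟨c, hc, ((le_max_left _ _).trans_lt hyz).trans h1, h2.trans_lt hz⟩
  · obtain ⟨c, hc, h1, h2⟩ := h (max a γ) (max_lt ha hγ)
    exact ⟨c, hc.2 γ ((le_max_right _ _).trans_lt h1), (le_max_left _ _).trans_lt h1, h2⟩

/-- The closure points of a function form a club. -/
theorem isClubIn_closure {κ : Cardinal.{0}} (hκ : κ.IsRegular) (hκ' : ℵ₀ < κ)
    {N : Ordinal.{0} → Ordinal.{0}} (hN : ∀ x < κ.ord, N x < κ.ord) :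
    IsClubIn κ.ord {x | 0 < x ∧ ∀ γ < x, N γ < x} := by
  have ho : ℵ₀ < κ.ord.cof := by rwa [hκ.cof_ord]
  have hlim := isSuccLimit_of_aleph0_lt_cof ho.le
  refine IsClubIn.diagonal hκ hκ' (C := fun γ => {x | N γ < x}) fun γ hγ =>
    ⟨fun a ha => ⟨succ (max a (N γ)), ?_, ?_, hlim.succ_lt (max_lt ha (hN γ hγ))⟩, ?_⟩
  · exact (le_max_right a (N γ)).trans_lt (lt_succ (max a (N γ)))
  · exact (le_max_left a (N γ)).trans_lt (lt_succ (max a (N γ)))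
  · intro x _ h0 h
    obtain ⟨c, hc, _, h2⟩ := h 0 h0
    exact lt_trans hc h2

theorem IsClubIn.inter {o : Ordinal.{0}} (ho : ℵ₀ < o.cof) {C D : Set Ordinal.{0}}
    (hC : IsClubIn o C) (hD : IsClubIn o D) : IsClubIn o (C ∩ D) := by
  have := IsClubIn.iInter ho (K := Bool) (C := fun b => if b then C else D)
    ((lt_aleph0_of_finite _).trans ho) (by rintro (_ | _) <;> simpa)
  convert this using 1
  ext x
  simp [and_comm]

/-- Fodor's lemma. -/
theorem exists_stationary_fiber {κ : Cardinal.{0}} (hκ : κ.IsRegular) (hκ' : ℵ₀ < κ)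
    {S : Set Ordinal.{0}} (hS : ∀ C, IsClubIn κ.ord C → ∃ x < κ.ord, x ∈ S ∧ x ∈ C)
    (f : Ordinal.{0} → Ordinal.{0}) (hf : ∀ x ∈ S, x < κ.ord → 0 < x → f x < x) :
    ∃ γ < κ.ord, ∀ C, IsClubIn κ.ord C → ∃ x < κ.ord, x ∈ S ∧ f x = γ ∧ x ∈ C := by
  by_contra! hcon
  have : ∀ γ, ∃ C, γ < κ.ord → (IsClubIn κ.ord C ∧ ∀ x < κ.ord, x ∈ S → f x = γ → x ∉ C) := by
    intro γ
    by_cases hγ : γ < κ.ord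
    · obtain ⟨C, hC⟩ := hcon γ hγ
      exact ⟨C, fun _ => hC⟩
    · exact ⟨∅, fun h => absurd h hγ⟩
  choose C hC using this
  obtain ⟨x, hx, hxS, h0, hxC⟩ := hS _ (IsClubIn.diagonal hκ hκ' (fun γ hγ => (hC γ hγ).1))
  have hfx := hf x hxS hx h0
  exact (hC _ (hfx.trans hx)).2 x hx hxS rfl (hxC _ hfx)

theorem isNormal_of_continuous_chain {s : Ordinal.{0} → Ordinal.{0}}
    (hmono : ∀ α β, β < α → s β < s α)
    (hlim : ∀ α, IsSuccLimit α → ∀ a < s α, ∃ β < α, a < s β) : IsNormal s := by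
  refine isNormal_iff.2 ⟨fun a b h => hmono _ _ h, fun o ho a h => ?_⟩
  by_contra! hcon
  obtain ⟨β, hβ, h1⟩ := hlim o ho a hcon
  exact absurd (h β hβ) (not_le.2 h1)

/-- Every limit ordinal has a normal cofinal sequence. -/
theorem exists_normal_cofinal {o : Ordinal.{0}} (ho : ℵ₀ ≤ o.cof) :
    ∃ s : Ordinal.{0} → Ordinal.{0}, (∀ α β, β < α → s β < s α) ∧
      (∀ α < o.cof.ord, s α < o) ∧ (∀ a < o, ∃ α < o.cof.ord, a < s α) ∧
      ∀ α, IsSuccLimit α → ∀ a < s α, ∃ β < α, a < s β := by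
  obtain ⟨K, f, hK, hf, hcof⟩ := exists_cofinal_family o
  have hlim := isSuccLimit_of_aleph0_lt_cof ho
  have : Nonempty K := by
    obtain ⟨k, _⟩ := hcof 0 (by exact hlim.bot_lt); exact ⟨k⟩
  obtain ⟨e, he⟩ := exists_enumeration hK.le
  obtain ⟨s, hs⟩ := exists_continuous_chain (ι := Unit) (fun _ => 0)
    (fun β _ _ => f (e β)) (fun _ _ _ _ => rfl)
  refine ⟨fun α => s α (), fun α β h => hs.lt () α β h, fun α hα => ?_, fun a ha => ?_,
    fun α hα a ha => hs.exists_lt hα () ha⟩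
  · exact hs.lt_of_step_lt (fun _ => o) (fun _ => le_rfl) (fun _ => hlim.bot_lt)
      (fun β _ _ _ => hf _) α hα ()
  · obtain ⟨k, hk⟩ := hcof a ha
    obtain ⟨ξ, hξ, rfl⟩ := he k
    have hl : IsSuccLimit o.cof.ord := isSuccLimit_ord ho
    exact ⟨succ ξ, hl.succ_lt hξ, hk.trans_lt (hs.step_lt () _ ξ (lt_succ ξ))⟩

/-- The limit points of a club include one of any given smaller regular cofinality. -/
theorem IsClubIn.exists_cof_eq {κ ρ : Cardinal.{0}} (hκ : κ.IsRegular) (hρ : ρ.IsRegular)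
    (h : ρ < κ) {C : Set Ordinal.{0}} (hC : IsClubIn κ.ord C) :
    ∃ x < κ.ord, x.cof = ρ ∧ x ∈ C ∧ ∀ a < x, ∃ c ∈ C, a < c ∧ c < x := by
  have h1 : ∀ x, ∃ y, x < κ.ord → (y ∈ C ∧ x < y ∧ y < κ.ord) := by
    intro x
    by_cases hx : x < κ.ord
    · obtain ⟨c, hc⟩ := hC.1 x hx
      exact ⟨c, fun _ => hc⟩
    · exact ⟨0, fun h => absurd h hx⟩
  choose M hM using h1
  obtain ⟨s, hs⟩ := exists_continuous_chain (ι := Unit) (fun _ => 0)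
    (fun β s i => M (s β i)) (fun β s s' h => by ext; rw [h β le_rfl])
  have hlt : ∀ α < κ.ord, ∀ i, s α i < κ.ord :=
    hs.lt_of_step_lt (fun _ => κ.ord) (fun _ => by rw [hκ.cof_ord])
      (fun _ => hκ.ord_pos) (fun β _ hβ i => (hM _ (hβ β le_rfl i)).2.2)
  have hn : IsNormal (fun α => s α ()) := isNormal_of_continuous_chain
    (fun α β h => hs.lt () α β h)
    (fun α hα a ha => hs.exists_lt hα () ha)
  have hρl : IsSuccLimit ρ.ord := isSuccLimit_ord hρ.aleph0_le
  have hlim : ∀ a < s ρ.ord (), ∃ c ∈ C, a < c ∧ c < s ρ.ord () := by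
    intro a ha
    obtain ⟨β, hβ, h2⟩ := hs.exists_lt hρl () ha
    have h3 := hM _ (hlt β (hβ.trans (ord_lt_ord.2 h)) ())
    exact ⟨_, h3.1, h2.trans h3.2.1, hs.step_lt () _ β hβ⟩
  have hpos : 0 < s ρ.ord () := (zero_le (a := s 0 ())).trans_lt (hs.lt () _ 0 hρl.bot_lt)
  refine ⟨s ρ.ord (), hlt _ (ord_lt_ord.2 h) (), ?_, hC.2 _ (hlt _ (ord_lt_ord.2 h) ()) hpos hlim,
    hlim⟩
  rw [cof_map_of_isNormal hn hρl, hρ.cof_ord]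

theorem IsClubIn.sSup_mem {o : Ordinal.{0}} {E : Set Ordinal.{0}} (hE : IsClubIn o E)
    {γ : Ordinal.{0}} (hγ : γ < o) (h0 : sSup (E ∩ Iic γ) ≠ 0) : sSup (E ∩ Iic γ) ∈ E := by
  have hne : (E ∩ Iic γ).Nonempty := by
    by_contra hne
    rw [not_nonempty_iff_eq_empty] at hne
    simp [hne] at h0
  have hb : BddAbove (E ∩ Iic γ) := ⟨γ, fun x hx => hx.2⟩
  by_contra hcon
  have hle : sSup (E ∩ Iic γ) ≤ γ := csSup_le hne (fun x hx => hx.2)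
  refine hcon (hE.2 _ (hle.trans_lt hγ) (pos_iff_ne_zero.2 h0) fun a ha => ?_)
  obtain ⟨c, hc, hac⟩ := exists_lt_of_lt_csSup hne ha
  refine ⟨c, hc.1, hac, lt_of_le_of_ne (le_csSup hb hc) ?_⟩
  rintro rfl
  exact hcon hc.1

/-- Club guessing, before thinning out to increasing sequences. -/
theorem club_guessing_aux {ρ κ : Cardinal.{0}} (hκ : κ.IsRegular) (hρ : ρ.IsRegular)
    (h : succ ρ < κ) {e : Ordinal.{0} → Ordinal.{0} → Ordinal.{0}}
    (he : ∀ j < κ.ord, j.cof = ρ → ∀ k < ρ.ord, e j k < j) :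
    ∃ E, IsClubIn κ.ord E ∧ ∀ D, IsClubIn κ.ord D → ∃ j < κ.ord, j.cof = ρ ∧
      (∀ a < j, ∃ c ∈ E, a < c ∧ c < j) ∧
      ∀ k < ρ.ord, sSup (E ∩ Iic (e j k)) ≠ 0 → sSup (E ∩ Iic (e j k)) ∈ D := by
  by_contra! hcon
  have hκ' : ℵ₀ < κ := (hρ.aleph0_le.trans (le_succ ρ)).trans_lt h
  have ho : ℵ₀ < κ.ord.cof := by rwa [hκ.cof_ord]
  have : ∀ E, ∃ D, IsClubIn κ.ord E → (IsClubIn κ.ord D ∧ ∀ j < κ.ord, j.cof = ρ →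
      (∀ a < j, ∃ c ∈ E, a < c ∧ c < j) →
      ∃ k < ρ.ord, sSup (E ∩ Iic (e j k)) ≠ 0 ∧ sSup (E ∩ Iic (e j k)) ∉ D) := by
    intro E
    by_cases hE : IsClubIn κ.ord E
    · obtain ⟨D, hD⟩ := hcon E hE
      exact ⟨D, fun _ => hD⟩
    · exact ⟨∅, fun h => absurd h hE⟩
  choose D hD using this
  have hint : ∀ ζ < (succ (succ ρ)).ord, ∀ E : Ordinal.{0} → Set Ordinal.{0},
      (∀ η < ζ, IsClubIn κ.ord (E η)) → IsClubIn κ.ord {x | ∀ η < ζ, x ∈ E η} := by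
    intro ζ hζ E hE
    have := IsClubIn.iInter ho (K := ζ.ToType) (C := fun η => E (ToType.mk.symm η).1)
      (by rw [mk_toType', hκ.cof_ord]; exact (card_le_iff.2 hζ).trans_lt h)
      (fun η => hE _ (ToType.mk.symm η).2)
    convert this using 1
    ext x
    refine ⟨fun hx η => hx _ (ToType.mk.symm η).2, fun hx η hη => ?_⟩
    simpa using hx (ToType.mk ⟨η, hη⟩)
  obtain ⟨E, hE⟩ := exists_dependent_choice (A := Set Ordinal.{0}) (succ ρ).ord
    (fun ζ H a => IsClubIn κ.ord a ∧ ∀ η < ζ, a ⊆ H η ∧ a ⊆ D (H η))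
    (fun ζ _ H H' hH a ha => ⟨ha.1, fun η hη => by rw [← hH η hη]; exact ha.2 η hη⟩)
    (fun ζ hζ H hH => by
      have hζ' : ζ < (succ (succ ρ)).ord := hζ.trans (ord_lt_ord.2 (lt_succ _))
      exact ⟨_, (hint ζ hζ' _ (fun η hη => (hH η hη).1)).inter ho
        (hint ζ hζ' _ (fun η hη => (hD _ (hH η hη).1).1)),
        fun η hη => ⟨fun x hx => hx.1 η hη, fun x hx => hx.2 η hη⟩⟩)
  have hEs : ∀ ζ < (succ ρ).ord, IsClubIn κ.ord (E ζ) := fun ζ hζ => (hE ζ hζ).1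
  obtain ⟨j, hj, hjc, -, hjl⟩ := (hint (succ ρ).ord (ord_lt_ord.2 (lt_succ _)) E hEs).exists_cof_eq
    hκ hρ ((lt_succ ρ).trans h)
  have hanti : ∀ ζ ζ' γ, ζ ≤ ζ' → ζ' < (succ ρ).ord →
      sSup (E ζ' ∩ Iic γ) ≤ sSup (E ζ ∩ Iic γ) := by
    intro ζ ζ' γ hle hζ'
    rcases hle.eq_or_lt with rfl | hlt
    · exact le_rfl
    · rcases (E ζ' ∩ Iic γ).eq_empty_or_nonempty with he | hne
      · simp [he]
      · exact csSup_le_csSup ⟨γ, fun x hx => hx.2⟩ hne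
          (inter_subset_inter_left _ ((hE ζ' hζ').2 ζ hlt).1)
  have hstab : ∀ k, ∃ ζ < (succ ρ).ord, ∀ ζ', ζ ≤ ζ' → ζ' < (succ ρ).ord →
      sSup (E ζ' ∩ Iic (e j k)) = sSup (E ζ ∩ Iic (e j k)) := by
    intro k
    obtain ⟨v, ⟨ζ, hζ, rfl⟩, hv⟩ := WellFounded.has_min (r := (· < ·)) wellFounded_lt
      ((fun ζ => sSup (E ζ ∩ Iic (e j k))) '' Iio (succ ρ).ord)
      ⟨_, 0, (by exact (isSuccLimit_ord (hρ.aleph0_le.trans (le_succ ρ))).bot_lt), rfl⟩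
    exact ⟨ζ, hζ, fun ζ' hle hζ' => le_antisymm (hanti _ _ _ hle hζ')
      (not_lt.1 (hv _ ⟨ζ', hζ', rfl⟩))⟩
  choose z hz hzs using hstab
  have hreg : (succ ρ).IsRegular := isRegular_succ hρ.aleph0_le
  obtain ⟨ζ, hζ, hζb⟩ := exists_bound_of_regular_ordinal hreg (a := ρ.ord)
    (ord_lt_ord.2 (lt_succ ρ)) z (fun k _ => hz k)
  have hζ1 : succ ζ < (succ ρ).ord := (isSuccLimit_ord hreg.aleph0_le).succ_lt hζ
  obtain ⟨k, hk, h0, hkD⟩ := (hD _ (hEs ζ hζ)).2 j hj hjc (fun a ha => by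
    obtain ⟨c, hc, h1⟩ := hjl a ha
    exact ⟨c, hc ζ hζ, h1⟩)
  have heq : sSup (E (succ ζ) ∩ Iic (e j k)) = sSup (E ζ ∩ Iic (e j k)) := by
    rw [hzs k (succ ζ) ((hζb k hk).le.trans (le_succ ζ)) hζ1, hzs k ζ (hζb k hk).le hζ]
  rw [← heq] at h0 hkD
  exact hkD (((hE _ hζ1).2 ζ (lt_succ ζ)).2
    ((hEs _ hζ1).sSup_mem ((he j hj hjc k hk).trans hj) h0))

/-- Club guessing by increasing, nowhere continuous cofinal sequences. -/
theorem club_guessing {ρ κ : Cardinal.{0}} (hκ : κ.IsRegular) (hρ : ρ.IsRegular)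
    (h : succ ρ < κ) : ∃ g : Ordinal.{0} → Ordinal.{0} → Ordinal.{0},
      ∀ D, IsClubIn κ.ord D → ∃ j < κ.ord, j.cof = ρ ∧
        (∀ k < ρ.ord, g j k ∈ D ∧ g j k < j ∧ ∃ b < g j k, ∀ k' < k, g j k' ≤ b) ∧
        ∀ a < j, ∃ k < ρ.ord, a < g j k := by
  have he : ∀ j, ∃ e : Ordinal.{0} → Ordinal.{0}, j < κ.ord → j.cof = ρ →
      (∀ k < ρ.ord, e k < j) ∧ ∀ a < j, ∃ k < ρ.ord, a < e k := by
    intro j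
    by_cases hj : j.cof = ρ
    · obtain ⟨s, -, h1, h2, -⟩ := exists_normal_cofinal (o := j) (hj ▸ hρ.aleph0_le)
      rw [hj] at h1 h2
      exact ⟨s, fun _ _ => ⟨h1, h2⟩⟩
    · exact ⟨fun _ => 0, fun _ h => absurd h hj⟩
  choose e he using he
  obtain ⟨E, hE, hguess⟩ := club_guessing_aux hκ hρ h (e := e) (fun j hj hjc => (he j hj hjc).1)
  have hg : ∀ j, ∃ g : Ordinal.{0} → Ordinal.{0}, j < κ.ord → j.cof = ρ →
      (∀ a < j, ∃ c ∈ E, a < c ∧ c < j) →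
      ∀ k < ρ.ord, (∃ k', k' < ρ.ord ∧ g k = sSup (E ∩ Iic (e j k'))) ∧ e j k < g k ∧ g k < j ∧
        ∃ b < g k, ∀ k' < k, g k' ≤ b := by
    intro j
    by_cases hj : j < κ.ord ∧ j.cof = ρ ∧ ∀ a < j, ∃ c ∈ E, a < c ∧ c < j
    · obtain ⟨hj, hjc, hjE⟩ := hj
      obtain ⟨g, hg⟩ := exists_dependent_choice (A := Ordinal.{0}) ρ.ord
        (fun k H a => (∃ k', k' < ρ.ord ∧ a = sSup (E ∩ Iic (e j k'))) ∧ e j k < a ∧ a < j ∧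
          ∃ b < a, ∀ k' < k, H k' ≤ b)
        (fun k _ H H' hH a ha => ⟨ha.1, ha.2.1, ha.2.2.1, by
          obtain ⟨b, hb, h⟩ := ha.2.2.2
          exact ⟨b, hb, fun k' hk' => by rw [← hH k' hk']; exact h k' hk'⟩⟩)
        (fun k hk H hH => by
          obtain ⟨b, hb, hHb⟩ := exists_bound_of_lt_cof_ordinal (o := j) (a := k)
            (by rw [hjc]; exact lt_ord.1 hk) H (fun k' hk' => (hH k' hk').2.2.1)
          obtain ⟨c, hc, h1, h2⟩ := hjE (max b (e j k)) (max_lt hb ((he j hj hjc).1 k hk))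
          obtain ⟨k', hk', h3⟩ := (he j hj hjc).2 c h2
          have h4 : c ≤ sSup (E ∩ Iic (e j k')) :=
            le_csSup ⟨e j k', fun x hx => hx.2⟩ ⟨hc, h3.le⟩
          have h5 : sSup (E ∩ Iic (e j k')) ≤ e j k' := csSup_le ⟨c, hc, h3.le⟩ (fun x hx => hx.2)
          exact ⟨_, ⟨k', hk', rfl⟩, ((le_max_right _ _).trans_lt h1).trans_le h4,
            h5.trans_lt ((he j hj hjc).1 k' hk'), b, ((le_max_left _ _).trans_lt h1).trans_le h4,
            hHb⟩)
      exact ⟨g, fun _ _ _ => hg⟩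
    · exact ⟨fun _ => 0, fun h1 h2 h3 => absurd ⟨h1, h2, h3⟩ hj⟩
  choose g hg using hg
  refine ⟨g, fun D hD => ?_⟩
  obtain ⟨j, hj, hjc, hjE, hjD⟩ := hguess D hD
  have hgj := hg j hj hjc hjE
  refine ⟨j, hj, hjc, fun k hk => ⟨?_, (hgj k hk).2.2⟩, fun a ha => ?_⟩
  · obtain ⟨⟨k', hk', h1⟩, h2, -⟩ := hgj k hk
    rw [h1] at h2 ⊢
    exact hjD k' hk' (pos_iff_ne_zero.1 ((zero_le).trans_lt h2))
  · obtain ⟨k, hk, h1⟩ := (he j hj hjc).2 a ha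
    exact ⟨k, hk, h1.trans (hgj k hk).2.1⟩

/-- `h` belongs to the product of the cardinals `φ i`. -/
def InProd {ι : Type} (φ : ι → Cardinal.{0}) (h : ι → Ordinal.{0}) : Prop :=
  ∀ i, h i < (φ i).ord

/-- The restricted product `∏ i ∈ b, φ i` is dominated by fewer than `ν` (or countably many)
functions. -/
def Dominated {ι : Type} (φ : ι → Cardinal.{0}) (ν : Cardinal.{0}) (b : Set ι) : Prop :=
  ∃ (K : Type) (g : K → ι → Ordinal.{0}), #K < max ν ℵ₁ ∧
    ∀ h, InProd φ h → ∃ k, ∀ i ∈ b, h i ≤ g k i ∧ g k i < (φ i).ord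

theorem Dominated.subset {ι : Type} {φ : ι → Cardinal.{0}} {ν : Cardinal.{0}} {b c : Set ι}
    (hb : Dominated φ ν b) (h : c ⊆ b) : Dominated φ ν c := by
  obtain ⟨K, g, hK, hg⟩ := hb
  exact ⟨K, g, hK, fun f hf => (hg f hf).imp fun k hk i hi => hk i (h hi)⟩

theorem Dominated.mono {ι : Type} {φ : ι → Cardinal.{0}} {ν ν' : Cardinal.{0}} {b : Set ι}
    (hb : Dominated φ ν b) (h : ν ≤ ν') : Dominated φ ν' b := by
  obtain ⟨K, g, hK, hg⟩ := hb
  exact ⟨K, g, hK.trans_le (max_le_max_right _ h), hg⟩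

theorem Dominated.union {ι : Type} {φ : ι → Cardinal.{0}} {ν : Cardinal.{0}} {b c : Set ι}
    (hb : Dominated φ ν b) (hc : Dominated φ ν c) : Dominated φ ν (b ∪ c) := by
  classical
  obtain ⟨K, g, hK, hg⟩ := hb
  obtain ⟨L, f, hL, hf⟩ := hc
  refine ⟨K × L, fun p i => if i ∈ b then g p.1 i else f p.2 i, ?_, fun h hh => ?_⟩
  · rw [mk_prod, Cardinal.lift_id, Cardinal.lift_id]
    exact mul_lt_of_lt (aleph0_lt_aleph_one.le.trans (le_max_right _ _)) hK hL
  · obtain ⟨k, hk⟩ := hg h hh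
    obtain ⟨l, hl⟩ := hf h hh
    refine ⟨(k, l), fun i hi => ?_⟩
    by_cases hib : i ∈ b
    · simpa [hib] using hk i hib
    · simpa [hib] using hl i (hi.resolve_left hib)

theorem dominated_empty {ι : Type} (φ : ι → Cardinal.{0}) (ν : Cardinal.{0}) :
    Dominated φ ν ∅ :=
  ⟨Unit, fun _ _ => 0, (lt_aleph0_of_finite _).trans
    (aleph0_lt_aleph_one.trans_le (le_max_right _ _)), fun _ _ => ⟨(), by simp⟩⟩

/-- The filter dual to the ideal of sets with restricted product dominated by fewer than `ν`
functions. -/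
def domFilter {ι : Type} (φ : ι → Cardinal.{0}) (ν : Cardinal.{0}) : Filter ι where
  sets := {s | Dominated φ ν sᶜ}
  univ_sets := by simpa using dominated_empty φ ν
  sets_of_superset := fun h hst => h.subset (compl_subset_compl.2 hst)
  inter_sets := fun h h' => by
    simp only [Set.mem_ofPred_eq, compl_inter] at *
    exact h.union h'

theorem eventually_domFilter {ι : Type} {φ : ι → Cardinal.{0}} {ν : Cardinal.{0}} {p : ι → Prop} :
    (∀ᶠ i in domFilter φ ν, p i) ↔ Dominated φ ν {i | ¬ p i} := Iff.rfl

theorem eventually_notMem_domFilter {ι : Type} {φ : ι → Cardinal.{0}} {ν : Cardinal.{0}}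
    {b : Set ι} : (∀ᶠ i in domFilter φ ν, i ∉ b) ↔ Dominated φ ν b := by
  rw [eventually_domFilter]
  simp

theorem domFilter_anti {ι : Type} {φ : ι → Cardinal.{0}} {ν ν' : Cardinal.{0}} (h : ν ≤ ν') :
    domFilter φ ν' ≤ domFilter φ ν := fun _ hs => Dominated.mono (φ := φ) hs h

theorem dominated_of_forall_le {ι : Type} {φ : ι → Cardinal.{0}} {ν : Cardinal.{0}} {b : Set ι}
    {K : Type} (hK : #K < max ν ℵ₁) (g : K → ι → Ordinal.{0}) (hg : ∀ k, InProd φ (g k))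
    (h : ∀ h, InProd φ h → ∃ k, ∀ i ∈ b, h i ≤ g k i) : Dominated φ ν b :=
  ⟨K, g, hK, fun f hf => (h f hf).imp fun k hk i hi => ⟨hk i hi, hg k i⟩⟩

theorem Dominated.exists_family {ι : Type} {φ : ι → Cardinal.{0}} (hφ : ∀ i, (φ i).IsRegular)
    {ν : Cardinal.{0}} {b : Set ι} (hb : Dominated φ ν b) :
    ∃ (K : Type) (g : K → ι → Ordinal.{0}), #K < max ν ℵ₁ ∧ (∀ k, InProd φ (g k)) ∧
      ∀ h, InProd φ h → ∃ k, ∀ i ∈ b, h i ≤ g k i := by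
  classical
  obtain ⟨K, g, hK, hg⟩ := hb
  refine ⟨K, fun k i => if g k i < (φ i).ord then g k i else 0, hK, fun k i => ?_, fun h hh => ?_⟩
  · dsimp only
    split_ifs with h
    · exact h
    · exact (hφ i).ord_pos
  · refine (hg h hh).imp fun k hk i hi => ?_
    dsimp only
    rw [if_pos (hk i hi).2]
    exact (hk i hi).1

/-- Pointwise bounds for small families. -/
theorem exists_pointwise_bound {ι : Type} {φ : ι → Cardinal.{0}} (hφ : ∀ i, (φ i).IsRegular)
    {K : Type} (hK : ∀ i, #K < φ i) (G : K → ι → Ordinal.{0}) (hG : ∀ k, InProd φ (G k)) :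
    ∃ h, InProd φ h ∧ ∀ k i, G k i < h i := by
  choose h hh using fun i => exists_bound_of_regular (hφ i) (hK i) (fun k => G k i)
    (fun k => hG k i)
  exact ⟨h, fun i => (hh i).1, fun k i => (hh i).2 k⟩

theorem InProd.succ {ι : Type} {φ : ι → Cardinal.{0}} (hφ : ∀ i, (φ i).IsRegular)
    {h : ι → Ordinal.{0}} (hh : InProd φ h) : InProd φ (fun i => succ (h i)) :=
  fun i => (isSuccLimit_ord (hφ i).aleph0_le).succ_lt (hh i)

theorem InProd.max {ι : Type} {φ : ι → Cardinal.{0}} {h g : ι → Ordinal.{0}}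
    (hh : InProd φ h) (hg : InProd φ g) : InProd φ (fun i => max (h i) (g i)) :=
  fun i => max_lt (hh i) (hg i)

/-- Chains of functions in a product, each exceeding a prescribed step of the previous ones. -/
theorem exists_prod_chain {ι : Type} {φ : ι → Cardinal.{0}} (hφ : ∀ i, (φ i).IsRegular)
    {κ : Cardinal.{0}} (hκ : ∀ i, κ < φ i) (step : (ι → Ordinal.{0}) → ι → Ordinal.{0})
    (hstep : ∀ h, InProd φ h → InProd φ (step h)) :
    ∃ H : Ordinal.{0} → ι → Ordinal.{0}, ∀ α ≤ κ.ord, InProd φ (H α) ∧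
      ∀ β < α, ∀ i, H β i ≤ H α i ∧ step (H β) i ≤ H α i := by
  obtain ⟨H, hH⟩ := exists_dependent_choice (A := ι → Ordinal.{0}) (succ κ.ord)
    (fun α H a => InProd φ a ∧ ∀ β < α, ∀ i, H β i ≤ a i ∧ step (H β) i ≤ a i)
    (fun α _ H H' h a ha => ⟨ha.1, fun β hβ => by rw [← h β hβ]; exact ha.2 β hβ⟩)
    (fun α hα H hH => by
      obtain ⟨h, hh, hb⟩ := exists_pointwise_bound hφ (K := α.ToType) (fun i => by
          rw [mk_toType']
          have := card_le_card (lt_succ_iff.1 hα)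
          rw [card_ord] at this
          exact this.trans_lt (hκ i))
        (fun β i => max (H (ToType.mk.symm β).1 i) (step (H (ToType.mk.symm β).1) i))
        (fun β => (hH _ (ToType.mk.symm β).2).1.max (hstep _ (hH _ (ToType.mk.symm β).2).1))
      refine ⟨h, hh, fun β hβ i => ?_⟩
      have := hb (ToType.mk ⟨β, hβ⟩) i
      simp only [OrderIso.symm_apply_apply, max_lt_iff] at this
      exact ⟨this.1.le, this.2.le⟩)
  exact ⟨H, fun α hα => hH α (lt_succ_iff.2 hα)⟩

theorem exists_increasing_majorant {ι : Type} {φ : ι → Cardinal.{0}} {F : Filter ι}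
    {ζ : Ordinal.{0}}
    (hdir : ∀ (K : Type), #K < ζ.card → ∀ G : K → ι → Ordinal.{0}, (∀ k, InProd φ (G k)) →
      ∃ h, InProd φ h ∧ ∀ k, ∀ᶠ i in F, G k i ≤ h i)
    (hζ : ζ.card.ord = ζ) (hζ' : ℵ₀ ≤ ζ.card)
    (G : Ordinal.{0} → ι → Ordinal.{0}) (hG : ∀ ξ < ζ, InProd φ (G ξ)) :
    ∃ g : Ordinal.{0} → ι → Ordinal.{0}, ∀ ξ < ζ, InProd φ (g ξ) ∧
      (∀ᶠ i in F, G ξ i ≤ g ξ i) ∧ ∀ η < ξ, ∀ᶠ i in F, g η i ≤ g ξ i := by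
  refine exists_dependent_choice (A := ι → Ordinal.{0}) ζ
    (fun ξ H a => InProd φ a ∧ (∀ᶠ i in F, G ξ i ≤ a i) ∧ ∀ η < ξ, ∀ᶠ i in F, H η i ≤ a i)
    (fun ξ _ H H' h a ha => ⟨ha.1, ha.2.1, fun β hβ => by rw [← h β hβ]; exact ha.2.2 β hβ⟩)
    (fun ξ hξ H hH => ?_)
  have hcard : ξ.card < ζ.card := by rw [← hζ] at hξ; exact lt_ord.1 hξ
  obtain ⟨h, hh, hb⟩ := hdir (Option ξ.ToType) (by
      rw [mk_option, mk_toType']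
      exact add_lt_of_lt hζ' hcard (one_lt_aleph0.trans_le hζ'))
    (fun o => o.elim (G ξ) (fun β => H (ToType.mk.symm β).1))
    (by rintro (_ | β)
        · exact hG ξ hξ
        · exact (hH _ (ToType.mk.symm β).2).1)
  refine ⟨h, hh, hb none, fun η hη => ?_⟩
  have := hb (some (ToType.mk ⟨η, hη⟩))
  simpa using this

/-- Directedness of a product modulo the ideal of `ν`-dominated sets. -/
theorem exists_eventual_bound {ι : Type} {φ : ι → Cardinal.{0}} (hφ : ∀ i, (φ i).IsRegular)
    {κ : Cardinal.{0}} (hι : #ι < κ) (hκφ : ∀ i, κ < φ i) (hκ : ℵ₀ ≤ κ)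
    {ν : Cardinal.{0}} (hν : ℵ₀ ≤ ν) (K : Type) (hK : #K ≤ ν) (G : K → ι → Ordinal.{0})
    (hG : ∀ k, InProd φ (G k)) :
    ∃ h, InProd φ h ∧ ∀ k, ∀ᶠ i in domFilter φ (succ ν), G k i ≤ h i := by
  obtain ⟨ζ, hζK⟩ : ∃ ζ, ζ = #K := ⟨_, rfl⟩
  induction ζ using WellFoundedLT.induction generalizing K with
  | ind ζ ih =>
  set F := domFilter φ (succ ν)
  rcases le_or_gt ζ κ with hle | hlt
  · obtain ⟨h, hh, hb⟩ := exists_pointwise_bound hφ (fun i => (hζK ▸ hle).trans_lt (hκφ i)) G hG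
    exact ⟨h, hh, fun k => Eventually.of_forall fun i => (hb k i).le⟩
  have hζ0 : ℵ₀ ≤ ζ := hκ.trans hlt.le
  have : Nonempty K := by rw [← mk_ne_zero_iff, ← hζK]; exact (aleph0_pos.trans_le hζ0).ne'
  obtain ⟨e, he⟩ := exists_enumeration hζK.ge
  obtain ⟨g, hg⟩ := exists_increasing_majorant (F := F) (ζ := ζ.ord)
    (fun L hL G' hG' => ih #L (by simpa using hL) L
      ((by simpa using hL.le : #L ≤ ζ).trans (hζK ▸ hK)) G' hG' rfl)
    (by simp) (by simpa) (fun ξ => G (e ξ)) (fun ξ _ => hG _)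
  suffices ∃ h, InProd φ h ∧ ∀ ξ < ζ.ord, ∀ᶠ i in F, g ξ i ≤ h i by
    obtain ⟨h, hh, hb⟩ := this
    refine ⟨h, hh, fun k => ?_⟩
    obtain ⟨ξ, hξ, rfl⟩ := he k
    filter_upwards [hb ξ hξ, (hg ξ hξ).2.1] with i h1 h2 using h2.trans h1
  have hmono : ∀ ξ < ζ.ord, ∀ η ≤ ξ, ∀ᶠ i in F, g η i ≤ g ξ i := by
    intro ξ hξ η hη
    rcases hη.eq_or_lt with rfl | hη
    · exact Eventually.of_forall fun i => le_rfl
    · exact (hg ξ hξ).2.2 η hη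
  rcases le_or_gt ζ.ord.cof κ with hcof | hcof
  · obtain ⟨L, f, hL, hf, hfc⟩ := exists_cofinal_family ζ.ord
    obtain ⟨h, hh, hb⟩ := exists_pointwise_bound hφ
      (fun i => (hL.trans_le hcof).trans_lt (hκφ i)) (fun k => g (f k)) (fun k => (hg _ (hf k)).1)
    refine ⟨h, hh, fun ξ hξ => ?_⟩
    obtain ⟨k, hk⟩ := hfc ξ hξ
    filter_upwards [hmono _ (hf k) ξ hk] with i hi using hi.trans (hb k i).le
  by_contra! hcon
  have hstep : ∀ h, ∃ (ξ : Ordinal.{0}) (h' : ι → Ordinal.{0}), InProd φ h → ξ < ζ.ord ∧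
      InProd φ h' ∧ ∀ η < ζ.ord, ξ ≤ η → ∃ i, h i < g η i ∧ g η i ≤ h' i := by
    intro h
    by_cases hh : InProd φ h
    swap
    · exact ⟨0, h, fun h' => absurd h' hh⟩
    obtain ⟨ξ, hξ, hξh⟩ := hcon h hh
    by_contra! hno
    refine hξh ?_
    have hno' : ∀ h', InProd φ h' → ∃ η < ζ.ord, ξ ≤ η ∧ ∀ i, h i < g η i → h' i < g η i := by
      intro h' hh'
      obtain ⟨-, h1⟩ := hno ξ h'
      exact h1 hξ hh'
    have hfam : ∀ a : {a : ζ.ord.ToType // ξ ≤ (ToType.mk.symm a).1}, ∃ (L : Type)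
        (G' : L → ι → Ordinal.{0}), #L < max (succ ν) ℵ₁ ∧ (∀ k, InProd φ (G' k)) ∧
          ∀ h, InProd φ h → ∃ k, ∀ i ∈ {i | ¬ g ξ i ≤ g (ToType.mk.symm a.1).1 i}, h i ≤ G' k i :=
      fun a => Dominated.exists_family hφ
        (eventually_domFilter.1 (hmono _ (ToType.mk.symm a.1).2 _ a.2))
    choose L G' hL hG' hdom using hfam
    refine eventually_domFilter.2 (dominated_of_forall_le (K := Σ a, L a) ?_
      (fun p i => max (g (ToType.mk.symm p.1.1).1 i) (G' p.1 p.2 i))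
      (fun p => (hg _ (ToType.mk.symm p.1.1).2).1.max (hG' p.1 p.2)) fun f hf => ?_)
    · refine lt_max_of_lt_left (lt_succ_iff.2 ?_)
      rw [mk_sigma]
      have hLν : ∀ a, #(L a) ≤ ν := fun a => by
        have := hL a
        rw [max_eq_left] at this
        · exact lt_succ_iff.1 this
        · rw [← succ_aleph0]; exact succ_le_succ hν
      refine (sum_le_sum _ _ hLν).trans ?_
      rw [sum_const']
      refine (mul_le_mul_left ((mk_subtype_le _).trans ?_) ν).trans (mul_eq_self hν).le
      rw [mk_toType', card_ord]
      exact hζK ▸ hK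
    · obtain ⟨η, hη, hξη, hη'⟩ := hno' f hf
      obtain ⟨k, hk⟩ := hdom ⟨ToType.mk ⟨η, hη⟩, by simpa using hξη⟩ f hf
      refine ⟨⟨⟨ToType.mk ⟨η, hη⟩, by simpa using hξη⟩, k⟩, fun i hi => ?_⟩
      simp only [OrderIso.symm_apply_apply, Set.mem_ofPred_eq, not_le] at hk hi ⊢
      rcases lt_or_ge (g η i) (g ξ i) with h1 | h1
      · exact (hk i h1).trans (le_max_right _ _)
      · exact (hη' i ((not_not.1 hi).trans_le h1)).le.trans (le_max_left _ _)
  choose X H' hXH using hstep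
  obtain ⟨H, hH⟩ := exists_prod_chain hφ hκφ (fun h i => max (h i) (H' h i)) (fun h hh => by
    by_cases hX : InProd φ (H' h)
    · exact hh.max hX
    · exact absurd (hXH h hh).2.1 hX)
  obtain ⟨ξ, hξ, hξb⟩ := exists_bound_of_lt_cof_ordinal (o := ζ.ord) (a := κ.ord)
    (by rwa [card_ord]) (fun α => X (H α)) (fun α hα => (hXH _ (hH α hα.le).1).1)
  have hy : ∀ α, ∃ i, α < κ.ord → H α i < g ξ i ∧ g ξ i ≤ H' (H α) i := by
    intro α
    by_cases hα : α < κ.ord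
    · obtain ⟨i, hi⟩ := (hXH _ (hH α hα.le).1).2.2 ξ hξ (hξb α hα)
      exact ⟨i, fun _ => hi⟩
    · obtain ⟨i, -⟩ := (hXH _ (hH 0 (zero_le (a := κ.ord))).1).2.2 ξ hξ
        (hξb 0 (ord_pos.2 (aleph0_pos.trans_le hκ)))
      exact ⟨i, fun h => absurd h hα⟩
  choose y hy using hy
  obtain ⟨α, β, hαβ, hβ, he⟩ := exists_eq_of_card_lt hι y
  have h1 := (hy α (hαβ.trans hβ)).2
  have h2 := ((hH β hβ.le).2 α hαβ (y α)).2
  have h3 := (hy β hβ).1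
  rw [← he] at h3
  exact absurd (h1.trans ((le_max_right _ _).trans h2)) (not_le.2 h3)

/-- `s` restricted to the ordinals up to `i`. -/
noncomputable def upTo (s : Ordinal.{0} → Ordinal.{0}) (i : Ordinal.{0}) :
    Ordinal.{0} → Ordinal.{0} :=
  fun γ => if γ ≤ i then s γ else 0

/-- Normal functions growing faster than a prescribed step. -/
theorem exists_normal_of_step (a₀ : Ordinal.{0})
    (step : Ordinal.{0} → (Ordinal.{0} → Ordinal.{0}) → Ordinal.{0}) :
    ∃ s : Ordinal.{0} → Ordinal.{0}, IsNormal s ∧ s 0 = a₀ ∧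
      (∀ i α, i < α → step i (upTo s i) < s α) ∧
      ∀ o b : Ordinal.{0}, o ≤ b.cof.ord → a₀ < b →
        (∀ β < o, (∀ γ ≤ β, s γ < b) → step β (upTo s β) < b) → ∀ α < o, s α < b := by
  obtain ⟨s, hs⟩ := exists_continuous_chain (ι := Unit) (fun _ => a₀)
    (fun i s _ => step i (upTo (fun γ => s γ ()) i)) (fun β s s' h => by
      have : upTo (fun γ => s γ ()) β = upTo (fun γ => s' γ ()) β := by
        funext γ
        unfold upTo
        split_ifs with hγ
        · dsimp only
          rw [h γ hγ]
        · rfl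
      simp only [this])
  refine ⟨fun i => s i (), isNormal_of_continuous_chain (fun α β h => hs.lt () α β h)
    (fun α hα a ha => hs.exists_lt hα () ha), by dsimp only; rw [hs.zero],
    fun i α h => hs.step_lt () α i h, fun o b hob hb hst α hα => ?_⟩
  exact hs.lt_of_step_lt (fun _ => b) (fun _ => hob) (fun _ => hb)
    (fun β hβ h _ => hst β hβ fun γ hγ => h γ hγ ()) α hα ()

theorem isClubIn_preimage {ξ : Ordinal.{0} → Ordinal.{0}} (hξ : IsNormal ξ) {o : Ordinal.{0}}
    (ho : ℵ₀ < o.cof) {e : Set Ordinal.{0}} (he : IsClubIn (ξ o) e) :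
    IsClubIn o {i | ξ i ∈ e} := by
  have hlim := isSuccLimit_of_aleph0_lt_cof ho.le
  have hex : ∀ x < ξ o, ∃ i < o, x < ξ i := fun x hx => by
    simpa using (hξ.lt_iff_exists_lt hlim).1 hx
  have hlim' : ∀ x < o, 0 < x → (∀ a < x, ∃ c, a < c ∧ c < x) → IsSuccLimit x := by
    intro x _ h0 h
    rw [isSuccLimit_iff, isSuccPrelimit_iff_succ_lt]
    exact ⟨by simpa using h0.ne', fun a ha => by
      obtain ⟨c, h1, h2⟩ := h a ha
      exact (succ_le_iff.2 h1).trans_lt h2⟩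
  refine ⟨fun a ha => ?_, fun x hx h0 h => ?_⟩
  · have hM : ∀ x, ∃ y, x < o → x < y ∧ y < o ∧ ∃ c ∈ e, ξ x < c ∧ c < ξ y := by
      intro x
      by_cases hx : x < o
      · obtain ⟨c, hc, h1, h2⟩ := he.1 (ξ x) (hξ.strictMono hx)
        obtain ⟨y, hy, h3⟩ := hex c h2
        exact ⟨y, fun _ => ⟨hξ.strictMono.lt_iff_lt.1 (h1.trans h3), hy, c, hc, h1, h3⟩⟩
      · exact ⟨0, fun h => absurd h hx⟩
    choose M hM using hM
    obtain ⟨b, hb, hab, hcl⟩ := exists_closed_above ho M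
      (fun x hx => ⟨(hM x hx).1, (hM x hx).2.1⟩) ha
    refine ⟨b, he.2 _ (hξ.strictMono hb) ((zero_le (a := _)).trans_lt (hξ.strictMono hab))
      (fun x hx => ?_), hab, hb⟩
    have hbl : IsSuccLimit b := hlim' b hb ((zero_le (a := _)).trans_lt hab) fun y hy => by
      obtain ⟨z, hz, h1, h2⟩ := hcl y hy
      exact ⟨z, h1, (hM z hz).1.trans h2⟩
    obtain ⟨y, hy, hxy⟩ := (hξ.lt_iff_exists_lt hbl).1 hx
    obtain ⟨z, hz, h1, h2⟩ := hcl y hy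
    obtain ⟨c, hc, h3, h4⟩ := (hM z hz).2.2
    exact ⟨c, hc, hxy.trans ((hξ.strictMono h1).trans h3), h4.trans (hξ.strictMono h2)⟩
  · refine he.2 _ (hξ.strictMono hx) ((zero_le (a := _)).trans_lt (hξ.strictMono h0)) fun y hy => ?_
    have hxl := hlim' x hx h0 fun a ha => by
      obtain ⟨c, -, h1⟩ := h a ha
      exact ⟨c, h1⟩
    obtain ⟨i, hi, hyi⟩ := (hξ.lt_iff_exists_lt hxl).1 hy
    obtain ⟨c, hc, h1, h2⟩ := h i hi
    exact ⟨ξ c, hc, hyi.trans (hξ.strictMono h1), hξ.strictMono h2⟩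

theorem isClubIn_image {ξ : Ordinal.{0} → Ordinal.{0}} (hξ : IsNormal ξ) {o : Ordinal.{0}}
    (ho : IsSuccLimit o) : IsClubIn (ξ o) {x | (∃ i < o, ξ i = x)} := by
  refine ⟨fun a ha => ?_, fun x hx h0 h => ?_⟩
  · obtain ⟨i, hi, h⟩ := (hξ.lt_iff_exists_lt ho).1 ha
    exact ⟨ξ i, ⟨i, hi, rfl⟩, h, hξ.strictMono hi⟩
  · obtain ⟨i, hi, hxi⟩ := (hξ.lt_iff_exists_lt ho).1 hx
    have hP : {i | x ≤ ξ i}.Nonempty := ⟨i, hxi.le⟩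
    set m := sInf {i | x ≤ ξ i}
    have hm : x ≤ ξ m := csInf_mem hP
    have hmin : ∀ k < m, ξ k < x := fun k hk => not_le.1 fun h' => notMem_of_lt_csInf' hk h'
    have hlt : ∀ k, ξ k < x → k < m := fun k hk =>
      not_le.1 fun h' => absurd (hm.trans (hξ.strictMono.monotone h')) (not_le.2 hk)
    have hmi : m ≤ i := csInf_le' hxi.le
    refine ⟨m, hmi.trans_lt hi, hm.antisymm' (not_lt.1 fun hxm => ?_)⟩
    have hml : IsSuccLimit m := by
      rw [isSuccLimit_iff, isSuccPrelimit_iff_succ_lt]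
      refine ⟨?_, fun a ha => ?_⟩
      · obtain ⟨_, ⟨j, -, rfl⟩, -, hj⟩ := h 0 h0
        simpa using ((zero_le (a := j)).trans_lt (hlt j hj)).ne'
      · obtain ⟨_, ⟨j, -, rfl⟩, h1, hj⟩ := h _ (hmin a ha)
        exact (succ_le_iff.2 (hξ.strictMono.lt_iff_lt.1 h1)).trans_lt (hlt j hj)
    obtain ⟨k, hk, h1⟩ := (hξ.lt_iff_exists_lt hml).1 hxm
    exact absurd h1 (hmin k hk).not_gt

/-- Strongly increasing subsequences of a sequence of functions increasing modulo a filter. -/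
theorem exists_strongly_increasing {ι : Type} {F : Filter ι} {Θ ν : Cardinal.{0}} (hΘ : ℵ₀ ≤ Θ)
    (hν : ν.IsRegular) (hΘν : succ (succ (succ Θ)) < ν) (f : Ordinal.{0} → ι → Ordinal.{0})
    (hinc : ∀ ξ < ν.ord, ∀ η < ξ, ∀ᶠ i in F, f η i < f ξ i)
    (hsup : ∀ ξ < ν.ord, ξ.cof = succ (succ (succ Θ)) →
      ∃ c, IsClubIn ξ c ∧ ∀ᶠ i in F, ∀ η ∈ c, f η i ≤ f ξ i)
    (T : Set Ordinal.{0}) (hT : ∀ a < ν.ord, ∃ t ∈ T, a < t ∧ t < ν.ord) :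
    ∃ (t : Ordinal.{0} → Ordinal.{0}) (Z : Ordinal.{0} → Set ι),
      (∀ k < (succ Θ).ord, t k ∈ T ∧ t k < ν.ord ∧ ∀ᶠ i in F, i ∉ Z k) ∧
      ∀ k < (succ Θ).ord, ∀ k' < k, t k' < t k ∧
        ∀ i, i ∉ Z k' → i ∉ Z k → f (t k') i < f (t k) i := by
  classical
  set s := succ (succ (succ Θ)) with hs
  have hρ : (succ Θ).IsRegular := isRegular_succ hΘ
  have hsr : s.IsRegular := isRegular_succ ((hΘ.trans (le_succ _)).trans (le_succ _))
  have hs0 : ℵ₀ < s := hΘ.trans_lt ((lt_succ Θ).trans ((lt_succ _).trans (lt_succ _)))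
  have hνl : IsSuccLimit ν.ord := isSuccLimit_ord hν.aleph0_le
  obtain ⟨g, hg⟩ := club_guessing hsr hρ (lt_succ (succ (succ Θ)))
  let E : Ordinal.{0} → Ordinal.{0} → (Ordinal.{0} → Ordinal.{0}) → Prop := fun j i ξ =>
    ∃ η < ν.ord, ∀ᶠ y in F, ∀ k < (succ Θ).ord, g j k ≤ i → f (ξ (g j k)) y ≤ f η y
  let bd : Ordinal.{0} → Ordinal.{0} → (Ordinal.{0} → Ordinal.{0}) → Ordinal.{0} := fun j i ξ =>
    if h : E j i ξ then h.choose else 0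
  have hbdlt : ∀ j i ξ, bd j i ξ < ν.ord := fun j i ξ => by
    by_cases h : E j i ξ
    · simp only [bd, dif_pos h]; exact h.choose_spec.1
    · simp only [bd, dif_neg h]; exact hν.ord_pos
  have hbdE : ∀ j i ξ, E j i ξ → ∀ᶠ y in F, ∀ k < (succ Θ).ord, g j k ≤ i →
      f (ξ (g j k)) y ≤ f (bd j i ξ) y := fun j i ξ h => by
    simp only [bd, dif_pos h]; exact h.choose_spec.2
  have hpick : ∀ i ξ, ∃ t, (ξ i < ν.ord → t ∈ T ∧ ξ i < t) ∧ t < ν.ord ∧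
      ∀ j < s.ord, bd j i ξ < t := by
    intro i ξ
    obtain ⟨b, hb, hjb⟩ := exists_bound_of_regular_ordinal hν (a := s.ord)
      (ord_lt_ord.2 hΘν) (fun j => bd j i ξ) (fun j _ => hbdlt j i ξ)
    by_cases hi : ξ i < ν.ord
    · obtain ⟨t, ht, h1, h2⟩ := hT (max b (ξ i)) (max_lt hb hi)
      exact ⟨t, fun _ => ⟨ht, (le_max_right _ _).trans_lt h1⟩, h2,
        fun j hj => (hjb j hj).trans ((le_max_left _ _).trans_lt h1)⟩
    · exact ⟨b, fun h => absurd h hi, hb, hjb⟩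
  choose t ht using hpick
  obtain ⟨ξ, hξ, -, hstep, hbound⟩ := exists_normal_of_step 0 t
  have hξν : ∀ α < succ s.ord, ξ α < ν.ord := hbound _ _ (by
      rw [hν.cof_ord]
      exact succ_le_iff.2 (ord_lt_ord.2 hΘν)) hν.ord_pos (fun β _ _ => (ht β _).2.1)
  have hsl : IsSuccLimit s.ord := isSuccLimit_ord hs0.le
  have hξs := hξν s.ord (lt_succ s.ord)
  have hcofs : ℵ₀ < s.ord.cof := by rwa [hsr.cof_ord]
  obtain ⟨e, he, hef⟩ := hsup (ξ s.ord) hξs (by rw [cof_map_of_isNormal hξ hsl, hsr.cof_ord])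
  obtain ⟨j, hj, hjc, hgj, -⟩ := hg _ (isClubIn_preimage hξ hcofs he)
  have hE : ∀ i, E j i (upTo ξ i) := fun i => ⟨ξ s.ord, hξs, by
    filter_upwards [hef] with y hy k hk hki
    simp only [upTo, if_pos hki]
    exact hy _ (hgj k hk).1⟩
  have hglt : ∀ k < (succ Θ).ord, g j k < s.ord := fun k hk => (hgj k hk).2.1.trans hj
  let τ : Ordinal.{0} → Ordinal.{0} := fun k => t (g j k) (upTo ξ (g j k))
  have hmono : ∀ k < (succ Θ).ord, ∀ k' < k, g j k' < g j k := fun k hk k' hk' => by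
    obtain ⟨b, hb, h⟩ := (hgj k hk).2.2
    exact (h k' hk').trans_lt hb
  have hτξ : ∀ k, τ k < ξ (succ (g j k)) := fun k => hstep _ _ (lt_succ _)
  have hτT : ∀ k < (succ Θ).ord, τ k ∈ T ∧ ξ (g j k) < τ k := fun k hk => by
    have := (ht (g j k) (upTo ξ (g j k))).1
    simp only [upTo, le_refl, if_true] at this
    exact this (hξν _ ((hglt k hk).trans (lt_succ _)))
  have hρl : IsSuccLimit (succ Θ).ord := isSuccLimit_ord hρ.aleph0_le
  have hlow : ∀ k < (succ Θ).ord, ∀ᶠ y in F, ∀ k' ≤ k, f (ξ (g j k')) y < f (τ k) y := by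
    intro k hk
    filter_upwards [hbdE j (g j k) _ (hE (g j k)),
      hinc (τ k) (ht _ _).2.1 _ ((ht (g j k) (upTo ξ (g j k))).2.2 j hj)] with y h1 h2 k' hk'
    have hle : g j k' ≤ g j k := by
      rcases hk'.eq_or_lt with rfl | h
      · exact le_rfl
      · exact (hmono k hk k' h).le
    have := h1 k' (hk'.trans_lt hk) hle
    simp only [upTo, if_pos hle] at this
    exact this.trans_lt h2
  have hup : ∀ k < (succ Θ).ord, ∀ᶠ y in F, f (τ k) y < f (ξ (g j (succ k))) y := fun k hk =>
    hinc _ (hξν _ ((hglt _ (hρl.succ_lt hk)).trans (lt_succ _))) _ ((hτξ k).trans_le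
      (hξ.strictMono.monotone (succ_le_iff.2 (hmono _ (hρl.succ_lt hk) k (lt_succ k)))))
  refine ⟨τ, fun k => {y | ¬ ((∀ k' ≤ k, f (ξ (g j k')) y < f (τ k) y) ∧
    f (τ k) y < f (ξ (g j (succ k))) y)}, fun k hk => ⟨(hτT k hk).1, (ht _ _).2.1, ?_⟩,
    fun k hk k' hk' => ⟨?_, fun y hy' hy => ?_⟩⟩
  · filter_upwards [hlow k hk, hup k hk] with y h1 h2 h3
    exact h3 ⟨h1, h2⟩
  · exact (hstep _ _ (hmono k hk k' hk')).trans (hτT k hk).2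
  · simp only [Set.mem_ofPred_eq, not_not] at hy hy'
    exact hy'.2.trans (hy.1 _ (succ_le_iff.2 hk'))

/-- A limit ordinal of uncountable cofinality has a club of size its cofinality. -/
theorem exists_small_club {o : Ordinal.{0}} (ho : ℵ₀ ≤ o.cof) :
    ∃ s : Ordinal.{0} → Ordinal.{0}, IsNormal s ∧ (∀ α < o.cof.ord, s α < o) ∧
      s o.cof.ord = o ∧ IsClubIn o {x | ∃ i < o.cof.ord, s i = x} := by
  obtain ⟨s, h1, h2, h3, h4⟩ := exists_normal_cofinal ho
  have hs : IsNormal s := isNormal_of_continuous_chain h1 h4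
  have hl : IsSuccLimit o.cof.ord := isSuccLimit_ord ho
  have he : s o.cof.ord = o := by
    refine le_antisymm (not_lt.1 fun h => ?_) (not_lt.1 fun h => ?_)
    · obtain ⟨a, ha, h5⟩ := h4 _ hl _ h
      exact absurd (h5.trans (h2 a ha)) (lt_irrefl _)
    · obtain ⟨a, ha, h5⟩ := h3 _ h
      exact absurd (h5.trans (hs.strictMono ha)) (lt_irrefl _)
  have := isClubIn_image hs hl
  rw [he] at this
  exact ⟨s, hs, h2, he, this⟩

/-- Increasing sequences modulo a directed filter, taking least club-wise upper bounds at points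
of suitable cofinality. -/
theorem exists_sup_sequence {ι : Type} {φ : ι → Cardinal.{0}} (hφ : ∀ i, (φ i).IsRegular)
    {F : Filter ι} {ν : Cardinal.{0}}
    (hdir : ∀ (K : Type), #K < ν → ∀ G : K → ι → Ordinal.{0}, (∀ k, InProd φ (G k)) →
      ∃ h, InProd φ h ∧ ∀ k, ∀ᶠ i in F, G k i ≤ h i)
    (u : Ordinal.{0} → ι → Ordinal.{0}) (hu : ∀ ξ < ν.ord, InProd φ (u ξ)) :
    ∃ f : Ordinal.{0} → ι → Ordinal.{0}, ∀ ξ < ν.ord, InProd φ (f ξ) ∧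
      (∀ η < ξ, ∀ᶠ i in F, f η i < f ξ i ∧ u η i ≤ f ξ i) ∧
      (ℵ₀ < ξ.cof → #ι < ξ.cof → (∀ᶠ i in F, ξ.cof < φ i) →
        (∃ c, IsClubIn ξ c ∧ c ⊆ Iio ξ ∧ ∀ᶠ y in F, ∀ η ∈ c, f η y ≤ f ξ y) ∧
        ∀ y v c, IsClubIn ξ c → c ⊆ Iio ξ → (∀ η ∈ c, f η y ≤ v) → f ξ y ≤ v) := by
  classical
  refine exists_dependent_choice (A := ι → Ordinal.{0}) ν.ord
    (fun ξ H a => InProd φ a ∧ (∀ η < ξ, ∀ᶠ i in F, H η i < a i ∧ u η i ≤ a i) ∧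
      (ℵ₀ < ξ.cof → #ι < ξ.cof → (∀ᶠ i in F, ξ.cof < φ i) →
        (∃ c, IsClubIn ξ c ∧ c ⊆ Iio ξ ∧ ∀ᶠ y in F, ∀ η ∈ c, H η y ≤ a y) ∧
        ∀ y v c, IsClubIn ξ c → c ⊆ Iio ξ → (∀ η ∈ c, H η y ≤ v) → a y ≤ v))
    (fun ξ _ H H' h a ha => ⟨ha.1, fun β hβ => by rw [← h β hβ]; exact ha.2.1 β hβ,
      fun h1 h2 h3 => ?_⟩) (fun ξ hξ H hH => ?_)
  · obtain ⟨⟨c, hc, hcξ, hcF⟩, h4⟩ := ha.2.2 h1 h2 h3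
    refine ⟨⟨c, hc, hcξ, ?_⟩, fun y v c hc hcξ hv => h4 y v c hc hcξ fun η hη => ?_⟩
    · filter_upwards [hcF] with y hy η hη
      rw [← h η (hcξ hη)]
      exact hy η hη
    · rw [h η (hcξ hη)]
      exact hv η hη
  by_cases hgood : ℵ₀ < ξ.cof ∧ #ι < ξ.cof ∧ ∀ᶠ i in F, ξ.cof < φ i
  swap
  · obtain ⟨h, hh, hb⟩ := hdir ξ.ToType (by rw [mk_toType']; exact lt_ord.1 hξ)
      (fun β i => max (H (ToType.mk.symm β).1 i) (u (ToType.mk.symm β).1 i))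
      (fun β => (hH _ (ToType.mk.symm β).2).1.max (hu _ ((ToType.mk.symm β).2.trans hξ)))
    refine ⟨_, hh.succ hφ, fun η hη => ?_, fun h1 h2 h3 => absurd ⟨h1, h2, h3⟩ hgood⟩
    filter_upwards [hb (ToType.mk ⟨η, hη⟩)] with i hi
    simp only [OrderIso.symm_apply_apply, max_le_iff] at hi
    exact ⟨lt_succ_iff.2 hi.1, hi.2.trans (le_succ _)⟩
  obtain ⟨h0, hι, hF⟩ := hgood
  have hl := isSuccLimit_of_aleph0_lt_cof h0.le
  let V : ι → Set Ordinal.{0} := fun y =>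
    {v | ∃ c, IsClubIn ξ c ∧ c ⊆ Iio ξ ∧ ∀ η ∈ c, H η y ≤ v}
  have hV : ∀ y, ξ.cof < φ y → ∃ v ∈ V y, v < (φ y).ord := by
    intro y hy
    obtain ⟨s, -, hs, -, hcl⟩ := exists_small_club h0.le
    obtain ⟨b, hb, hsb⟩ := exists_bound_of_regular_ordinal (hφ y) (a := ξ.cof.ord)
      (ord_lt_ord.2 hy) (fun i => H (s i) y) (fun i hi => (hH _ (hs i hi)).1 y)
    refine ⟨b, ⟨_, hcl, ?_, ?_⟩, hb⟩
    · rintro _ ⟨i, hi, rfl⟩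
      exact hs i hi
    · rintro _ ⟨i, hi, rfl⟩
      exact (hsb i hi).le
  let a : ι → Ordinal.{0} := fun y => if ξ.cof < φ y then sInf (V y) else 0
  have ha : InProd φ a := by
    intro y
    by_cases hy : ξ.cof < φ y
    · obtain ⟨v, hv, h⟩ := hV y hy
      simp only [a, if_pos hy]
      exact (csInf_le' hv).trans_lt h
    · simp only [a, if_neg hy]
      exact (hφ y).ord_pos
  have hcl : ∀ y, ∃ c, IsClubIn ξ c ∧ c ⊆ Iio ξ ∧ (ξ.cof < φ y → ∀ η ∈ c, H η y ≤ a y) := by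
    intro y
    by_cases hy : ξ.cof < φ y
    · obtain ⟨v, hv, -⟩ := hV y hy
      obtain ⟨c, hc⟩ := csInf_mem (⟨v, hv⟩ : (V y).Nonempty)
      refine ⟨c, hc.1, hc.2.1, fun _ => ?_⟩
      simp only [a, if_pos hy]
      exact hc.2.2
    · refine ⟨Iio ξ, ⟨fun b hb => ⟨succ b, hl.succ_lt hb, lt_succ b, hl.succ_lt hb⟩,
        fun x hx _ _ => hx⟩, subset_rfl, fun h => absurd h hy⟩
  choose c hc hcξ hca using hcl
  have hIio : IsClubIn ξ (Iio ξ) :=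
    ⟨fun b hb => ⟨succ b, hl.succ_lt hb, lt_succ b, hl.succ_lt hb⟩, fun x hx _ _ => hx⟩
  have hcI := (IsClubIn.iInter h0 hι hc).inter h0 hIio
  have hcF : ∀ᶠ y in F, ∀ η ∈ {x | ∀ k, x ∈ c k} ∩ Iio ξ, H η y ≤ a y := by
    filter_upwards [hF] with y hy η hη
    exact hca y hy η (hη.1 y)
  refine ⟨a, ha, fun η hη => ?_, fun _ _ _ => ⟨⟨_, hcI, inter_subset_right, hcF⟩,
    fun y v c hc hcξ hv => ?_⟩⟩
  · obtain ⟨ζ, hζ, h1, h2⟩ := hcI.1 (succ η) (hl.succ_lt hη)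
    filter_upwards [hcF, (hH ζ h2).2.1 η ((lt_succ η).trans h1)] with y h3 h4
    have := h3 ζ hζ
    exact ⟨h4.1.trans_le this, h4.2.trans this⟩
  · by_cases hy : ξ.cof < φ y
    · simp only [a, if_pos hy]
      exact csInf_le' ⟨c, hc, hcξ, hv⟩
    · simp only [a, if_neg hy]
      exact zero_le (a := v)

/-- A product of at most `Θ` regular cardinals exceeding the third successor of `Θ`. -/
structure IsProgressive {ι : Type} (φ : ι → Cardinal.{0}) (Θ : Cardinal.{0}) : Prop where
  aleph0_le : ℵ₀ ≤ Θ
  card_le : #ι ≤ Θ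
  isRegular : ∀ i, (φ i).IsRegular
  lt : ∀ i, succ (succ (succ Θ)) < φ i

namespace IsProgressive

variable {ι : Type} {φ : ι → Cardinal.{0}} {Θ : Cardinal.{0}}

theorem succ_lt (hP : IsProgressive φ Θ) (i : ι) : succ Θ < φ i :=
  ((le_succ _).trans (le_succ _)).trans_lt (hP.lt i)

theorem exists_bound_le (hP : IsProgressive φ Θ) {ν : Cardinal.{0}} (hν : ℵ₀ ≤ ν)
    {K : Type} (hK : #K ≤ ν) (G : K → ι → Ordinal.{0}) (hG : ∀ k, InProd φ (G k)) :
    ∃ h, InProd φ h ∧ ∀ k, ∀ᶠ i in domFilter φ (succ ν), G k i ≤ h i :=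
  exists_eventual_bound hP.isRegular (lt_succ_iff.2 hP.card_le) hP.succ_lt
    (hP.aleph0_le.trans (le_succ _)) hν K hK G hG

theorem exists_bound (hP : IsProgressive φ Θ) {ν : Cardinal.{0}} (hν : ℵ₀ < ν)
    (K : Type) (hK : #K < ν) (G : K → ι → Ordinal.{0}) (hG : ∀ k, InProd φ (G k)) :
    ∃ h, InProd φ h ∧ ∀ k, ∀ᶠ i in domFilter φ ν, G k i ≤ h i := by
  obtain ⟨h, hh, hb⟩ := hP.exists_bound_le (ν := max #K ℵ₀) (le_max_right _ _)
    (le_max_left _ _) G hG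
  exact ⟨h, hh, fun k => domFilter_anti (succ_le_iff.2 (max_lt hK hν)) (hb k)⟩

/-- Dominating families of size at most `ν`, enumerated in type `ν`. -/
theorem exists_dominating (hP : IsProgressive φ Θ) {ν : Cardinal.{0}} (hν : ℵ₀ ≤ ν) {Y : Set ι}
    (hY : Dominated φ (succ ν) Y) : ∃ G : Ordinal.{0} → ι → Ordinal.{0}, (∀ ξ, InProd φ (G ξ)) ∧
      ∀ h, InProd φ h → ∃ ξ < ν.ord, ∀ i ∈ Y, h i ≤ G ξ i := by
  obtain ⟨K, g, hK, hg, hgY⟩ := hY.exists_family hP.isRegular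
  have hK' : #K ≤ ν := by
    rw [max_eq_left] at hK
    · exact lt_succ_iff.1 hK
    · rw [← succ_aleph0]; exact succ_le_succ hν
  have : Nonempty K := by
    obtain ⟨k, -⟩ := hgY (fun _ => 0) (fun i => (hP.isRegular i).ord_pos)
    exact ⟨k⟩
  obtain ⟨e, he⟩ := exists_enumeration hK'
  refine ⟨fun ξ => g (e ξ), fun ξ => hg _, fun h hh => ?_⟩
  obtain ⟨k, hk⟩ := hgY h hh
  obtain ⟨ξ, hξ, rfl⟩ := he k
  exact ⟨ξ, hξ, hk⟩

/-- Increasing sequences modulo `domFilter φ ν` of length `ν` above a given sequence. -/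
theorem exists_majorant (hP : IsProgressive φ Θ) {ν : Cardinal.{0}} (hν : ℵ₀ < ν)
    (G : Ordinal.{0} → ι → Ordinal.{0}) (hG : ∀ ξ < ν.ord, InProd φ (G ξ)) :
    ∃ g : Ordinal.{0} → ι → Ordinal.{0}, ∀ ξ < ν.ord, InProd φ (g ξ) ∧
      (∀ i, G ξ i ≤ g ξ i) ∧ ∀ η < ξ, ∀ᶠ i in domFilter φ ν, g η i ≤ g ξ i := by
  obtain ⟨g, hg⟩ := exists_increasing_majorant (ζ := ν.ord) (F := domFilter φ ν)
    (fun K hK => hP.exists_bound hν K (by simpa using hK)) (by simp) (by simpa using hν.le) G hG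
  refine ⟨fun ξ i => max (g ξ i) (G ξ i), fun ξ hξ => ⟨(hg ξ hξ).1.max (hG ξ hξ),
    fun i => le_max_right _ _, fun η hη => ?_⟩⟩
  filter_upwards [(hg ξ hξ).2.2 η hη, (hg η (hη.trans hξ)).2.1] with i h1 h2
  exact (max_le h1 (h2.trans h1)).trans (le_max_left _ _)

/-- Universal sequences: increasing sequences modulo `domFilter φ ν` cofinal in every
restricted product dominated by `ν` functions. -/
theorem exists_universal (hP : IsProgressive φ Θ) {ν : Cardinal.{0}} (hν : ν.IsRegular)
    (hν' : succ Θ < ν) :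
    ∃ u : Ordinal.{0} → ι → Ordinal.{0}, (∀ ξ < ν.ord, InProd φ (u ξ)) ∧
      (∀ ξ < ν.ord, ∀ η < ξ, ∀ᶠ i in domFilter φ ν, u η i ≤ u ξ i) ∧
      ∀ Y, Dominated φ (succ ν) Y → ∀ h, InProd φ h →
        ∃ ξ < ν.ord, ∀ᶠ i in domFilter φ ν, i ∈ Y → h i ≤ u ξ i := by
  have hν0 : ℵ₀ < ν := (hP.aleph0_le.trans (le_succ _)).trans_lt hν'
  have hκ : (succ Θ).IsRegular := isRegular_succ hP.aleph0_le
  let good : (Ordinal.{0} → ι → Ordinal.{0}) → Prop := fun u => (∀ ξ < ν.ord, InProd φ (u ξ)) ∧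
      (∀ ξ < ν.ord, ∀ η < ξ, ∀ᶠ i in domFilter φ ν, u η i ≤ u ξ i)
  by_contra! hcon
  have hfail : ∀ u, ∃ (Y : Set ι) (h : ι → Ordinal.{0}) (G : Ordinal.{0} → ι → Ordinal.{0}),
      good u → InProd φ h ∧ (∀ ξ < ν.ord, ∃ᶠ i in domFilter φ ν, i ∈ Y ∧ u ξ i < h i) ∧
      (∀ ξ, InProd φ (G ξ)) ∧ ∀ h, InProd φ h → ∃ ξ < ν.ord, ∀ i ∈ Y, h i ≤ G ξ i := by
    intro u
    by_cases hu : good u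
    · obtain ⟨Y, hY, h, hh, hξ⟩ := hcon u hu.1 hu.2
      obtain ⟨G, hG⟩ := hP.exists_dominating hν0.le hY
      exact ⟨Y, h, G, fun _ => ⟨hh, hξ, hG⟩⟩
    · exact ⟨∅, fun _ => 0, fun _ _ => 0, fun h => absurd h hu⟩
  choose Y h G hfail using hfail
  obtain ⟨U, hU⟩ := exists_dependent_choice (A := Ordinal.{0} → ι → Ordinal.{0}) (succ Θ).ord
    (fun α H a => good a ∧ ∀ β < α, ∀ ξ < ν.ord, ∀ i, H β ξ i ≤ a ξ i ∧ G (H β) ξ i ≤ a ξ i)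
    (fun α _ H H' h a ha => ⟨ha.1, fun β hβ => by rw [← h β hβ]; exact ha.2 β hβ⟩)
    (fun α hα H hH => by
      have hpt : ∀ ξ, ∃ b, ξ < ν.ord → InProd φ b ∧ ∀ β < α, ∀ i,
          H β ξ i ≤ b i ∧ G (H β) ξ i ≤ b i := by
        intro ξ
        by_cases hξ : ξ < ν.ord
        · obtain ⟨b, hb, hβ⟩ := exists_pointwise_bound hP.isRegular (K := α.ToType)
            (fun i => by rw [mk_toType']; exact (lt_ord.1 hα).trans (hP.succ_lt i))
            (fun β i => max (H (ToType.mk.symm β).1 ξ i) (G (H (ToType.mk.symm β).1) ξ i))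
            (fun β => ((hH _ (ToType.mk.symm β).2).1.1 ξ hξ).max
              ((hfail _ (hH _ (ToType.mk.symm β).2).1).2.2.1 ξ))
          refine ⟨b, fun _ => ⟨hb, fun β h i => ?_⟩⟩
          have := hβ (ToType.mk ⟨β, h⟩) i
          simp only [OrderIso.symm_apply_apply, max_lt_iff] at this
          exact ⟨this.1.le, this.2.le⟩
        · exact ⟨fun _ => 0, fun h => absurd h hξ⟩
      choose b hb using hpt
      obtain ⟨g, hg⟩ := hP.exists_majorant hν0 b (fun ξ hξ => (hb ξ hξ).1)
      exact ⟨g, ⟨fun ξ hξ => (hg ξ hξ).1, fun ξ hξ => (hg ξ hξ).2.2⟩, fun β hβ ξ hξ i =>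
        ⟨((hb ξ hξ).2 β hβ i).1.trans ((hg ξ hξ).2.1 i),
          ((hb ξ hξ).2 β hβ i).2.trans ((hg ξ hξ).2.1 i)⟩⟩)
  obtain ⟨b, hb, hbh⟩ := exists_pointwise_bound hP.isRegular (K := (succ Θ).ord.ToType)
    (fun i => by rw [mk_toType', card_ord]; exact hP.succ_lt i)
    (fun α => h (U (ToType.mk.symm α).1))
    (fun α => (hfail _ (hU _ (ToType.mk.symm α).2).1).1)
  have hbh' : ∀ α < (succ Θ).ord, ∀ i, h (U α) i < b i := fun α hα i => by
    simpa using hbh (ToType.mk ⟨α, hα⟩) i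
  have hξ : ∀ α, ∃ ξ, α < (succ Θ).ord → ξ < ν.ord ∧ ∀ i ∈ Y (U α), b i ≤ G (U α) ξ i := by
    intro α
    by_cases hα : α < (succ Θ).ord
    · obtain ⟨ξ, hξ⟩ := (hfail _ (hU α hα).1).2.2.2 b hb
      exact ⟨ξ, fun _ => hξ⟩
    · exact ⟨0, fun h => absurd h hα⟩
  choose X hX using hξ
  obtain ⟨ξ, hξ, hXξ⟩ := exists_bound_of_regular_ordinal hν (a := (succ Θ).ord)
    (ord_lt_ord.2 hν') X (fun α hα => (hX α hα).1)
  have hy : ∀ α, ∃ i, α < (succ Θ).ord → U α ξ i < h (U α) i ∧ b i ≤ U (succ α) ξ i := by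
    intro α
    by_cases hα : α < (succ Θ).ord
    · have hs := hU _ ((isSuccLimit_ord hκ.aleph0_le).succ_lt hα)
      obtain ⟨i, ⟨hiY, hi⟩, h2⟩ := (((hfail _ (hU α hα).1).2.1 ξ hξ).and_eventually
        (hs.1.2 ξ hξ _ (hXξ α hα))).exists
      exact ⟨i, fun _ => ⟨hi, ((hX α hα).2 i hiY).trans
        ((hs.2 α (lt_succ α) _ (hX α hα).1 i).2.trans h2)⟩⟩
    · obtain ⟨i, -⟩ := ((hfail _ (hU 0 hκ.ord_pos).1).2.1 ξ hξ).exists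
      exact ⟨i, fun h => absurd h hα⟩
  choose y hy using hy
  obtain ⟨α, β, hαβ, hβ, he⟩ := exists_eq_of_card_lt (lt_succ_iff.2 hP.card_le) y
  have h1 := (hy α (hαβ.trans hβ)).2
  have h2 := (hy β hβ).1
  rw [← he] at h2
  have h3 : U (succ α) ξ (y α) ≤ U β ξ (y α) := by
    rcases (succ_le_iff.2 hαβ).eq_or_lt with h | h
    · rw [h]
    · exact ((hU β hβ).2 _ h ξ hξ _).1
  exact absurd ((h1.trans h3).trans_lt (h2.trans (hbh' β hβ _))) (lt_irrefl _)

end IsProgressive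

namespace IsProgressive

variable {ι : Type} {φ : ι → Cardinal.{0}} {Θ : Cardinal.{0}}

/-- A scale for the sets dominated by `ν` functions: strictly increasing modulo `domFilter φ ν`,
cofinal on all these sets, with least club-wise upper bounds at cofinality `Θ⁺⁺⁺`. -/
structure IsScale (φ : ι → Cardinal.{0}) (Θ ν : Cardinal.{0}) (f : Ordinal.{0} → ι → Ordinal.{0}) :
    Prop where
  inProd : ∀ ξ < ν.ord, InProd φ (f ξ)
  lt : ∀ ξ < ν.ord, ∀ η < ξ, ∀ᶠ i in domFilter φ ν, f η i < f ξ i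
  exists_club : ∀ ξ < ν.ord, ξ.cof = succ (succ (succ Θ)) →
    ∃ c, IsClubIn ξ c ∧ ∀ᶠ i in domFilter φ ν, ∀ η ∈ c, f η i ≤ f ξ i
  le_of_club : ∀ ξ < ν.ord, ξ.cof = succ (succ (succ Θ)) → ∀ y v c, IsClubIn ξ c → c ⊆ Iio ξ →
    (∀ η ∈ c, f η y ≤ v) → f ξ y ≤ v
  exists_le : ∀ Y, Dominated φ (succ ν) Y → ∀ h, InProd φ h →
    ∃ ξ < ν.ord, ∀ᶠ i in domFilter φ ν, i ∈ Y → h i ≤ f ξ i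

theorem exists_isScale (hP : IsProgressive φ Θ) {ν : Cardinal.{0}} (hν : ν.IsRegular)
    (hν' : succ (succ (succ Θ)) < ν) : ∃ f, IsScale φ Θ ν f := by
  have hΘ3 : succ Θ < succ (succ (succ Θ)) := (lt_succ _).trans (lt_succ _)
  have hν0 : ℵ₀ < ν := (hP.aleph0_le.trans_lt (lt_succ Θ)).trans (hΘ3.trans hν')
  obtain ⟨u, hu, -, huY⟩ := hP.exists_universal hν (hΘ3.trans hν')
  obtain ⟨f, hf⟩ := exists_sup_sequence hP.isRegular (hP.exists_bound hν0) u hu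
  have hgood : ∀ ξ < ν.ord, ξ.cof = succ (succ (succ Θ)) → _ := fun ξ hξ hc =>
    (hf ξ hξ).2.2 (hc ▸ (hP.aleph0_le.trans_lt (lt_succ Θ)).trans hΘ3)
      (hc ▸ (hP.card_le.trans_lt (lt_succ Θ)).trans hΘ3)
      (Eventually.of_forall fun i => hc ▸ hP.lt i)
  refine ⟨f, fun ξ hξ => (hf ξ hξ).1, fun ξ hξ η hη => ((hf ξ hξ).2.1 η hη).mono fun i h => h.1,
    fun ξ hξ hc => ?_, fun ξ hξ hc => (hgood ξ hξ hc).2, fun Y hY h hh => ?_⟩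
  · obtain ⟨c, hc1, -, hc2⟩ := (hgood ξ hξ hc).1
    exact ⟨c, hc1, hc2⟩
  · obtain ⟨ξ, hξ, hξh⟩ := huY Y hY h hh
    have hl := (isSuccLimit_ord hν0.le).succ_lt hξ
    refine ⟨_, hl, ?_⟩
    filter_upwards [hξh, (hf _ hl).2.1 ξ (lt_succ ξ)] with i h1 h2 hi
    exact (h1 hi).trans h2.2

/-- Generators: a largest set, modulo `domFilter φ ν`, dominated by `ν` functions. -/
theorem IsScale.exists_generator (hP : IsProgressive φ Θ) {ν : Cardinal.{0}} (hν : ν.IsRegular)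
    (hν' : succ (succ (succ Θ)) < ν) {f : Ordinal.{0} → ι → Ordinal.{0}}
    (hf : IsScale φ Θ ν f) : ∃ B, Dominated φ (succ ν) B ∧
      ∀ Y, Dominated φ (succ ν) Y → ∀ᶠ i in domFilter φ ν, i ∈ Y → i ∈ B := by
  have hΘ3 : succ Θ < succ (succ (succ Θ)) := (lt_succ _).trans (lt_succ _)
  have hν0 : ℵ₀ < ν := (hP.aleph0_le.trans_lt (lt_succ Θ)).trans (hΘ3.trans hν')
  obtain ⟨g', hg', hb⟩ := hP.exists_bound_le hν0.le (K := ν.ord.ToType)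
    (by rw [mk_toType', card_ord]) (fun ξ => f (ToType.mk.symm ξ).1)
    (fun ξ => hf.inProd _ (ToType.mk.symm ξ).2)
  obtain ⟨g, hg, hfg⟩ : ∃ g, InProd φ g ∧ ∀ ξ < ν.ord, ∀ᶠ i in domFilter φ (succ ν),
      f ξ i < g i := by
    refine ⟨_, hg'.succ hP.isRegular, fun ξ hξ => ?_⟩
    filter_upwards [hb (ToType.mk ⟨ξ, hξ⟩)] with i hi
    simpa using hi
  let B : Ordinal.{0} → Set ι := fun ξ => {i | g i ≤ f ξ i}
  have hBdom : ∀ ξ < ν.ord, Dominated φ (succ ν) (B ξ) := fun ξ hξ =>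
    eventually_notMem_domFilter.1 ((hfg ξ hξ).mono fun i hi => not_le.2 hi)
  suffices ∃ ξ₀ < ν.ord, ∀ ξ < ν.ord, ∀ᶠ i in domFilter φ ν, i ∈ B ξ → i ∈ B ξ₀ by
    obtain ⟨ξ₀, hξ₀, h⟩ := this
    refine ⟨B ξ₀, hBdom _ hξ₀, fun Y hY => ?_⟩
    obtain ⟨ξ, hξ, hY⟩ := hf.exists_le Y hY g hg
    filter_upwards [h ξ hξ, hY] with i h1 h2 h3 using h1 (h2 h3)
  by_contra! hcon
  have hN : ∀ ξ₀, ∃ ξ, ξ₀ < ν.ord → ξ < ν.ord ∧ ∃ᶠ i in domFilter φ ν, i ∈ B ξ ∧ i ∉ B ξ₀ := by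
    intro ξ₀
    by_cases h : ξ₀ < ν.ord
    · obtain ⟨ξ, hξ⟩ := hcon ξ₀ h
      exact ⟨ξ, fun _ => hξ⟩
    · exact ⟨0, fun h' => absurd h' h⟩
  choose N hN using hN
  obtain ⟨t, Z, ht, htZ⟩ := exists_strongly_increasing hP.aleph0_le hν hν' f hf.lt hf.exists_club _
    (isClubIn_closure hν hν0 (fun x hx => (hN x hx).1)).1
  have hκ : (succ Θ).IsRegular := isRegular_succ hP.aleph0_le
  have hl : IsSuccLimit (succ Θ).ord := isSuccLimit_ord hκ.aleph0_le
  have hy : ∀ k, ∃ y, k < (succ Θ).ord → y ∉ Z k ∧ y ∉ Z (succ k) ∧ f (t k) y < g y ∧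
      g y ≤ f (t (succ k)) y := by
    have : ∀ k < (succ Θ).ord, ∃ y, y ∉ Z k ∧ y ∉ Z (succ k) ∧ f (t k) y < g y ∧
      g y ≤ f (t (succ k)) y := by
      intro k hk
      have hk' := hl.succ_lt hk
      obtain ⟨y, ⟨h1, h2⟩, h3, h4, h5⟩ := ((hN (t k) (ht k hk).2.1).2.and_eventually
        ((ht k hk).2.2.and ((ht _ hk').2.2.and (hf.lt _ (ht _ hk').2.1 _
          ((ht _ hk').1.2 _ (htZ _ hk' k (lt_succ k)).1))))).exists
      exact ⟨y, h3, h4, not_le.1 h2, h1.trans h5.le⟩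
    intro k
    by_cases hk : k < (succ Θ).ord
    · obtain ⟨y, hy⟩ := this k hk
      exact ⟨y, fun _ => hy⟩
    · obtain ⟨y, -⟩ := this 0 hκ.ord_pos
      exact ⟨y, fun h => absurd h hk⟩
  choose y hy using hy
  obtain ⟨α, β, hαβ, hβ, he⟩ := exists_eq_of_card_lt (lt_succ_iff.2 hP.card_le) y
  obtain ⟨-, h1, -, h2⟩ := hy α (hαβ.trans hβ)
  obtain ⟨h3, -, h4, -⟩ := hy β hβ
  rw [← he] at h3 h4
  have h5 : f (t (succ α)) (y α) ≤ f (t β) (y α) := by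
    rcases (succ_le_iff.2 hαβ).eq_or_lt with h | h
    · rw [h]
    · exact ((htZ β hβ _ h).2 _ h1 h3).le
  exact absurd ((h2.trans h5).trans_lt h4) (lt_irrefl _)

end IsProgressive

namespace IsProgressive

variable {ι : Type} {φ : ι → Cardinal.{0}} {Θ : Cardinal.{0}}

/-- The values obtained from `ξ`, at coordinate `i`, by following a finite path. -/
def pathVal (f : ι → Ordinal.{0} → ι → Ordinal.{0}) (i : ι) (ξ : Ordinal.{0}) :
    List ι → ι × Ordinal.{0}
  | [] => (i, ξ)
  | y :: l => (y, f (pathVal f i ξ l).1 (pathVal f i ξ l).2 y)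

theorem exists_path_bound (hP : IsProgressive φ Θ) {f : ι → Ordinal.{0} → ι → Ordinal.{0}}
    (hf : ∀ i, IsScale φ Θ (φ i) (f i)) :
    ∃ H, InProd φ H ∧ ∀ i, ∀ ξ < (φ i).ord, ∀ᶠ y in domFilter φ (succ (φ i)),
      ∀ l, (pathVal f i ξ l).1 = y → (pathVal f i ξ l).2 < H y := by
  classical
  have hval : ∀ i, ∀ ξ < (φ i).ord, ∀ l, (pathVal f i ξ l).2 < (φ (pathVal f i ξ l).1).ord := by
    intro i ξ hξ l
    induction l with
    | nil => exact hξ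
    | cons y l ih => exact (hf _).inProd _ ih y
  have hE : ∀ i ξ, ∃ E : ι → Ordinal.{0}, InProd φ E ∧ (ξ < (φ i).ord →
      ∀ y l, (pathVal f i ξ l).1 = y → (pathVal f i ξ l).2 < E y) := by
    intro i ξ
    by_cases hξ : ξ < (φ i).ord
    · obtain ⟨E, hE, hb⟩ := exists_pointwise_bound hP.isRegular (K := List ι) (fun j =>
          ((mk_list_le_max ι).trans (max_le hP.aleph0_le hP.card_le)).trans_lt
            ((le_succ Θ).trans_lt (hP.succ_lt j)))
        (fun l y => if (pathVal f i ξ l).1 = y then (pathVal f i ξ l).2 else 0) (fun l y => by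
          dsimp only
          split_ifs with h
          · exact h ▸ hval i ξ hξ l
          · exact (hP.isRegular y).ord_pos)
      refine ⟨E, hE, fun _ y l hl => ?_⟩
      have := hb l y
      rwa [if_pos hl] at this
    · exact ⟨fun _ => 0, fun j => (hP.isRegular j).ord_pos, fun h => absurd h hξ⟩
  choose E hE hEb using hE
  choose H hH hHb using fun i => hP.exists_bound_le (hP.isRegular i).aleph0_le
    (K := (φ i).ord.ToType) (by rw [mk_toType', card_ord]) (fun ξ => E i (ToType.mk.symm ξ).1)
    (fun ξ => hE _ _)
  obtain ⟨h, hh, hb⟩ := exists_pointwise_bound hP.isRegular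
    (fun j => hP.card_le.trans_lt ((le_succ Θ).trans_lt (hP.succ_lt j))) H hH
  refine ⟨h, hh, fun i ξ hξ => ?_⟩
  filter_upwards [hHb i (ToType.mk ⟨ξ, hξ⟩)] with y hy l hl
  simp only [OrderIso.symm_apply_apply] at hy
  exact (hEb i ξ hξ y l hl).trans_le (hy.trans (hb i y).le)

/-- Transitive generators. -/
theorem exists_transitive_generators (hP : IsProgressive φ Θ) :
    ∃ c : ι → Set ι, (∀ i, i ∈ c i) ∧ (∀ i, ∀ j ∈ c i, c j ⊆ c i) ∧
      (∀ i, Dominated φ (succ (φ i)) (c i)) ∧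
      ∀ i Y, Dominated φ (succ (φ i)) Y → ∀ᶠ j in domFilter φ (φ i), j ∈ Y → j ∈ c i := by
  classical
  set ρ := succ (succ (succ Θ)) with hρ
  have hρr : ρ.IsRegular := isRegular_succ ((hP.aleph0_le.trans (le_succ _)).trans (le_succ _))
  have hΘρ : Θ < ρ := (lt_succ Θ).trans ((lt_succ _).trans (lt_succ _))
  have hρl : IsSuccLimit ρ.ord := isSuccLimit_ord hρr.aleph0_le
  choose f hf using fun i => hP.exists_isScale (hP.isRegular i) (hP.lt i)
  choose B hB hBY using fun i => (hf i).exists_generator hP (hP.isRegular i) (hP.lt i)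
  obtain ⟨H, hH, hpath⟩ := hP.exists_path_bound hf
  have hΦ : ∀ h, ∃ h', InProd φ h → InProd φ h' ∧ (∀ i y, f i (h i) y ≤ h' y) ∧
      ∀ i, ∃ ξ ≤ h' i, ∀ᶠ j in domFilter φ (φ i), j ∈ B i → h j ≤ f i ξ j := by
    intro h
    by_cases hh : InProd φ h
    · obtain ⟨b, hb, hfb⟩ := exists_pointwise_bound hP.isRegular
        (fun j => hP.card_le.trans_lt ((le_succ Θ).trans_lt (hP.succ_lt j)))
        (fun i => f i (h i)) (fun i => (hf i).inProd _ (hh i))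
      choose ξ hξ hξB using fun i => (hf i).exists_le _ (hB i) h hh
      exact ⟨_, fun _ => ⟨hb.max (g := ξ) hξ, fun i y => (hfb i y).le.trans (le_max_left _ _),
        fun i => ⟨ξ i, le_max_right _ _, hξB i⟩⟩⟩
    · exact ⟨h, fun h' => absurd h' hh⟩
  choose Φ hΦ using hΦ
  obtain ⟨s, hs⟩ := exists_continuous_chain H (fun ζ s => Φ (s ζ))
    (fun β s s' h => by simp only [h β le_rfl])
  have hsφ : ∀ ζ < succ ρ.ord, InProd φ (s ζ) := hs.lt_of_step_lt (fun i => (φ i).ord)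
    (fun i => by
      rw [(hP.isRegular i).cof_ord]
      exact succ_le_iff.2 (ord_lt_ord.2 (hP.lt i))) hH
    (fun β _ hβ => (hΦ _ (hβ β le_rfl)).1)
  have hnorm : ∀ i, IsNormal fun ζ => s ζ i := fun i =>
    isNormal_of_continuous_chain (fun α β h => hs.lt i α β h)
      (fun α hα a ha => hs.exists_lt hα i ha)
  set χ := s ρ.ord with hχ
  have hχφ : InProd φ χ := hsφ _ (lt_succ _)
  have hs' : ∀ ζ < ρ.ord, InProd φ (s ζ) := fun ζ hζ => hsφ ζ (hζ.trans (lt_succ _))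
  have hχcof : ∀ i, (χ i).cof = ρ := fun i => by
    have := cof_map_of_isNormal (hnorm i) hρl
    rwa [hρr.cof_ord] at this
  have hfχ : ∀ i y, f i (χ i) y ≤ χ y := by
    intro i y
    refine (hf i).le_of_club (χ i) (hχφ i) (hχcof i) y _ _ (isClubIn_image (hnorm i) hρl) ?_ ?_
    · rintro _ ⟨ζ, hζ, rfl⟩
      exact hs.lt i _ _ hζ
    · rintro _ ⟨ζ, hζ, rfl⟩
      exact ((hΦ _ (hs' ζ hζ)).2.1 i y).trans (hs.step_lt y _ _ hζ).le
  have hBb : ∀ i, ∀ᶠ y in domFilter φ (φ i), y ∈ B i → χ y ≤ f i (χ i) y := by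
    intro i
    obtain ⟨e, he, hef⟩ := (hf i).exists_club (χ i) (hχφ i) (hχcof i)
    have hz : ∀ y, ∃ ζ < ρ.ord, f i (χ i) y < χ y → f i (χ i) y < s ζ y := by
      intro y
      by_cases h : f i (χ i) y < χ y
      · obtain ⟨ζ, hζ, h'⟩ := hs.exists_lt hρl y h
        exact ⟨ζ, hζ, fun _ => h'⟩
      · exact ⟨0, hρl.bot_lt, fun h' => absurd h' h⟩
    choose z hz hzy using hz
    obtain ⟨ζ, hζ, hzζ⟩ := exists_bound_of_regular hρr (hP.card_le.trans_lt hΘρ) z hz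
    obtain ⟨ξ, hξ, hξB⟩ := (hΦ _ (hs' ζ hζ)).2.2 i
    obtain ⟨η, hη, h1, h2⟩ := he.1 ξ (hξ.trans_lt (hs.step_lt i _ _ hζ))
    filter_upwards [hef, hξB, (hf i).lt η (h2.trans (hχφ i)) ξ h1] with y h3 h4 h5 hy
    by_contra! hlt
    exact absurd ((h4 hy).trans (h5.le.trans (h3 η hη)))
      (not_le.2 ((hzy y hlt).trans (hs.lt y _ _ (hzζ y))))
  let r : ι → ι → Prop := fun i j => χ j ≤ f i (χ i) j
  refine ⟨fun i => {j | Relation.ReflTransGen r i j}, fun i => .refl,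
    fun i j hj k hk => hj.trans hk, fun i => ?_, fun i Y hY => ?_⟩
  · rw [← eventually_notMem_domFilter]
    filter_upwards [hpath i (χ i) (hχφ i)] with y hy hiy
    have hex : ∃ l, pathVal f i (χ i) l = (y, χ y) := by
      clear hy
      induction hiy with
      | refl => exact ⟨[], rfl⟩
      | @tail j k _ hjk ih =>
        obtain ⟨l, hl⟩ := ih
        exact ⟨k :: l, by simp only [pathVal, hl]; rw [(hfχ j k).antisymm hjk]⟩
    obtain ⟨l, hl⟩ := hex
    have h1 := hy l (by rw [hl])
    rw [hl] at h1
    have h2 := hs.lt y _ _ hρl.bot_lt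
    rw [Ordinal.bot_eq_zero, hs.zero] at h2
    exact absurd (h1.trans h2) (lt_irrefl _)
  · filter_upwards [hBb i, hBY i Y hY] with y h1 h2 h3
    exact .single (h1 (h2 h3))

theorem dominated_of_singular (hP : IsProgressive φ Θ) {ν : Cardinal.{0}} (hν : ℵ₀ ≤ ν)
    (hs : ν.ord.cof < ν) {Y : Set ι} (hY : Dominated φ (succ ν) Y) : Dominated φ ν Y := by
  obtain ⟨G, hG, hGY⟩ := hP.exists_dominating hν hY
  have hν0 : ℵ₀ < ν := lt_of_not_ge fun h => absurd (hν.antisymm h) (by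
    rintro rfl
    rw [isRegular_aleph0.cof_ord] at hs
    exact lt_irrefl _ hs)
  obtain ⟨L, f, hL, hf, hfc⟩ := exists_cofinal_family ν.ord
  choose h hh hb using fun l => hP.exists_bound hν0 (f l).ToType
    (by rw [mk_toType']; exact lt_ord.1 (hf l)) (fun ξ => G (ToType.mk.symm ξ).1) (fun ξ => hG _)
  obtain ⟨H, hH, hHb⟩ := hP.exists_bound hν0 L (hL.trans_lt hs) h hh
  have hl := isSuccLimit_ord hν
  choose ξ hξ hξY using hGY
  obtain ⟨x, hx, hxY⟩ : ∃ x < ν.ord, ∀ i ∈ Y, succ (H i) ≤ G x i :=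
    ⟨_, hξ _ (hH.succ hP.isRegular), hξY _ (hH.succ hP.isRegular)⟩
  obtain ⟨l, hxl⟩ := hfc _ (hl.succ_lt hx)
  rw [← eventually_notMem_domFilter]
  filter_upwards [hb l (ToType.mk ⟨x, succ_le_iff.1 hxl⟩), hHb l] with i h1 h2 hi
  simp only [OrderIso.symm_apply_apply] at h1
  exact absurd ((hxY i hi).trans (h1.trans h2)) (not_le.2 (lt_succ _))

theorem eq_empty_of_dominated (hP : IsProgressive φ Θ) {ν : Cardinal.{0}} {Y : Set ι}
    (hY : Dominated φ (succ ν) Y) (hν : ∀ i, ν < φ i) : Y = ∅ := by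
  obtain ⟨K, g, hK, hg, hgY⟩ := hY.exists_family hP.isRegular
  obtain ⟨h, hh, hb⟩ := exists_pointwise_bound hP.isRegular (fun i => hK.trans_le (max_le
    (succ_le_iff.2 (hν i)) (by
      rw [← succ_aleph0]
      exact succ_le_iff.2 ((hP.aleph0_le.trans (le_succ _)).trans_lt (hP.succ_lt i))))) g hg
  obtain ⟨k, hk⟩ := hgY h hh
  exact Set.eq_empty_of_forall_notMem fun i hi => absurd (hk i hi) (not_le.2 (hb k i))

/-- Compactness: dominated sets are covered by finitely many transitive generators. -/
theorem exists_finset_cover (hP : IsProgressive φ Θ) {c : ι → Set ι}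
    (hc : ∀ i Y, Dominated φ (succ (φ i)) Y → ∀ᶠ j in domFilter φ (φ i), j ∈ Y → j ∈ c i)
    {ρ ϑ Λ : Cardinal.{0}} (hϑ : ∀ i, ϑ < φ i)
    (hΛ : ∀ x : Cardinal.{0}, x.IsRegular → ϑ < x → x ≤ Λ → ∃ i, φ i = x) (hρ : ρ ≤ Λ)
    {Y : Set ι} (hY : Dominated φ (succ ρ) Y) :
    ∃ s : Finset ι, (∀ i ∈ s, φ i ≤ ρ) ∧ ∀ y ∈ Y, ∃ i ∈ s, y ∈ c i := by
  classical
  induction ρ using WellFoundedLT.induction generalizing Y with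
  | ind ρ ih =>
  rcases le_or_gt ρ (max ϑ Θ) with hle | hlt
  · rw [hP.eq_empty_of_dominated hY (fun i => hle.trans_lt (max_lt (hϑ i)
      ((le_succ _).trans_lt (hP.succ_lt i))))]
    exact ⟨∅, by simp⟩
  have hρ0 : ℵ₀ < ρ := hP.aleph0_le.trans_lt ((le_max_right _ _).trans_lt hlt)
  have hsmall : ∀ Z, Dominated φ ρ Z →
      ∃ s : Finset ι, (∀ i ∈ s, φ i ≤ ρ) ∧ ∀ y ∈ Z, ∃ i ∈ s, y ∈ c i := by
    intro Z hZ
    obtain ⟨K, g, hK, hg⟩ := hZ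
    have hK' : max #K ℵ₀ < ρ := max_lt (by
      rwa [max_eq_left] at hK
      rw [← succ_aleph0]
      exact succ_le_iff.2 hρ0) hρ0
    obtain ⟨s, hs, hsZ⟩ := ih _ hK' (hK'.le.trans hρ) (Y := Z)
      ⟨K, g, ((le_max_left _ _).trans_lt (lt_succ _)).trans_le (le_max_left _ _), hg⟩
    exact ⟨s, fun i hi => (hs i hi).trans hK'.le, hsZ⟩
  by_cases hreg : ρ.IsRegular
  · obtain ⟨i, rfl⟩ := hΛ ρ hreg ((le_max_left _ _).trans_lt hlt) hρ
    obtain ⟨s, hs, hsZ⟩ := hsmall _ (eventually_domFilter.1 (hc i Y hY))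
    refine ⟨insert i s, by simpa using hs, fun y hy => ?_⟩
    by_cases hyi : y ∈ c i
    · exact ⟨i, by simp, hyi⟩
    · obtain ⟨j, hj, h⟩ := hsZ y (by simp [hy, hyi])
      exact ⟨j, by simp [hj], h⟩
  · refine hsmall Y (hP.dominated_of_singular hρ0.le (lt_of_not_ge fun h => hreg ⟨hρ0.le, ?_⟩) hY)
    exact h

end IsProgressive

/-- Hypotheses on a sequence of functions, strictly increasing modulo a filter, ensuring the
existence of an exact upper bound. -/
structure IsClubIncreasing {ι : Type} (F : Filter ι) (Θ ν : Cardinal.{0})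
    (f : Ordinal.{0} → ι → Ordinal.{0}) : Prop where
  aleph0_le : ℵ₀ ≤ Θ
  isRegular : ν.IsRegular
  succ_lt : succ (succ (succ Θ)) < ν
  lt : ∀ ξ < ν.ord, ∀ η < ξ, ∀ᶠ i in F, f η i < f ξ i
  exists_club : ∀ ξ < ν.ord, ξ.cof = succ (succ (succ Θ)) →
    ∃ c, IsClubIn ξ c ∧ ∀ᶠ i in F, ∀ η ∈ c, f η i ≤ f ξ i

namespace IsClubIncreasing

variable {ι : Type} {F : Filter ι} {Θ ν : Cardinal.{0}} {f : Ordinal.{0} → ι → Ordinal.{0}}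

theorem exists_proj_bound (hf : IsClubIncreasing F Θ ν f) (hι : #ι ≤ Θ) (S : ι → Set Ordinal.{0})
    {K : Type} (hK : #K ≤ Θ) (e : K → ι → Ordinal.{0}) (heS : ∀ y, ∀ s ∈ S y, ∃ k, e k y = s)
    (hS : ∀ ξ < ν.ord, ∀ᶠ y in F, ∃ s ∈ S y, f ξ y ≤ s) :
    ∃ ξ < ν.ord, ∀ η < ν.ord, ∀ᶠ y in F, f η y ≤ sInf {s | s ∈ S y ∧ f ξ y ≤ s} := by
  have hν := hf.isRegular
  have hΘ := hf.aleph0_le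
  have hν0 : ℵ₀ < ν := (hΘ.trans_lt (lt_succ Θ)).trans
    (((lt_succ _).trans (lt_succ _)).trans hf.succ_lt)
  by_contra! hcon
  have hN : ∀ ξ, ∃ η, ξ < ν.ord → η < ν.ord ∧
      ∃ᶠ y in F, sInf {s | s ∈ S y ∧ f ξ y ≤ s} < f η y := by
    intro ξ
    by_cases h : ξ < ν.ord
    · obtain ⟨η, hη⟩ := hcon ξ h
      exact ⟨η, fun _ => hη⟩
    · exact ⟨0, fun h' => absurd h' h⟩
  choose N hN using hN
  obtain ⟨t, Z, ht, htZ⟩ := exists_strongly_increasing hΘ hν hf.succ_lt f hf.lt hf.exists_club _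
    (isClubIn_closure hν hν0 (fun x hx => (hN x hx).1)).1
  have hκ : (succ Θ).IsRegular := isRegular_succ hΘ
  have hl : IsSuccLimit (succ Θ).ord := isSuccLimit_ord hκ.aleph0_le
  have hy : ∀ k, ∃ p : ι × K, k < (succ Θ).ord → p.1 ∉ Z k ∧ p.1 ∉ Z (succ k) ∧
      f (t k) p.1 ≤ e p.2 p.1 ∧ e p.2 p.1 < f (t (succ k)) p.1 := by
    have : ∀ k < (succ Θ).ord, ∃ p : ι × K, p.1 ∉ Z k ∧ p.1 ∉ Z (succ k) ∧
      f (t k) p.1 ≤ e p.2 p.1 ∧ e p.2 p.1 < f (t (succ k)) p.1 := by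
      intro k hk
      have hk' := hl.succ_lt hk
      obtain ⟨y, h1, h3, h4, h5, s, hsS, hs⟩ := ((hN (t k) (ht k hk).2.1).2.and_eventually
        ((ht k hk).2.2.and ((ht _ hk').2.2.and ((hf.lt _ (ht _ hk').2.1 _
          ((ht _ hk').1.2 _ (htZ _ hk' k (lt_succ k)).1)).and (hS _ (ht k hk).2.1))))).exists
      obtain ⟨h6, h7⟩ := csInf_mem (⟨s, hsS, hs⟩ : {s | s ∈ S y ∧ f (t k) y ≤ s}.Nonempty)
      obtain ⟨j, hj⟩ := heS y _ h6
      exact ⟨(y, j), h3, h4, hj ▸ h7, hj ▸ h1.trans h5⟩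
    intro k
    by_cases hk : k < (succ Θ).ord
    · obtain ⟨y, hy⟩ := this k hk
      exact ⟨y, fun _ => hy⟩
    · obtain ⟨y, -⟩ := this 0 hκ.ord_pos
      exact ⟨y, fun h => absurd h hk⟩
  choose y hy using hy
  obtain ⟨α, β, hαβ, hβ, he⟩ := exists_eq_of_card_lt (κ := succ Θ) (by
    rw [mk_prod, Cardinal.lift_id, Cardinal.lift_id]
    exact mul_lt_of_lt (hΘ.trans (le_succ _)) (lt_succ_iff.2 hι) (lt_succ_iff.2 hK)) y
  obtain ⟨-, h1, -, h2⟩ := hy α (hαβ.trans hβ)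
  obtain ⟨h3, -, h4, -⟩ := hy β hβ
  rw [← he] at h3 h4
  have h5 : f (t (succ α)) (y α).1 ≤ f (t β) (y α).1 := by
    rcases (succ_le_iff.2 hαβ).eq_or_lt with h | h
    · rw [h]
    · exact ((htZ β hβ _ h).2 _ h1 h3).le
  exact absurd ((h2.trans_le h5).trans_le h4) (lt_irrefl _)

theorem exists_lub (hf : IsClubIncreasing F Θ ν f) (hι : #ι ≤ Θ) {g : ι → Ordinal.{0}}
    (hg : ∀ ξ < ν.ord, ∀ i, f ξ i ≤ g i) :
    ∃ h : ι → Ordinal.{0}, (∀ ξ < ν.ord, ∀ᶠ i in F, f ξ i ≤ h i) ∧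
      ∀ q : ι → Ordinal.{0}, (∀ ξ < ν.ord, ∀ᶠ i in F, f ξ i ≤ q i) → ∀ᶠ i in F, h i ≤ q i := by
  have hν := hf.isRegular
  have hΘ := hf.aleph0_le
  have hκ : (succ Θ).IsRegular := isRegular_succ hΘ
  have hΘν : succ Θ < ν := ((lt_succ _).trans (lt_succ _)).trans hf.succ_lt
  by_contra! hcon
  let S : (Ordinal.{0} → ι → Ordinal.{0}) → Ordinal.{0} → ι → Set Ordinal.{0} :=
    fun H α y => {s | s = g y ∨ ∃ β < α, H β y = s}
  let pr : (Ordinal.{0} → ι → Ordinal.{0}) → Ordinal.{0} → Ordinal.{0} → ι → Ordinal.{0} :=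
    fun H α ξ y => sInf {s | s ∈ S H α y ∧ f ξ y ≤ s}
  have hSne : ∀ H α, ∀ ξ < ν.ord, ∀ y, {s | s ∈ S H α y ∧ f ξ y ≤ s}.Nonempty :=
    fun H α ξ hξ y => ⟨g y, Or.inl rfl, hg ξ hξ y⟩
  have hloc : ∀ α, ∀ H H' : Ordinal.{0} → ι → Ordinal.{0}, (∀ β < α, H β = H' β) →
      ∀ ξ, pr H α ξ = pr H' α ξ := by
    intro α H H' h ξ
    have : S H α = S H' α := by
      funext y
      ext s
      refine or_congr Iff.rfl ⟨?_, ?_⟩ <;> rintro ⟨β, hβ, h1⟩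
      · exact ⟨β, hβ, by rw [← h β hβ]; exact h1⟩
      · exact ⟨β, hβ, by rw [h β hβ]; exact h1⟩
    simp only [pr, this]
  obtain ⟨H, hH⟩ := exists_dependent_choice (A := ι → Ordinal.{0}) (succ Θ).ord
    (fun α H a => (∀ ξ < ν.ord, ∀ᶠ i in F, f ξ i ≤ a i) ∧
      ∃ ξ < ν.ord, (∀ η < ν.ord, ∀ᶠ y in F, f η y ≤ pr H α ξ y) ∧ ∃ᶠ y in F, a y < pr H α ξ y)
    (fun α _ H H' h a ha => ⟨ha.1, by
      obtain ⟨ξ, hξ, h1⟩ := ha.2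
      rw [hloc α H H' h ξ] at h1
      exact ⟨ξ, hξ, h1⟩⟩)
    (fun α hα H hH => by
      obtain ⟨ξ, hξ, hb⟩ := hf.exists_proj_bound hι (S H α) (K := Option α.ToType) (by
          rw [mk_option, mk_toType']
          exact add_le_of_le hΘ (lt_succ_iff.1 (lt_ord.1 hα)) (one_le_aleph0.trans hΘ))
        (fun o => o.elim g fun β => H (ToType.mk.symm β).1) (by
          rintro y s (rfl | ⟨β, hβ, rfl⟩)
          · exact ⟨none, rfl⟩
          · exact ⟨some (ToType.mk ⟨β, hβ⟩), by simp⟩)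
        (fun ξ hξ => Eventually.of_forall fun y => hSne H α ξ hξ y)
      obtain ⟨q, hq, hqf⟩ := hcon _ hb
      refine ⟨fun i => min (pr H α ξ i) (q i), fun η hη => ?_, ξ, hξ, hb, ?_⟩
      · filter_upwards [hb η hη, hq η hη] with i h1 h2 using le_min h1 h2
      · exact hqf.mono fun i hi => min_lt_of_right_lt hi)
  choose! X hX using fun α hα => (hH α hα).2
  obtain ⟨ξ, hξ, hXξ⟩ := exists_bound_of_regular_ordinal hν (a := (succ Θ).ord)
    (ord_lt_ord.2 hΘν) X (fun α hα => (hX α hα).1)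
  have hanti : ∀ y α β, α ≤ β → pr H β ξ y ≤ pr H α ξ y := fun y α β hαβ =>
    csInf_le_csInf' (hSne H α ξ hξ y) fun s hs => ⟨hs.1.imp id fun ⟨γ, hγ, h⟩ =>
      ⟨γ, hγ.trans_le hαβ, h⟩, hs.2⟩
  have hmin : ∀ y, ∃ α < (succ Θ).ord, ∀ β < (succ Θ).ord, pr H α ξ y ≤ pr H β ξ y := by
    intro y
    obtain ⟨_, ⟨α, hα, rfl⟩, h⟩ := WellFounded.has_min (r := (· < ·)) wellFounded_lt
      {x | ∃ α < (succ Θ).ord, pr H α ξ y = x} ⟨_, 0, hκ.ord_pos, rfl⟩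
    exact ⟨α, hα, fun β hβ => not_lt.1 (h _ ⟨β, hβ, rfl⟩)⟩
  choose A hA hAmin using hmin
  obtain ⟨α, hα, hAα⟩ := exists_bound_of_regular hκ (lt_succ_iff.2 hι) A hA
  obtain ⟨y, h1, h2, h3, h4⟩ := ((hX α hα).2.2.and_eventually
    (((hX α hα).2.1 ξ hξ).and (((hH α hα).1 ξ hξ).and (hf.lt ξ hξ _ (hXξ α hα))))).exists
  have h5 : pr H α ξ y = pr H α (X α) y := by
    refine le_antisymm (csInf_le' ⟨(csInf_mem (hSne H α _ (hX α hα).1 y)).1, h2⟩)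
      (csInf_le_csInf' (hSne H α ξ hξ y) fun s hs => ⟨hs.1, h4.le.trans hs.2⟩)
  have h6 : pr H (succ α) ξ y ≤ H α y := csInf_le' ⟨Or.inr ⟨α, lt_succ α, rfl⟩, h3⟩
  have h7 := (hanti y _ _ (hAα y).le).trans
    (hAmin y _ ((isSuccLimit_ord hκ.aleph0_le).succ_lt hα))
  exact absurd (h7.trans h6) (not_le.2 (h5 ▸ h1))

theorem lt_lub (hf : IsClubIncreasing F Θ ν f) {h : ι → Ordinal.{0}}
    (hub : ∀ ξ < ν.ord, ∀ᶠ i in F, f ξ i ≤ h i) : ∀ ξ < ν.ord, ∀ᶠ i in F, f ξ i < h i := by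
  intro ξ hξ
  have hl := (isSuccLimit_ord hf.isRegular.aleph0_le).succ_lt hξ
  filter_upwards [hf.lt _ hl ξ (lt_succ ξ), hub _ hl] with i h1 h2 using h1.trans_le h2

theorem exists_lt_of_lt_lub (hf : IsClubIncreasing F Θ ν f) (hι : #ι ≤ Θ) {h : ι → Ordinal.{0}}
    (hub : ∀ ξ < ν.ord, ∀ᶠ i in F, f ξ i ≤ h i)
    (hlub : ∀ q : ι → Ordinal.{0}, (∀ ξ < ν.ord, ∀ᶠ i in F, f ξ i ≤ q i) → ∀ᶠ i in F, h i ≤ q i)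
    {g : ι → Ordinal.{0}} (hg : ∀ᶠ i in F, g i < h i) : ∃ ξ < ν.ord, ∀ᶠ i in F, g i < f ξ i := by
  obtain ⟨ξ, hξ, hb⟩ := hf.exists_proj_bound hι (fun y => {s | s = g y ∨ s = h y}) (K := Bool)
    ((lt_aleph0_of_finite _).le.trans hf.aleph0_le) (fun b y => if b then g y else h y) (by
      rintro y s (rfl | rfl)
      · exact ⟨true, rfl⟩
      · exact ⟨false, rfl⟩)
    (fun ξ hξ => (hub ξ hξ).mono fun y hy => ⟨_, Or.inr rfl, hy⟩)
  refine ⟨ξ, hξ, ?_⟩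
  filter_upwards [hlub _ hb, hub ξ hξ, hg] with y h1 h2 h3
  by_contra! h4
  exact absurd ((h1.trans (csInf_le' ⟨Or.inl rfl, h4⟩)).trans_lt h3) (lt_irrefl _)

theorem lt_cof_lub (hf : IsClubIncreasing F Θ ν f) (hι : #ι ≤ Θ) {h : ι → Ordinal.{0}}
    (hub : ∀ ξ < ν.ord, ∀ᶠ i in F, f ξ i ≤ h i)
    (hlub : ∀ q : ι → Ordinal.{0}, (∀ ξ < ν.ord, ∀ᶠ i in F, f ξ i ≤ q i) →
      ∀ᶠ i in F, h i ≤ q i) : ∀ᶠ i in F, Θ < (h i).cof := by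
  have hfam : ∀ y, ∃ e : Ordinal.{0} → Ordinal.{0}, 0 < h y → (h y).cof ≤ Θ →
      (∀ k, e k < h y) ∧ ∀ a < h y, ∃ k < Θ.ord, a ≤ e k := by
    intro y
    by_cases hy : 0 < h y ∧ (h y).cof ≤ Θ
    · obtain ⟨K, u, hK, hu, hc⟩ := exists_cofinal_family (h y)
      obtain ⟨k, -⟩ := hc 0 hy.1
      have : Nonempty K := ⟨k⟩
      obtain ⟨v, hv⟩ := exists_enumeration (hK.trans_le hy.2)
      refine ⟨fun k => u (v k), fun _ _ => ⟨fun k => hu _, fun a ha => ?_⟩⟩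
      obtain ⟨k, hk⟩ := hc a ha
      obtain ⟨ξ, hξ, rfl⟩ := hv k
      exact ⟨ξ, hξ, hk⟩
    · exact ⟨fun _ => 0, fun h1 h2 => absurd ⟨h1, h2⟩ hy⟩
  choose e he using hfam
  obtain ⟨ξ, hξ, hb⟩ := hf.exists_proj_bound hι
    (fun y => {s | (Θ < (h y).cof → s = h y) ∧ (¬ Θ < (h y).cof → ∃ k < Θ.ord, e y k = s)})
    (K := Option Θ.ord.ToType) (by
      rw [mk_option, mk_toType', card_ord]
      exact add_le_of_le hf.aleph0_le le_rfl (one_le_aleph0.trans hf.aleph0_le))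
    (fun o y => o.elim (h y) fun k => e y (ToType.mk.symm k).1) (by
      rintro y s ⟨h1, h2⟩
      by_cases hc : Θ < (h y).cof
      · exact ⟨none, (h1 hc).symm⟩
      · obtain ⟨k, hk, rfl⟩ := h2 hc
        exact ⟨some (ToType.mk ⟨k, hk⟩), by simp⟩)
    (fun ξ hξ => (hf.lt_lub hub ξ hξ).mono fun y hy => by
      by_cases hc : Θ < (h y).cof
      · exact ⟨h y, ⟨fun _ => rfl, fun h1 => absurd hc h1⟩, hy.le⟩
      · obtain ⟨k, hk, h1⟩ := (he y ((zero_le (a := f ξ y)).trans_lt hy) (not_lt.1 hc)).2 _ hy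
        exact ⟨_, ⟨fun h1 => absurd h1 hc, fun _ => ⟨k, hk, rfl⟩⟩, h1⟩)
  filter_upwards [hlub _ hb, hf.lt_lub hub ξ hξ] with y h1 h2
  by_contra hc
  have h0 := (zero_le (a := f ξ y)).trans_lt h2
  obtain ⟨k, hk, h3⟩ := (he y h0 (not_lt.1 hc)).2 _ h2
  have h4 := h1.trans (csInf_le' (a := e y k)
    ⟨⟨fun h1 => absurd h1 hc, fun _ => ⟨k, hk, rfl⟩⟩, h3⟩)
  exact absurd (h4.trans_lt ((he y h0 (not_lt.1 hc)).1 k)) (lt_irrefl _)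

end IsClubIncreasing

namespace IsProgressive

/-- Bounded increasing sequences of regular length below the degree of directedness. -/
theorem exists_isClubIncreasing {ι : Type} {φ : ι → Cardinal.{0}} {Θ Λ x : Cardinal.{0}}
    (hP : IsProgressive φ Θ) (hx : x.IsRegular) (hΘx : succ (succ (succ Θ)) < x) (hxΛ : x ≤ Λ) :
    ∃ f g, InProd φ g ∧ (∀ ξ < x.ord, ∀ i, f ξ i ≤ g i) ∧
      IsClubIncreasing (domFilter φ (succ Λ)) Θ x f := by
  have hΘ3 : succ Θ < succ (succ (succ Θ)) := (lt_succ _).trans (lt_succ _)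
  have hdir : ∀ K : Type, #K ≤ x → ∀ G : K → ι → Ordinal.{0}, (∀ k, InProd φ (G k)) →
      ∃ h, InProd φ h ∧ ∀ k, ∀ᶠ i in domFilter φ (succ Λ), G k i ≤ h i :=
    fun K hK G hG => hP.exists_bound_le (hx.aleph0_le.trans hxΛ) (hK.trans hxΛ) G hG
  obtain ⟨f, hf⟩ := exists_sup_sequence (ν := x) hP.isRegular (F := domFilter φ (succ Λ))
    (fun K hK => hdir K hK.le) (fun _ _ => 0) (fun ξ hξ i => (hP.isRegular i).ord_pos)
  obtain ⟨g, hg, hb⟩ := hdir x.ord.ToType (by rw [mk_toType', card_ord])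
    (fun ξ => f (ToType.mk.symm ξ).1) (fun ξ => (hf _ (ToType.mk.symm ξ).2).1)
  have hb' : ∀ ξ < x.ord, ∀ᶠ i in domFilter φ (succ Λ), f ξ i ≤ g i := fun ξ hξ => by
    simpa using hb (ToType.mk ⟨ξ, hξ⟩)
  refine ⟨fun ξ i => min (f ξ i) (succ (g i)), fun i => succ (g i), hg.succ hP.isRegular,
    fun ξ _ i => min_le_right _ _, hP.aleph0_le, hx, hΘx, fun ξ hξ η hη => ?_, fun ξ hξ hc => ?_⟩
  · filter_upwards [(hf ξ hξ).2.1 η hη, hb' η (hη.trans hξ)] with i h1 h2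
    exact lt_min (min_lt_of_left_lt h1.1) (min_lt_of_left_lt (lt_succ_of_le h2))
  · obtain ⟨⟨c, h1, -, h2⟩, -⟩ := (hf ξ hξ).2.2
      (hc ▸ (hP.aleph0_le.trans_lt (lt_succ Θ)).trans hΘ3)
      (hc ▸ (hP.card_le.trans_lt (lt_succ Θ)).trans hΘ3)
      (Eventually.of_forall fun i => hc ▸ hP.lt i)
    refine ⟨c, h1, ?_⟩
    filter_upwards [h2] with i hi η hη
    exact min_le_min_right _ (hi η hη)

/-- If `∏ φ'` is not dominated by `Λ` functions then every regular cardinal `x ≤ Λ` is needed to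
dominate some product of cofinalities. -/
theorem exists_dominated_succ_of_isRegular {ι ι' : Type} {φ : ι → Cardinal.{0}}
    {φ' : ι' → Cardinal.{0}} {Θ Θ' Λ x : Cardinal.{0}} (hP : IsProgressive φ Θ)
    (hP' : IsProgressive φ' Θ') (hΛ : ¬ Dominated φ' (succ Λ) univ) (hx : x.IsRegular)
    (hΘx : succ (succ (succ Θ')) < x) (hxΛ : x ≤ Λ)
    (hcov : ∀ z : Cardinal.{0}, z.IsRegular → Θ' < z → (∃ i, z < φ' i) → ∃ j, φ j = z) :
    ∃ Y, (∀ j ∈ Y, ∃ i, φ j < φ' i) ∧ Dominated φ (succ x) Y ∧ ¬ Dominated φ x Y := by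
  have hx1 : ℵ₁ ≤ x := by
    rw [← succ_aleph0]
    exact succ_le_of_lt (hP'.aleph0_le.trans_lt (((lt_succ _).trans
      ((lt_succ _).trans (lt_succ _))).trans hΘx))
  set F := domFilter φ' (succ Λ) with hF
  have hne : ¬ ∀ᶠ y in F, False := fun h => hΛ (by
    have := eventually_domFilter.1 h
    simpa using this)
  obtain ⟨f, g, hg, hfg, hf⟩ := hP'.exists_isClubIncreasing hx hΘx hxΛ
  obtain ⟨h, hub, hlub⟩ := hf.exists_lub hP'.card_le hfg
  have hhg : ∀ᶠ y in F, h y ≤ g y := hlub g fun ξ hξ => Eventually.of_forall (hfg ξ hξ)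
  have hcof := hf.lt_cof_lub hP'.card_le hub hlub
  have hs : ∀ y, ∃ s : Ordinal.{0} → Ordinal.{0}, Θ' < (h y).cof →
      (h y).cof.IsRegular ∧ IsNormal s ∧ (∀ α < (h y).cof.ord, s α < h y) ∧
      ∀ a < h y, ∃ α < (h y).cof.ord, a < s α := by
    intro y
    by_cases hy : Θ' < (h y).cof
    · have h0 : ℵ₀ ≤ (h y).cof := hP'.aleph0_le.trans hy.le
      obtain ⟨s, h1, h2, -, h3⟩ := exists_small_club h0
      refine ⟨s, fun _ => ⟨?_, h1, h2, fun a ha => ?_⟩⟩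
      · refine ⟨h0, ?_⟩
        simp
      · obtain ⟨_, ⟨α, hα, rfl⟩, h4, -⟩ := h3.1 a ha
        exact ⟨α, hα, h4⟩
    · exact ⟨id, fun h => absurd h hy⟩
  choose s hs using hs
  have hlt : ∀ y, h y ≤ g y → (h y).cof < φ' y := fun y hy =>
    (Ordinal.cof_le_card _).trans_lt (lt_ord.1 (hy.trans_lt (hg y)))
  have hp : ∀ y, ∃ j : ι, Θ' < (h y).cof → h y ≤ g y → φ j = (h y).cof := by
    intro y
    by_cases hy : Θ' < (h y).cof ∧ h y ≤ g y
    · obtain ⟨j, hj⟩ := hcov _ (hs y hy.1).1 hy.1 ⟨y, hlt y hy.2⟩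
      exact ⟨j, fun _ _ => hj⟩
    · by_cases hn : Nonempty ι
      · exact ⟨hn.some, fun h1 h2 => absurd ⟨h1, h2⟩ hy⟩
      · exact absurd (by
          filter_upwards [hcof, hhg] with y h1 h2
          obtain ⟨j, -⟩ := hcov _ (hs y h1).1 h1 ⟨y, hlt y h2⟩
          exact hn ⟨j⟩) hne
  choose p hp using hp
  have hgood : ∀ᶠ y in F, Θ' < (h y).cof ∧ φ (p y) = (h y).cof := by
    filter_upwards [hcof, hhg] with y h1 h2 using ⟨h1, hp y h1 h2⟩
  have hH : ∀ ξ < x.ord, ∃ H, InProd φ H ∧ ∀ᶠ y in F, ∀ a < (φ (p y)).ord, H (p y) ≤ a →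
      f ξ y < s y a := by
    intro ξ hξ
    have : ∀ y, ∃ α, α < (φ (p y)).ord ∧ (Θ' < (h y).cof → φ (p y) = (h y).cof → f ξ y < h y →
        f ξ y < s y α) := by
      intro y
      by_cases hy : Θ' < (h y).cof ∧ φ (p y) = (h y).cof ∧ f ξ y < h y
      · obtain ⟨α, hα, h1⟩ := (hs y hy.1).2.2.2 _ hy.2.2
        exact ⟨α, hy.2.1 ▸ hα, fun _ _ _ => h1⟩
      · exact ⟨0, (hP.isRegular _).ord_pos, fun h1 h2 h3 => absurd ⟨h1, h2, h3⟩ hy⟩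
    choose α hα hαy using this
    have : ∀ j, ∃ b, b < (φ j).ord ∧ ((∃ y, p y = j ∧ Θ' < φ j) → ∀ y, p y = j → α y < b) := by
      intro j
      by_cases hj : Θ' < φ j
      · obtain ⟨b, hb, h1⟩ := exists_bound_of_regular (hP.isRegular j) (K := {y // p y = j})
          ((mk_subtype_le _).trans_lt (hP'.card_le.trans_lt hj)) (fun y => α y.1)
          (fun y => by have := hα y.1; rwa [y.2] at this)
        exact ⟨b, hb, fun _ y hy => h1 ⟨y, hy⟩⟩
      · exact ⟨0, (hP.isRegular _).ord_pos, fun ⟨_, _, h⟩ => absurd h hj⟩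
    choose H hH hHy using this
    refine ⟨H, hH, ?_⟩
    filter_upwards [hgood, hf.lt_lub hub ξ hξ] with y h1 h2 a ha hHa
    refine (hαy y h1.1 h1.2 h2).trans_le ((hs y h1.1).2.1.strictMono.monotone ?_)
    exact (hHy (p y) ⟨y, rfl, h1.2 ▸ h1.1⟩ y rfl).le.trans hHa
  have hG : ∀ G, InProd φ G → ∀ᶠ y in F, s y (G (p y)) < h y := by
    intro G hG
    filter_upwards [hgood] with y h1
    exact (hs y h1.1).2.2.1 _ (h1.2 ▸ hG _)
  have hlow : ∀ Y, Dominated φ x Y → ∀ᶠ y in F, p y ∉ Y := by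
    classical
    rintro Y ⟨K, G, hK, hGY⟩
    rw [max_eq_left hx1] at hK
    let G' : K → ι → Ordinal.{0} := fun k j => if G k j < (φ j).ord then G k j else 0
    have hG' : ∀ k, InProd φ (G' k) := by
      intro k j
      by_cases hj : G k j < (φ j).ord
      · simp [G', hj]
      · simpa [G', hj] using (hP.isRegular j).ord_pos
    choose X hX hXG using fun k => hf.exists_lt_of_lt_lub hP'.card_le hub hlub (hG _ (hG' k))
    obtain ⟨ξ, hξ, hXξ⟩ := exists_bound_of_regular hx hK X hX
    obtain ⟨H, hHP, hHy⟩ := hH ξ hξ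
    obtain ⟨k, hk⟩ := hGY H hHP
    filter_upwards [hHy, hXG k, hf.lt ξ hξ _ (hXξ k)] with y h1 h2 h3 hy
    obtain ⟨h4, h5⟩ := hk _ hy
    have h6 := h1 _ h5 h4
    simp only [G', if_pos h5] at h2
    exact absurd ((h6.trans h2).trans h3) (lt_irrefl _)
  obtain ⟨Y, hY, hYI⟩ : ∃ Y, Dominated φ (succ x) Y ∧ ¬ ∀ᶠ y in F, p y ∉ Y := by
    by_contra! hcon
    choose! H hHP hHy using hH
    obtain ⟨G, hGP, hHG⟩ := hP.exists_bound_le hx.aleph0_le (K := x.ord.ToType)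
      (by rw [mk_toType', card_ord]) (fun ξ => H (ToType.mk.symm ξ).1)
      (fun ξ => hHP _ (ToType.mk.symm ξ).2)
    have hle : ∀ᶠ y in F, h y ≤ s y (G (p y)) := by
      refine hlub _ fun ξ hξ => ?_
      have h1 := hcon _ (eventually_domFilter.1 (hHG (ToType.mk ⟨ξ, hξ⟩)))
      filter_upwards [h1, hHy ξ hξ] with y h2 h3
      refine (h3 _ (hGP _) ?_).le
      simpa using h2
    exact hne (by filter_upwards [hle, hG G hGP] with y h1 h2 using absurd h2 (not_lt.2 h1))
  have hsmall : ∀ᶠ y in F, ∃ i, φ (p y) < φ' i := by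
    filter_upwards [hgood, hhg] with y h1 h2
    refine ⟨y, ?_⟩
    rw [h1.2]
    exact hlt y h2
  refine ⟨Y ∩ {j | ∃ i, φ j < φ' i}, fun j hj => hj.2, hY.subset inter_subset_left, fun hd =>
    hYI ?_⟩
  filter_upwards [hlow _ hd, hsmall] with y h1 h2 h3
  exact h1 ⟨h3, h2⟩

end IsProgressive

theorem exists_injOn_lt_ord_aleph {o δ : Ordinal.{0}} (ho : o < (succ (ℵ_ δ)).ord) :
    ∃ e : Ordinal.{0} → Ordinal.{0}, (∀ x ≤ o, e x < (ℵ_ δ).ord) ∧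
      ∀ x ≤ o, ∀ y ≤ o, e x = e y → x = y := by
  have h1 : #(succ o).ToType ≤ #(ℵ_ δ).ord.ToType := by
    rw [mk_toType', mk_toType', card_ord]
    exact lt_succ_iff.1 (lt_ord.1 ((isSuccLimit_ord ((aleph0_le_aleph δ).trans
      (le_succ _))).succ_lt ho))
  obtain ⟨E⟩ := h1
  refine ⟨fun x => if h : x ≤ o then (ToType.mk.symm (E (ToType.mk ⟨x, lt_succ_of_le h⟩))).1
    else 0, fun x hx => ?_, fun x hx y hy h => ?_⟩
  · simp only [dif_pos hx]
    exact (ToType.mk.symm _).2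
  · simp only [dif_pos hx, dif_pos hy] at h
    have := ToType.mk.injective (E.injective (ToType.mk.symm.injective (Subtype.ext h)))
    exact congrArg Subtype.val this

/-- Increasing sequences of length `ℵ_{δ+1}`, modulo bounded sets, in a product of successors of
alephs converging to `ℵ_δ`. -/
theorem exists_sup_sequence_of_isNormal {μ : Cardinal.{0}} (hμ : μ.IsRegular)
    {δ : Ordinal.{0} → Ordinal.{0}} (hδ : IsNormal δ) :
    ∃ f : Ordinal.{0} → μ.ord.ToType → Ordinal.{0},
      ∀ ξ < (succ (ℵ_ (δ μ.ord))).ord,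
        InProd (fun a : μ.ord.ToType => succ (ℵ_ (δ (ToType.mk.symm a).1))) (f ξ) ∧
        (∀ η < ξ, ∀ᶠ i in atTop, f η i < f ξ i) ∧
        (ℵ₀ < ξ.cof → μ < ξ.cof → ξ.cof < ℵ_ (δ μ.ord) →
          ∃ c, IsClubIn ξ c ∧ ∀ᶠ y in atTop, ∀ η ∈ c, f η y ≤ f ξ y) := by
  have hl : IsSuccLimit μ.ord := isSuccLimit_ord hμ.aleph0_le
  have hreg : ∀ a : μ.ord.ToType, (succ (ℵ_ (δ (ToType.mk.symm a).1))).IsRegular :=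
    fun a => isRegular_succ (aleph0_le_aleph _)
  have hev : ∀ c < ℵ_ (δ μ.ord), ∀ᶠ a : μ.ord.ToType in atTop,
      c < ℵ_ (δ (ToType.mk.symm a).1) := by
    intro c hc
    obtain ⟨α, hα, h⟩ := ((isNormal_aleph.comp hδ).lt_iff_exists_lt hl).1 hc
    filter_upwards [eventually_ge_atTop (ToType.mk ⟨α, hα⟩)] with a ha
    refine h.trans_le (aleph_le_aleph.2 (hδ.strictMono.monotone ?_))
    have := ToType.mk.symm.monotone ha
    rwa [OrderIso.symm_apply_apply] at this
  obtain ⟨f, hf⟩ := exists_sup_sequence (F := atTop) (ν := succ (ℵ_ (δ μ.ord))) hreg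
    (fun K hK G hG => by
      by_cases hne : Nonempty K
      · obtain ⟨e, he⟩ := exists_enumeration (lt_succ_iff.1 hK)
        have : ∀ a : μ.ord.ToType, ∃ b < (succ (ℵ_ (δ (ToType.mk.symm a).1))).ord,
            ∀ x < (ℵ_ (δ (ToType.mk.symm a).1)).ord, G (e x) a < b := fun a =>
          exists_bound_of_regular_ordinal (hreg a) (ord_lt_ord.2 (lt_succ _)) _
            fun x _ => hG _ _
        choose b hb hGb using this
        refine ⟨b, hb, fun k => ?_⟩
        obtain ⟨x, hx, rfl⟩ := he k
        filter_upwards [hev _ (lt_ord.1 hx)] with a ha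
        exact (hGb a x (lt_ord.2 ha)).le
      · exact ⟨fun _ => 0, fun i => (hreg i).ord_pos, fun k => absurd ⟨k⟩ hne⟩)
    (fun _ _ => 0) (fun ξ hξ i => (hreg i).ord_pos)
  refine ⟨f, fun ξ hξ => ⟨(hf ξ hξ).1, fun η hη => ((hf ξ hξ).2.1 η hη).mono fun i h => h.1,
    fun h0 h1 h2 => ?_⟩⟩
  obtain ⟨⟨c, hc, -, h⟩, -⟩ := (hf ξ hξ).2.2 h0 (by rwa [mk_toType', card_ord])
    ((hev _ h2).mono fun i hi => hi.trans (lt_succ _))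
  exact ⟨c, hc, h⟩

/-- Shelah: the successors of the alephs at club many points of a normal sequence with limit `δ`
have a product dominated by `ℵ_{δ+1}` functions. -/
theorem exists_isClubIn_dominated {μ : Cardinal.{0}} (hμ : μ.IsRegular) (hμ' : ℵ₀ < μ)
    {δ : Ordinal.{0} → Ordinal.{0}} (hδ : IsNormal δ)
    (h0 : succ (succ (succ μ)) < succ (ℵ_ (δ 0))) :
    ∃ D, IsClubIn μ.ord D ∧
      Dominated (fun a : μ.ord.ToType => succ (ℵ_ (δ (ToType.mk.symm a).1)))
        (succ (succ (ℵ_ (δ μ.ord)))) {a | (ToType.mk.symm a).1 ∈ D} := by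
  by_contra! hcon
  have hl : IsSuccLimit μ.ord := isSuccLimit_ord hμ.aleph0_le
  set φ : μ.ord.ToType → Cardinal.{0} := fun a => succ (ℵ_ (δ (ToType.mk.symm a).1)) with hφ
  have hP : IsProgressive φ μ := by
    refine ⟨hμ'.le, by rw [mk_toType', card_ord], fun a => isRegular_succ (aleph0_le_aleph _),
      fun a => h0.trans_le (succ_le_succ (aleph_le_aleph.2 (hδ.strictMono.monotone
        (zero_le (a := (ToType.mk.symm a).1)))))⟩
  set N := succ (ℵ_ (δ μ.ord)) with hN
  have hNr : N.IsRegular := isRegular_succ (aleph0_le_aleph _)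
  have hμN : μ < N := by
    refine ((((lt_succ _).trans (lt_succ _)).trans (lt_succ _)).trans h0).trans_le
      (succ_le_succ (aleph_le_aleph.2 (hδ.strictMono.monotone (zero_le (a := μ.ord)))))
  have hμδ : μ < ℵ_ (δ 0) := ((lt_succ _).trans (lt_succ _)).trans
    ((lt_succ _).trans_le (lt_succ_iff.1 h0))
  obtain ⟨f, hf⟩ := exists_sup_sequence_of_isNormal hμ hδ
  obtain ⟨g, hg, hfg⟩ := hP.exists_bound_le hNr.aleph0_le (K := N.ord.ToType)
    (by rw [mk_toType', card_ord]) (fun ξ => f (ToType.mk.symm ξ).1)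
    (fun ξ => (hf _ (ToType.mk.symm ξ).2).1)
  choose e he hinj using fun a => exists_injOn_lt_ord_aleph (hg a)
  have key : ∀ ξ < N.ord, ∃ γ < μ.ord, ∀ β < μ.ord, ∃ a : μ.ord.ToType,
      β < (ToType.mk.symm a).1 ∧ f ξ a ≤ g a ∧ e a (f ξ a) < (ℵ_ (δ γ)).ord := by
    intro ξ hξ
    have hlim : IsClubIn μ.ord {x | 0 < x ∧ ∀ a < x, succ a < x} :=
      isClubIn_closure hμ hμ' fun x hx => hl.succ_lt hx
    have hstat : ∀ C, IsClubIn μ.ord C → ∃ x < μ.ord, x ∈ {x | IsSuccLimit x ∧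
        ∀ h : x < μ.ord, f ξ (ToType.mk ⟨x, h⟩) ≤ g (ToType.mk ⟨x, h⟩)} ∧ x ∈ C := by
      intro C hC
      by_contra! h
      refine hcon _ (hC.inter (by rwa [hμ.cof_ord]) hlim) ((eventually_domFilter.1
        (hfg (ToType.mk ⟨ξ, hξ⟩))).subset ?_)
      intro a ha
      rw [Set.mem_ofPred_eq, OrderIso.symm_apply_apply]
      intro hle
      refine h _ (ToType.mk.symm a).2 ⟨?_, fun h' => ?_⟩ ha.1
      · exact ⟨not_isMin_of_lt ha.2.1, isSuccPrelimit_of_succ_lt ha.2.2⟩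
      · have : ToType.mk ⟨(ToType.mk.symm a).1, h'⟩ = a := ToType.mk.apply_symm_apply a
        rwa [this]
    have hr : ∀ x, ∃ r, ∀ h : x < μ.ord, IsSuccLimit x →
        f ξ (ToType.mk ⟨x, h⟩) ≤ g (ToType.mk ⟨x, h⟩) → r < x ∧
        e (ToType.mk ⟨x, h⟩) (f ξ (ToType.mk ⟨x, h⟩)) < (ℵ_ (δ r)).ord := by
      intro x
      by_cases hx : ∃ h : x < μ.ord, IsSuccLimit x ∧
        f ξ (ToType.mk ⟨x, h⟩) ≤ g (ToType.mk ⟨x, h⟩)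
      · obtain ⟨h, h1, h2⟩ := hx
        have h3 := he _ _ h2
        rw [OrderIso.symm_apply_apply, ord_aleph] at h3
        obtain ⟨r, hr, h4⟩ := ((isNormal_omega.comp hδ).lt_iff_exists_lt h1).1 h3
        refine ⟨r, fun _ _ _ => ⟨hr, ?_⟩⟩
        rw [ord_aleph]
        exact h4
      · exact ⟨0, fun h h1 h2 => absurd ⟨h, h1, h2⟩ hx⟩
    choose r hr using hr
    obtain ⟨γ, hγ, hst⟩ := exists_stationary_fiber hμ hμ' hstat r
      (fun x hx hxμ _ => (hr x hxμ hx.1 (hx.2 hxμ)).1)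
    refine ⟨γ, hγ, fun β hβ => ?_⟩
    obtain ⟨x, hx, hxS, rfl, hxC⟩ := hst _ (isClubIn_closure hμ hμ' (N := fun _ => β)
      fun _ _ => hβ)
    refine ⟨ToType.mk ⟨x, hx⟩, ?_, hxS.2 hx, (hr x hx hxS.1 (hxS.2 hx)).2⟩
    rw [OrderIso.symm_apply_apply]
    exact hxC.2 0 hxC.1
  choose! γ hγ hγf using key
  obtain ⟨γ₀, hγ₀, hT⟩ : ∃ γ₀ < μ.ord, ∀ a < N.ord, ∃ t ∈ {t | t < N.ord ∧ γ t = γ₀},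
      a < t ∧ t < N.ord := by
    by_contra! h
    choose! b hb hbN using h
    obtain ⟨B, hB, hbB⟩ := exists_bound_of_regular_ordinal hNr (ord_lt_ord.2 hμN) b hb
    exact absurd hB (not_lt.2 (hbN _ (hγ B hB) B ⟨hB, rfl⟩ (hbB _ (hγ B hB))))
  set Θ := max μ (ℵ_ (δ γ₀)) with hΘ
  have hΘe : Θ = ℵ_ (δ γ₀) := max_eq_right (hμδ.le.trans (aleph_le_aleph.2
    (hδ.strictMono.monotone (zero_le (a := γ₀)))))
  have hΘ0 : ℵ₀ ≤ Θ := hμ'.le.trans (le_max_left _ _)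
  have hstep : ∀ γ < μ.ord, succ (ℵ_ (δ γ)) ≤ ℵ_ (δ (succ γ)) := fun γ _ =>
    succ_le_of_lt (aleph_lt_aleph.2 (hδ.strictMono (lt_succ γ)))
  have hΘ3 : succ (succ (succ Θ)) < ℵ_ (δ μ.ord) := by
    rw [hΘe]
    have h1 := hl.succ_lt hγ₀
    have h2 := hl.succ_lt h1
    exact ((succ_le_succ ((succ_le_succ (hstep _ hγ₀)).trans (hstep _ h1))).trans
      (hstep _ h2)).trans_lt (aleph_lt_aleph.2 (hδ.strictMono (hl.succ_lt h2)))
  have hΘs : Θ < succ (succ (succ Θ)) := ((lt_succ _).trans (lt_succ _)).trans (lt_succ _)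
  obtain ⟨t, Z, ht, htZ⟩ := exists_strongly_increasing hΘ0 hNr (hΘ3.trans (lt_succ _)) f
    (fun ξ hξ => (hf ξ hξ).2.1)
    (fun ξ hξ hc => (hf ξ hξ).2.2 (hc ▸ hΘ0.trans_lt hΘs)
      (hc ▸ (le_max_left _ _).trans_lt hΘs) (hc ▸ hΘ3)) _ hT
  have hκ : (succ Θ).IsRegular := isRegular_succ hΘ0
  have hne : Nonempty μ.ord.ToType := ⟨ToType.mk ⟨0, hμ.ord_pos⟩⟩
  have hpt : ∀ k, ∃ p : μ.ord.ToType × (ℵ_ (δ γ₀)).ord.ToType, k < (succ Θ).ord →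
      p.1 ∉ Z k ∧ f (t k) p.1 ≤ g p.1 ∧ e p.1 (f (t k) p.1) = (ToType.mk.symm p.2).1 := by
    have : ∀ k < (succ Θ).ord, ∃ p : μ.ord.ToType × (ℵ_ (δ γ₀)).ord.ToType,
        p.1 ∉ Z k ∧ f (t k) p.1 ≤ g p.1 ∧ e p.1 (f (t k) p.1) = (ToType.mk.symm p.2).1 := by
      intro k hk
      obtain ⟨⟨h1, h2⟩, -, h3⟩ := ht k hk
      obtain ⟨b, hb⟩ := eventually_atTop.1 h3
      obtain ⟨a, ha, h4, h5⟩ := hγf _ h1 (ToType.mk.symm b).1 (ToType.mk.symm b).2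
      rw [h2] at h5
      refine ⟨(a, ToType.mk ⟨_, h5⟩), hb a ?_, h4, by simp⟩
      exact (ToType.mk.symm.le_iff_le).1 ha.le
    intro k
    by_cases hk : k < (succ Θ).ord
    · obtain ⟨p, hp⟩ := this k hk
      exact ⟨p, fun _ => hp⟩
    · obtain ⟨p, -⟩ := this 0 hκ.ord_pos
      exact ⟨p, fun h => absurd h hk⟩
  choose p hp using hpt
  obtain ⟨k', k, hkk, hk, hpe⟩ := exists_eq_of_card_lt (κ := succ Θ) (by
    rw [mk_prod, Cardinal.lift_id, Cardinal.lift_id, mk_toType', mk_toType', card_ord, card_ord]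
    exact mul_lt_of_lt hκ.aleph0_le (lt_succ_iff.2 (le_max_left _ _))
      (lt_succ_iff.2 (le_max_right _ _))) p
  obtain ⟨h1, h2, h3⟩ := hp k' (hkk.trans hk)
  obtain ⟨h4, h5, h6⟩ := hp k hk
  rw [← hpe] at h4 h5 h6
  exact ((htZ k hk k' hkk).2 _ h1 h4).ne (hinj _ _ h2 _ h5 (h3.trans h6.symm))

theorem Dominated.of_injOn {ι ι' : Type} {φ : ι → Cardinal.{0}} {φ' : ι' → Cardinal.{0}}
    {ν : Cardinal.{0}} {S : Set ι'} (hS : Dominated φ' ν S) (hφ' : ∀ i, (φ' i).IsRegular)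
    (Y : Set ι) (e : ι → ι') (he : ∀ i ∈ Y, e i ∈ S ∧ φ' (e i) = φ i)
    (hinj : ∀ i ∈ Y, ∀ j ∈ Y, e i = e j → i = j) : Dominated φ ν Y := by
  obtain ⟨K, g, hK, hg⟩ := hS
  refine ⟨K, fun k i => g k (e i), hK, fun H hH => ?_⟩
  have : ∀ b, ∃ x, x < (φ' b).ord ∧ ∀ a ∈ Y, e a = b → H a = x := by
    intro b
    by_cases hb : ∃ a ∈ Y, e a = b
    · obtain ⟨a, ha, rfl⟩ := hb
      exact ⟨H a, (he a ha).2 ▸ hH a, fun a' ha' h => by rw [hinj a' ha' a ha h]⟩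
    · exact ⟨0, (hφ' b).ord_pos, fun a ha h => absurd ⟨a, ha, h⟩ hb⟩
  choose H' hH' hHe using this
  obtain ⟨k, hk⟩ := hg H' hH'
  refine ⟨k, fun i hi => ?_⟩
  have := hk _ (he i hi).1
  rwa [← hHe _ i hi rfl, (he i hi).2] at this

theorem Dominated.finset_biUnion {ι κ : Type} {φ : ι → Cardinal.{0}} {ν : Cardinal.{0}}
    {c : κ → Set ι} (t : Finset κ) (h : ∀ i ∈ t, Dominated φ ν (c i)) :
    Dominated φ ν {a | ∃ i ∈ t, a ∈ c i} := by
  classical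
  induction t using Finset.induction_on with
  | empty => simpa using dominated_empty φ ν
  | insert i t _ ih =>
    refine ((h i (Finset.mem_insert_self i t)).union
      (ih fun j hj => h j (Finset.mem_insert_of_mem hj))).subset ?_
    rintro a ⟨j, hj, ha⟩
    rcases Finset.mem_insert.1 hj with rfl | hj
    · exact Or.inl ha
    · exact Or.inr ⟨j, hj, ha⟩

/-- Shelah's bound: the product of a progressive family of regular cardinals below `ℵ_δ` is
dominated by `ℵ_b` functions, where `b` is a limit of cofinality `κ⁺⁺⁺⁺` for some `κ ≥ |δ|`. -/
theorem dominated_univ_of_generating {ι ι' : Type} {φ : ι → Cardinal.{0}} {φ' : ι' → Cardinal.{0}}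
    {κ Θ : Cardinal.{0}} {δ b : Ordinal.{0}} (hκ : ℵ₀ ≤ κ) (hκΘ : κ ≤ Θ)
    (hP : IsProgressive φ Θ) (hP' : IsProgressive φ' (succ (succ (succ Θ))))
    (hφinj : Function.Injective φ)
    (hΘδ : succ (succ (succ (succ (succ (succ Θ))))) < ℵ_ δ)
    (hφδ : #{i | φ i < ℵ_ δ} ≤ κ) (hφ'δ : ∀ i, φ' i < ℵ_ δ)
    (hb : b.cof = succ (succ (succ (succ κ)))) (hδb : δ < b)
    (hcov : ∀ x : Cardinal.{0}, x.IsRegular → succ (succ (succ Θ)) < x → x ≤ ℵ_ b → ∃ i, φ i = x) :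
    Dominated φ' (succ (ℵ_ b)) univ := by
  by_contra hΛ
  set μ := succ (succ (succ κ)) with hμdef
  have hκ1 : (succ κ).IsRegular := isRegular_succ hκ
  have hμ : μ.IsRegular := isRegular_succ ((hκ.trans (le_succ _)).trans (le_succ _))
  have hκμ : κ < μ := ((lt_succ _).trans (lt_succ _)).trans (lt_succ _)
  have hμ0 : ℵ₀ < μ := hκ.trans_lt hκμ
  have hbl : IsSuccLimit b := isSuccLimit_of_aleph0_lt_cof (by
    rw [hb]; exact (hμ0.trans (lt_succ _)).le)
  obtain ⟨g, hg⟩ := club_guessing hμ hκ1 (lt_succ (succ (succ κ)))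
  obtain ⟨c, hc1, hc2, hc3, hc4⟩ := hP.exists_transitive_generators
  let Y : Ordinal.{0} → Ordinal.{0} → (Ordinal.{0} → Ordinal.{0}) → Set ι := fun i η s =>
    {a | ∃ k < (succ κ).ord, g i k < η ∧ φ a = succ (ℵ_ (s (g i k)))}
  have hstep : ∀ β s, ∃ a, β ≤ μ.ord → a < b ∧ ∀ i < μ.ord, ∀ η ≤ β,
      (∃ j < b, Dominated φ (succ (ℵ_ j)) (Y i η s)) → Dominated φ (succ (ℵ_ a)) (Y i η s) := by
    intro β s
    by_cases hβ : β ≤ μ.ord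
    · have : ∀ i η, ∃ j < b, (∃ j < b, Dominated φ (succ (ℵ_ j)) (Y i η s)) →
          Dominated φ (succ (ℵ_ j)) (Y i η s) := by
        intro i η
        by_cases h : ∃ j < b, Dominated φ (succ (ℵ_ j)) (Y i η s)
        · obtain ⟨j, hj, hd⟩ := h
          exact ⟨j, hj, fun _ => hd⟩
        · exact ⟨0, (zero_le (a := δ)).trans_lt hδb, fun h' => absurd h' h⟩
      choose j hj hjd using this
      obtain ⟨a, ha, haj⟩ := exists_bound_of_lt_cof (o := b)
        (K := μ.ord.ToType × (succ β).ToType) (by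
          rw [mk_prod, Cardinal.lift_id, Cardinal.lift_id, mk_toType', mk_toType', card_ord, hb]
          refine mul_lt_of_lt (hμ.aleph0_le.trans (le_succ _)) (lt_succ _) (lt_ord.1 ?_)
          exact (isSuccLimit_ord (hμ.aleph0_le.trans (le_succ _))).succ_lt
            (hβ.trans_lt (ord_lt_ord.2 (lt_succ _))))
        (fun p => j (ToType.mk.symm p.1).1 (ToType.mk.symm p.2).1) (fun _ => hj _ _)
      refine ⟨a, fun _ => ⟨ha, fun i hi η hη h => (hjd i η h).mono (succ_le_succ
        (aleph_le_aleph.2 ?_))⟩⟩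
      simpa using haj (ToType.mk ⟨i, hi⟩, ToType.mk ⟨η, lt_succ_of_le hη⟩)
    · exact ⟨0, fun h => absurd h hβ⟩
  choose step hstep using hstep
  obtain ⟨s, hs, hs0, hslt, hsb⟩ := exists_normal_of_step δ step
  have hsμ : ∀ α ≤ μ.ord, s α < b := fun α hα => hsb (succ μ.ord) b
    (succ_le_of_lt (by rw [hb]; exact ord_lt_ord.2 (lt_succ _))) hδb
    (fun β hβ _ => (hstep β _ (lt_succ_iff.1 hβ)).1) α (lt_succ_of_le hα)
  have hδs : ∀ α, ℵ_ δ ≤ ℵ_ (s α) := fun α => aleph_le_aleph.2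
    (hs0 ▸ hs.strictMono.monotone (zero_le (a := α)))
  have h6 : μ ≤ succ (succ (succ Θ)) := succ_le_succ (succ_le_succ (succ_le_succ hκΘ))
  have hΘ3 : succ (succ (succ Θ)) < ℵ_ δ :=
    (((lt_succ _).trans (lt_succ _)).trans (lt_succ _)).trans hΘδ
  obtain ⟨D, hD, hDd⟩ := exists_isClubIn_dominated hμ hμ0 hs
    (((succ_le_succ (succ_le_succ (succ_le_succ h6))).trans_lt hΘδ).trans_le
      ((hδs 0).trans (le_succ _)))
  obtain ⟨i, hi, hicof, hgD, hgcof⟩ := hg D hD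
  have hYd : ∀ η, ∃ j < b, Dominated φ (succ (ℵ_ j)) (Y i η s) := by
    intro η
    refine ⟨succ (s μ.ord), hbl.succ_lt (hsμ _ le_rfl), ?_⟩
    have h2 : ℵ_ (succ (s μ.ord)) = succ (ℵ_ (s μ.ord)) := by rw [succ_aleph, succ_eq_add_one]
    rw [h2]
    have hne : Nonempty μ.ord.ToType := ⟨ToType.mk ⟨0, hμ.ord_pos⟩⟩
    have : ∀ a, ∃ k : μ.ord.ToType, a ∈ Y i η s → (ToType.mk.symm k).1 ∈ D ∧
        succ (ℵ_ (s (ToType.mk.symm k).1)) = φ a := by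
      intro a
      by_cases ha : a ∈ Y i η s
      · obtain ⟨k, hk, -, h⟩ := ha
        obtain ⟨h3, h4, -⟩ := hgD k hk
        exact ⟨ToType.mk ⟨_, h4.trans hi⟩, fun _ => by
          rw [OrderIso.symm_apply_apply]; exact ⟨h3, h.symm⟩⟩
      · exact ⟨hne.some, fun h => absurd h ha⟩
    choose e he using this
    exact hDd.of_injOn (fun a => isRegular_succ (aleph0_le_aleph _)) _ e he
      (fun a ha a' ha' h => hφinj (by rw [← (he a ha).2, ← (he a' ha').2, h]))
  have hYlt : ∀ η ≤ μ.ord, ∀ α > η, Dominated φ (succ (ℵ_ (s α))) (Y i η s) := by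
    intro η hη α hα
    have h1 : Y i η (upTo s η) = Y i η s := by
      ext a
      refine exists_congr fun k => and_congr Iff.rfl (and_congr_right fun hk => ?_)
      rw [upTo, if_pos hk.le]
    have h2 := (hstep η (upTo s η) hη).2 i hi η le_rfl
    rw [h1] at h2
    exact (h2 (hYd η)).mono (succ_le_succ (aleph_le_aleph.2 (hslt η α hα).le))
  have hη : ∀ a : {a | φ a < ℵ_ δ}, ∃ η < i, (∃ z ∈ Y i i s, a.1 ∈ c z) →
      ∃ z ∈ Y i η s, a.1 ∈ c z := by
    intro a
    by_cases ha : ∃ z ∈ Y i i s, a.1 ∈ c z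
    · obtain ⟨z, ⟨k, hk, hki, hz⟩, haz⟩ := ha
      obtain ⟨k', hk', hlt⟩ := hgcof _ hki
      exact ⟨g i k', (hgD k' hk').2.1, fun _ => ⟨z, ⟨k, hk, hlt, hz⟩, haz⟩⟩
    · refine ⟨0, pos_iff_ne_zero.2 ?_, fun h => absurd h ha⟩
      rintro rfl
      rw [Ordinal.cof_zero] at hicof
      exact (hκ1.aleph0_le.trans_lt' aleph0_pos).ne hicof
  choose η hηi hηz using hη
  obtain ⟨η₀, hη₀, hb₀⟩ := exists_bound_of_lt_cof (by
    rw [hicof]; exact lt_succ_iff.2 hφδ) η hηi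
  obtain ⟨k, hk, hkη⟩ := hgcof η₀ hη₀
  set α := g i k with hα
  have hαμ : α < μ.ord := (hgD k hk).2.1.trans hi
  have hxb : succ (ℵ_ (s α)) ≤ ℵ_ b := succ_le_of_lt (aleph_lt_aleph.2 (hsμ α hαμ.le))
  have hxr : (succ (ℵ_ (s α))).IsRegular := isRegular_succ (aleph0_le_aleph _)
  obtain ⟨z, hz⟩ := hcov _ hxr (hΘ3.trans_le ((hδs α).trans (le_succ _))) hxb
  obtain ⟨Z, hZδ, hZ, hZx⟩ := hP.exists_dominated_succ_of_isRegular hP' hΛ hxr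
    (hΘδ.trans_le ((hδs α).trans (le_succ _))) hxb (fun x hx hΘx ⟨j, hj⟩ => hcov x hx hΘx
      ((hj.trans (hφ'δ j)).le.trans (aleph_le_aleph.2 hδb.le)))
  have hsub : Z ∩ c z ⊆ {a | ∃ y ∈ Y i η₀ s, a ∈ c y} := by
    rintro a ⟨haZ, haz⟩
    obtain ⟨j, hj⟩ := hZδ a haZ
    obtain ⟨y, ⟨l, hl, hlη, hy⟩, hay⟩ := hηz ⟨a, hj.trans (hφ'δ j)⟩
      ⟨z, ⟨k, hk, (hgD k hk).2.1, hz⟩, haz⟩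
    exact ⟨y, ⟨l, hl, hlη.trans_le (hb₀ _), hy⟩, hay⟩
  obtain ⟨t, ht, htY⟩ := hP.exists_finset_cover hc4 (ϑ := succ (succ (succ Θ))) hP.lt hcov
    (aleph_le_aleph.2 (hsμ α hαμ.le).le) (hYlt η₀ (hη₀.trans hi).le α hkη)
  refine hZx (((Dominated.finset_biUnion t fun j hj => ((hc3 j).mono (succ_le_succ
    (ht j hj)))).union (eventually_domFilter.1 (hz ▸ hc4 z Z (hz ▸ hZ)))).subset fun a ha => ?_)
  by_cases haz : a ∈ c z
  · obtain ⟨y, hy, hay⟩ := hsub ⟨ha, haz⟩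
    obtain ⟨j, hj, hyj⟩ := htY y hy
    exact Or.inl ⟨j, hj, hc2 j y hyj hay⟩
  · exact Or.inr fun h => haz (h ha)

/-- `lam` many sets of size `θ` such that every set of at most `θ` ordinals below `o` is contained
in the union of fewer than `σ` of them. -/
def HasCover (lam θ σ : Cardinal.{0}) (o : Ordinal.{0}) : Prop :=
  ∃ (L : Type) (P : L → θ.ord.ToType → Ordinal.{0}), #L ≤ lam ∧
    ∀ X : θ.ord.ToType → Ordinal.{0}, (∀ i, X i < o) →
      ∃ S : Set L, #S < σ ∧ ∀ i, ∃ l ∈ S, ∃ j, P l j = X i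

theorem exists_cofinal_function {θ : Cardinal.{0}} (hθ : ℵ₀ ≤ θ) (β : Ordinal.{0}) (hβ : 0 < β) :
    ∃ e : Ordinal.{0} → Ordinal.{0},
      (β.cof ≤ θ → (∀ x, e x < β) ∧ ∀ a < β, ∃ x < θ.ord, a ≤ e x) ∧
      (θ < β.cof → (∀ x < β.cof.ord, e x < β) ∧
        ∀ a < β, ∃ x < β.cof.ord, ∀ y ≥ x, a ≤ e y) := by
  rcases le_or_gt β.cof θ with h | h
  · obtain ⟨K, f, hK, hf, hc⟩ := exists_cofinal_family β
    obtain ⟨k, -⟩ := hc 0 hβ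
    have : Nonempty K := ⟨k⟩
    obtain ⟨v, hv⟩ := exists_enumeration (hK.trans_le h)
    refine ⟨fun x => f (v x), fun _ => ⟨fun x => hf _, fun a ha => ?_⟩, fun h' =>
      absurd h (not_le.2 h')⟩
    obtain ⟨k, hk⟩ := hc a ha
    obtain ⟨x, hx, rfl⟩ := hv k
    exact ⟨x, hx, hk⟩
  · obtain ⟨s, h1, h2, -, h3⟩ := exists_small_club (hθ.trans h.le)
    refine ⟨s, fun h' => absurd h' (not_le.2 h), fun _ => ⟨h2, fun a ha => ?_⟩⟩
    obtain ⟨_, ⟨x, hx, rfl⟩, h4, -⟩ := h3.1 a ha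
    exact ⟨x, hx, fun y hy => h4.le.trans (h1.strictMono.monotone hy)⟩

theorem hasCover_of_dominated {ι : Type} {φ : ι → Cardinal.{0}} {θ Λ : Cardinal.{0}}
    {o : Ordinal.{0}} (hθ : ℵ₀ ≤ θ) (hΛ : ℵ₀ ≤ Λ) (hφ : ∀ i, (φ i).IsRegular)
    (hφθ : ∀ i, θ < φ i)
    (hcov : ∀ β ≤ o, θ < β.cof → ∃ i, φ i = β.cof) (hd : Dominated φ (succ Λ) univ) :
    HasCover Λ θ ℵ₁ o := by
  classical
  obtain ⟨L, G, hL, hG⟩ := hd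
  have hL : #L ≤ Λ := by
    refine lt_succ_iff.1 (hL.trans_le (max_le le_rfl ?_))
    rw [← succ_aleph0]
    exact succ_le_succ hΛ
  have hLne : Nonempty L := by
    obtain ⟨k, -⟩ := hG (fun _ => 0) fun i => (hφ i).ord_pos
    exact ⟨k⟩
  have he : ∀ β : Ordinal.{0}, ∃ e : Ordinal.{0} → Ordinal.{0}, 0 < β →
      (β.cof ≤ θ → (∀ x, e x < β) ∧ ∀ a < β, ∃ x < θ.ord, a ≤ e x) ∧
      (θ < β.cof → (∀ x < β.cof.ord, e x < β) ∧
        ∀ a < β, ∃ x < β.cof.ord, ∀ y ≥ x, a ≤ e y) := by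
    intro β
    by_cases hβ : 0 < β
    · obtain ⟨e, h⟩ := exists_cofinal_function hθ β hβ
      exact ⟨e, fun _ => h⟩
    · exact ⟨id, fun h => absurd h hβ⟩
  choose e he using he
  let step : Ordinal.{0} → L × θ.ord.ToType → Ordinal.{0} := fun β p =>
    if h : θ < β.cof ∧ β ≤ o then e β (G p.1 (hcov β h.2 h.1).choose)
    else e β (ToType.mk.symm p.2).1
  have hstep : ∀ X B : θ.ord.ToType → Ordinal.{0}, (∀ i, B i ≤ o) → ∃ (g : L)
      (c : θ.ord.ToType → θ.ord.ToType), ∀ i, X i < B i →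
        X i ≤ step (B i) (g, c i) ∧ step (B i) (g, c i) < B i := by
    intro X B hB
    have h1 : ∀ i, ∃ x, X i < B i → (∀ h : θ < (B i).cof ∧ B i ≤ o,
        x < (φ (hcov _ h.2 h.1).choose).ord ∧ ∀ y ≥ x, X i ≤ e (B i) y) ∧
        ((B i).cof ≤ θ → x < θ.ord ∧ X i ≤ e (B i) x) := by
      intro i
      by_cases hi : X i < B i
      · have h2 := he (B i) ((zero_le (a := X i)).trans_lt hi)
        rcases le_or_gt (B i).cof θ with h | h
        · obtain ⟨x, hx, h3⟩ := (h2.1 h).2 _ hi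
          exact ⟨x, fun _ => ⟨fun h' => absurd h (not_le.2 h'.1), fun _ => ⟨hx, h3⟩⟩⟩
        · obtain ⟨x, hx, h3⟩ := (h2.2 h).2 _ hi
          refine ⟨x, fun _ => ⟨fun h' => ⟨?_, h3⟩, fun h' => absurd h' (not_le.2 h)⟩⟩
          rwa [(hcov _ h'.2 h'.1).choose_spec]
      · exact ⟨0, fun h => absurd h hi⟩
    choose x hx using h1
    have h3 : ∀ j, ∃ b, b < (φ j).ord ∧ ∀ i, X i < B i → (∃ h : θ < (B i).cof ∧ B i ≤ o,
        (hcov _ h.2 h.1).choose = j) → x i ≤ b := by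
      intro j
      let x' : θ.ord.ToType → Ordinal.{0} := fun i => if x i < (φ j).ord then x i else 0
      obtain ⟨b, hb, hbx⟩ := exists_bound_of_regular (hφ j) (K := θ.ord.ToType)
        (by rw [mk_toType', card_ord]; exact hφθ j) x' (fun i => by
          by_cases hi : x i < (φ j).ord
          · simp [x', hi]
          · simpa [x', hi] using (hφ j).ord_pos)
      refine ⟨b, hb, fun i hi ⟨h, hj⟩ => ?_⟩
      have h4 := ((hx i hi).1 h).1
      rw [hj] at h4
      have := hbx i
      simp only [x', if_pos h4] at this
      exact this.le
    choose b hb hbx using h3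
    obtain ⟨g, hg⟩ := hG b hb
    have hc : ∀ i, ∃ c : θ.ord.ToType, x i < θ.ord → (ToType.mk.symm c).1 = x i := by
      intro i
      by_cases hi : x i < θ.ord
      · exact ⟨ToType.mk ⟨_, hi⟩, fun _ => by simp⟩
      · exact ⟨i, fun h => absurd h hi⟩
    choose c hc using hc
    refine ⟨g, c, fun i hi => ?_⟩
    have hpos := (zero_le (a := X i)).trans_lt hi
    by_cases h : θ < (B i).cof ∧ B i ≤ o
    · simp only [step, dif_pos h]
      obtain ⟨h5, h6⟩ := hg _ (mem_univ (hcov _ h.2 h.1).choose)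
      refine ⟨((hx i hi).1 h).2 _ ((hbx _ i hi ⟨h, rfl⟩).trans h5), ?_⟩
      refine ((he _ hpos).2 h.1).1 _ ?_
      rwa [(hcov _ h.2 h.1).choose_spec] at h6
    · simp only [step, dif_neg h]
      have h' : (B i).cof ≤ θ := not_lt.1 fun h' => h ⟨h', hB i⟩
      obtain ⟨h5, h6⟩ := (hx i hi).2 h'
      rw [hc i h5]
      exact ⟨h6, ((he _ hpos).1 h').1 _⟩
  have hcard : #θ.ord.ToType = #(List θ.ord.ToType) := by
    have : Infinite θ.ord.ToType := by
      rw [infinite_iff, mk_toType', card_ord]; exact hθ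
    exact (mk_list_eq_mk _).symm
  obtain ⟨E⟩ := Cardinal.eq.1 hcard
  refine ⟨List L, fun l j => (l.zip (E j)).foldl step o,
    (mk_list_le_max L).trans (max_le hΛ hL), fun X hX => ?_⟩
  have hne : Nonempty θ.ord.ToType :=
    ⟨ToType.mk ⟨0, show (0 : Ordinal) < θ.ord from
      lt_ord.2 (by simpa using aleph0_pos.trans_le hθ)⟩⟩
  choose! g c hgc using hstep X
  let next : (θ.ord.ToType → Ordinal.{0}) → θ.ord.ToType → Ordinal.{0} := fun B i =>
    if X i < B i then step (B i) (g B, c B i) else B i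
  let B : ℕ → θ.ord.ToType → Ordinal.{0} := fun n => next^[n] fun _ => o
  have hB : ∀ n, B (n + 1) = next (B n) := fun n => Function.iterate_succ_apply' _ _ _
  have hlt : ∀ n i, X i < B n i → B (n + 1) i = step (B n i) (g (B n), c (B n) i) :=
    fun n i h => by rw [hB]; exact if_pos h
  have hge : ∀ n i, ¬ X i < B n i → B (n + 1) i = B n i :=
    fun n i h => by rw [hB]; exact if_neg h
  have hBo : ∀ n i, B n i ≤ o := by
    intro n
    induction n with
    | zero => exact fun i => le_rfl
    | succ n ih =>
      intro i
      by_cases h : X i < B n i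
      · exact hlt n i h ▸ (hgc _ ih i h).2.le.trans (ih i)
      · exact hge n i h ▸ ih i
  have hXB : ∀ n i, X i ≤ B n i := by
    intro n
    induction n with
    | zero => exact fun i => (hX i).le
    | succ n ih =>
      intro i
      by_cases h : X i < B n i
      · exact hlt n i h ▸ (hgc _ (hBo n) i h).1
      · exact hge n i h ▸ ih i
  have hex : ∀ i, ∃ n, ¬ X i < B n i := by
    intro i
    by_contra! h
    obtain ⟨_, ⟨n, rfl⟩, hn⟩ := WellFounded.has_min (r := (· < ·)) wellFounded_lt
      (range fun n => B n i) ⟨_, 0, rfl⟩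
    refine hn _ ⟨n + 1, rfl⟩ ?_
    simp only [hlt n i (h n)]
    exact (hgc _ (hBo n) i (h n)).2
  refine ⟨range fun n => (List.range n).map fun m => g (B m), ?_, fun i => ?_⟩
  · exact lt_of_le_of_lt (le_aleph0_iff_set_countable.2 (countable_range _)) aleph0_lt_aleph_one
  · have hfold : ∀ n ≤ Nat.find (hex i),
        ((List.range n).map fun m => (g (B m), c (B m) i)).foldl step o = B n i := by
      intro n
      induction n with
      | zero => exact fun _ => rfl
      | succ n ih =>
        intro hn
        rw [List.range_succ, List.map_append, List.foldl_append, ih (by omega),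
          hlt n i (not_not.1 (Nat.find_min (hex i) (by omega)))]
        rfl
    refine ⟨_, ⟨Nat.find (hex i), rfl⟩, E.symm ((List.range (Nat.find (hex i))).map
      fun m => c (B m) i), ?_⟩
    simp only [Equiv.apply_symm_apply]
    rw [List.zip_map', hfold _ le_rfl]
    exact le_antisymm (not_lt.1 (Nat.find_spec (hex i))) (hXB _ i)

theorem succ_lt_aleph {δ : Ordinal.{0}} (hδ : IsSuccLimit δ) {c : Cardinal.{0}} (hc : c < ℵ_ δ) :
    succ c < ℵ_ δ := by
  have h := isNormal_aleph.lt_iff_exists_lt hδ |>.1 hc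
  obtain ⟨a, ha, h⟩ := h
  exact (succ_le_iff.2 h).trans_lt (aleph_lt_aleph.2 ha)

theorem exists_aleph_eq {c : Cardinal.{0}} (hc : ℵ₀ ≤ c) : ∃ j, ℵ_ j = c := by
  have : c ∈ range Cardinal.aleph := by rw [range_aleph]; exact hc
  exact this

/-- Singular cardinals above `κ` whose index has cardinality at most `κ` have small covers. -/
theorem hasCover_aleph {κ : Cardinal.{0}} {δ : Ordinal.{0}} (hκ : ℵ₀ ≤ κ) (hδ : IsSuccLimit δ)
    (hδκ : δ.card ≤ κ) (hκδ : κ < ℵ_ δ) :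
    HasCover (ℵ_ (δ + (succ (succ (succ (succ κ)))).ord))
      (succ (succ (succ (succ (succ (succ (succ (succ (succ (succ κ)))))))))) ℵ₁
      (ℵ_ δ).ord := by
  set Θ := succ (succ (succ (succ κ))) with hΘ
  set b := δ + Θ.ord with hb
  have hκΘ : κ ≤ Θ := by
    rw [hΘ]
    exact (((le_succ κ).trans (le_succ _)).trans (le_succ _)).trans (le_succ _)
  have hΘ0 : ℵ₀ ≤ Θ := hκ.trans hκΘ
  set θ := succ (succ (succ (succ (succ (succ Θ))))) with hθ
  have hΘθ : Θ ≤ θ := by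
    rw [hθ]
    exact (((((le_succ Θ).trans (le_succ _)).trans (le_succ _)).trans (le_succ _)).trans
      (le_succ _)).trans (le_succ _)
  have hθδ : θ < ℵ_ δ := by
    rw [hθ, hΘ]
    iterate 10 refine succ_lt_aleph hδ ?_
    exact hκδ
  have hΘreg : Θ.IsRegular := isRegular_succ
    (((hκ.trans (le_succ _)).trans (le_succ _)).trans (le_succ _))
  have hΘpos : Θ.ord ≠ 0 := hΘreg.ord_pos.ne'
  have hbcof : b.cof = Θ := by
    rw [hb, cof_add _ hΘpos, hΘreg.cof_ord]
  have hδb : δ < b := by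
    rw [hb]; exact lt_add_of_pos_right _ hΘreg.ord_pos
  let φ : {j : (succ b).ToType // (ℵ_ (ToType.mk.symm j).1).IsRegular ∧
    succ (succ (succ Θ)) < ℵ_ (ToType.mk.symm j).1} → Cardinal.{0} :=
    fun j => ℵ_ (ToType.mk.symm j.1).1
  let φ' : {j : δ.ToType // (ℵ_ (ToType.mk.symm j).1).IsRegular ∧
    θ < ℵ_ (ToType.mk.symm j).1} → Cardinal.{0} :=
    fun j => ℵ_ (ToType.mk.symm j.1).1
  have hφinj : Function.Injective φ := by
    intro x y h
    exact Subtype.ext (ToType.mk.symm.injective (Subtype.ext (aleph.injective h)))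
  have hP : IsProgressive φ Θ := by
    refine ⟨hΘ0, ?_, fun i => i.2.1, fun i => i.2.2⟩
    refine (mk_subtype_le _).trans ?_
    rw [mk_toType', succ_eq_add_one, card_add, hb, card_add, card_ord, card_one]
    exact add_le_of_le hΘ0 (add_le_of_le hΘ0 (hδκ.trans hκΘ) le_rfl)
      (one_le_aleph0.trans hΘ0)
  have hP' : IsProgressive φ' (succ (succ (succ Θ))) := by
    refine ⟨hΘ0.trans (((le_succ Θ).trans (le_succ _)).trans (le_succ _)), ?_,
      fun i => i.2.1, fun i => i.2.2⟩
    refine (mk_subtype_le _).trans ?_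
    rw [mk_toType']
    exact (hδκ.trans hκΘ).trans (((le_succ Θ).trans (le_succ _)).trans (le_succ _))
  refine hasCover_of_dominated (φ := φ') (hΘ0.trans hΘθ) (aleph0_le_aleph _) (fun i => i.2.1)
    (fun i => i.2.2) ?_ ?_
  · intro β hβ hβθ
    have h0 : ℵ₀ ≤ β.cof := (hΘ0.trans hΘθ).trans hβθ.le
    have h1 : β.cof.IsRegular := ⟨h0, by rw [Ordinal.cof_ord_cof]⟩
    obtain ⟨j, hj⟩ := exists_aleph_eq h0
    have hle : ℵ_ j ≤ ℵ_ δ := by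
      rw [hj]
      refine (cof_le_card β).trans ?_
      simpa using card_le_card hβ
    have hjδ : j < δ := by
      refine (aleph_le_aleph.1 hle).lt_of_ne ?_
      rintro rfl
      have h2 : (ℵ_ j).ord.cof = ℵ_ j := by rw [hj]; exact h1.cof_ord
      rw [ord_aleph, cof_omega hδ] at h2
      exact absurd ((cof_le_card j).trans hδκ) (by rw [h2]; exact not_le.2 hκδ)
    refine ⟨⟨ToType.mk ⟨j, hjδ⟩, ?_⟩, ?_⟩
    · simp only [OrderIso.symm_apply_apply]
      rw [hj]; exact ⟨h1, hβθ⟩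
    · simpa [φ'] using hj
  · refine dominated_univ_of_generating hκ hκΘ hP hP' hφinj hθδ ?_ ?_ hbcof hδb ?_
    · refine le_trans ?_ hδκ
      rw [← mk_toType' δ]
      have h1 : ∀ i : {i | φ i < ℵ_ δ}, (ToType.mk.symm i.1.1).1 < δ := fun i =>
        aleph_lt_aleph.1 i.2
      refine mk_le_of_injective (f := fun i => ToType.mk ⟨(ToType.mk.symm i.1.1).1, h1 i⟩)
        fun x y h => ?_
      have h2 := Subtype.ext_iff.1 (ToType.mk.injective h)
      exact Subtype.ext (Subtype.ext (ToType.mk.symm.injective (Subtype.ext h2)))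
    · intro i
      exact aleph_lt_aleph.2 (ToType.mk.symm i.1).2
    · intro x hx hlt hle
      obtain ⟨j, rfl⟩ := exists_aleph_eq hx.aleph0_le
      refine ⟨⟨ToType.mk ⟨j, lt_succ_iff.2 (aleph_le_aleph.1 hle)⟩, ?_⟩, ?_⟩
      · simp only [OrderIso.symm_apply_apply]
        exact ⟨hx, hlt⟩
      · simp [φ]

section Cover

variable {lam θ σ : Cardinal.{0}}

theorem HasCover.of_enumeration {x y : Ordinal.{0}} (h : HasCover lam θ σ y)
    (g f : Ordinal.{0} → Ordinal.{0})
    (hg : ∀ a < x, g a < y) (hf : ∀ a < x, f (g a) = a) : HasCover lam θ σ x := by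
  obtain ⟨L, P, hL, hP⟩ := h
  refine ⟨L, fun l j => f (P l j), hL, fun X hX => ?_⟩
  obtain ⟨S, hS, h⟩ := hP (fun i => g (X i)) fun i => hg _ (hX i)
  refine ⟨S, hS, fun i => ?_⟩
  obtain ⟨l, hl, j, hj⟩ := h i
  exact ⟨l, hl, j, by simp only [hj, hf _ (hX i)]⟩

theorem exists_enumeration_of_card_le {x y : Ordinal.{0}} (h : x.card ≤ y.card) :
    ∃ g f : Ordinal.{0} → Ordinal.{0}, (∀ a < x, g a < y) ∧ ∀ a < x, f (g a) = a := by
  classical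
  rw [← mk_toType' x, ← mk_toType' y] at h
  obtain ⟨e⟩ := h
  refine ⟨fun a => if h : a < x then (ToType.mk.symm (e (ToType.mk ⟨a, h⟩))).1 else 0,
    fun b => if h : ∃ a : x.ToType, (ToType.mk.symm (e a)).1 = b then
      (ToType.mk.symm h.choose).1 else 0, fun a ha => ?_, fun a ha => ?_⟩
  · simp only [dif_pos ha]
    exact (ToType.mk.symm _).2
  · simp only [dif_pos ha]
    have h : ∃ a' : x.ToType, (ToType.mk.symm (e a')).1 =
      (ToType.mk.symm (e (ToType.mk ⟨a, ha⟩))).1 := ⟨_, rfl⟩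
    rw [dif_pos h]
    have h1 := e.injective (ToType.mk.symm.injective (Subtype.ext h.choose_spec))
    rw [h1]
    simp

theorem HasCover.of_card_le {x y : Ordinal.{0}} (h : HasCover lam θ σ y) (hxy : x.card ≤ y.card) :
    HasCover lam θ σ x := by
  obtain ⟨g, f, hg, hf⟩ := exists_enumeration_of_card_le hxy
  exact h.of_enumeration g f hg hf

theorem hasCover_of_card_le {x : Ordinal.{0}} (hlam : ℵ₀ ≤ lam) (hσ : ℵ₀ ≤ σ) (hx : x.card ≤ θ) :
    HasCover lam θ σ x := by
  have h : HasCover lam θ σ θ.ord := by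
    refine ⟨Unit, fun _ j => (ToType.mk.symm j).1, by simpa using one_le_aleph0.trans hlam,
      fun X hX => ⟨univ, ?_, fun i => ⟨(), mem_univ _, ToType.mk ⟨_, hX i⟩, by simp⟩⟩⟩
    simpa using one_lt_aleph0.trans_le hσ
  exact h.of_card_le (by rwa [card_ord])

theorem hasCover_of_lt_cof {x : Ordinal.{0}} (hlam : ℵ₀ ≤ lam) (hθ0 : ℵ₀ ≤ θ)
    (hx : x.card ≤ lam) (hθ : θ < x.cof) (h : ∀ y < x, HasCover lam θ σ y) :
    HasCover lam θ σ x := by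
  classical
  have h' : ∀ y : x.ToType, HasCover lam θ σ (ToType.mk.symm y).1 :=
    fun y => h _ (ToType.mk.symm y).2
  choose L P hL hP using h'
  refine ⟨Σ y, L y, fun l j => P l.1 l.2 j, ?_, fun X hX => ?_⟩
  · rw [mk_sigma]
    refine (Cardinal.sum_le_sum _ _ hL).trans ?_
    rw [Cardinal.sum_const, mk_toType', Cardinal.lift_id, Cardinal.lift_id]
    exact mul_le_of_le hlam hx le_rfl
  · have hlim := isSuccLimit_of_aleph0_lt_cof (hθ0.trans hθ.le)
    obtain ⟨b, hb, hXb⟩ := exists_bound_of_lt_cof (K := θ.ord.ToType)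
      (by rwa [mk_toType', card_ord]) X hX
    obtain ⟨S, hS, h1⟩ := hP (ToType.mk ⟨_, hlim.succ_lt hb⟩) X
      (fun i => by simpa using lt_succ_iff.2 (hXb i))
    refine ⟨Sigma.mk _ '' S, mk_image_le.trans_lt hS, fun i => ?_⟩
    obtain ⟨l, hl, j, hj⟩ := h1 i
    exact ⟨_, ⟨l, hl, rfl⟩, j, hj⟩

theorem mk_iUnion_lt_of_isRegular {K : Type} {L : Type} (hσ : σ.IsRegular) (hK : #K < σ)
    (S : K → Set L) (hS : ∀ k, #(S k) < σ) : #(⋃ k, S k : Set L) < σ :=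
  (mk_iUnion_le_sum_mk).trans_lt (sum_lt_of_isRegular hσ hK hS)

theorem hasCover_of_cof_lt {x : Ordinal.{0}} (hlam : ℵ₀ ≤ lam) (hx : x.card ≤ lam)
    (hσ : σ.IsRegular) (hxσ : x.cof < σ) (hxl : IsSuccLimit x)
    (h : ∀ y < x, HasCover lam θ σ y) : HasCover lam θ σ x := by
  classical
  obtain ⟨K, f, hK, hf, hfx⟩ := exists_cofinal_family x
  have h' : ∀ k, HasCover lam θ σ (succ (f k)) := fun k => h _ (hxl.succ_lt (hf k))
  choose L P hL hP using h'
  refine ⟨Σ k, L k, fun l j => P l.1 l.2 j, ?_, fun X hX => ?_⟩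
  · rw [mk_sigma]
    refine (Cardinal.sum_le_sum _ _ hL).trans ?_
    rw [Cardinal.sum_const, hK, Cardinal.lift_id, Cardinal.lift_id]
    exact mul_le_of_le hlam ((cof_le_card x).trans hx) le_rfl
  · choose S hS h1 using fun k => hP k (fun i => if X i ≤ f k then X i else 0) fun i => by
      split_ifs with h
      · exact lt_succ_iff.2 h
      · exact (zero_le (a := f k)).trans_lt (lt_succ _)
    refine ⟨⋃ k, Sigma.mk k '' S k, mk_iUnion_lt_of_isRegular hσ (hK.trans_lt hxσ) _
      fun k => mk_image_le.trans_lt (hS k), fun i => ?_⟩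
    obtain ⟨k, hk⟩ := hfx _ (hX i)
    obtain ⟨l, hl, j, hj⟩ := h1 k i
    rw [if_pos hk] at hj
    exact ⟨⟨k, l⟩, mem_iUnion.2 ⟨k, l, hl, rfl⟩, j, hj⟩

theorem HasCover.comp {Λ θ' : Cardinal.{0}} {x : Ordinal.{0}} (hlam : ℵ₀ ≤ lam)
    (hσ : σ.IsRegular) (hσ' : ℵ₀ < σ) (hθ : θ ≤ θ') (hθ0 : ℵ₀ ≤ θ) (hΛ : Λ ≤ lam)
    (h1 : HasCover Λ θ' ℵ₁ x) (h2 : HasCover lam θ σ θ'.ord) : HasCover lam θ σ x := by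
  classical
  obtain ⟨L, P, hL, hP⟩ := h1
  obtain ⟨L', P', hL', hP'⟩ := h2
  have hpos : 0 < θ'.ord := lt_ord.2 (by simpa using aleph0_pos.trans_le (hθ0.trans hθ))
  refine ⟨L × L', fun l j => if h : P' l.2 j < θ'.ord then P l.1 (ToType.mk ⟨_, h⟩) else 0, ?_,
    fun X hX => ?_⟩
  · rw [mk_prod, Cardinal.lift_id, Cardinal.lift_id]
    exact mul_le_of_le hlam (hL.trans hΛ) hL'
  · have hle : #θ.ord.ToType ≤ #θ'.ord.ToType := by simpa [mk_toType'] using hθ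
    obtain ⟨e⟩ := hle
    have hpos' : 0 < θ.ord := lt_ord.2 (by simpa using aleph0_pos.trans_le hθ0)
    obtain ⟨S, hS, h3⟩ := hP (fun i => if h : ∃ a, e a = i then X h.choose else
      X (ToType.mk ⟨0, hpos'⟩)) fun i => by
        split_ifs with h
        · exact hX _
        · exact hX _
    have h4 : ∀ i, ∃ l ∈ S, ∃ j, P l j = X i := by
      intro i
      obtain ⟨l, hl, j, hj⟩ := h3 (e i)
      have h : ∃ a, e a = e i := ⟨i, rfl⟩
      rw [dif_pos h] at hj
      have h5 := e.injective h.choose_spec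
      rw [h5] at hj
      exact ⟨l, hl, j, hj⟩
    have h6 : ∀ l i, ∃ a, a < θ'.ord ∧ ((∃ j, P l j = X i) → ∃ h : a < θ'.ord,
        P l (ToType.mk ⟨a, h⟩) = X i) := by
      intro l i
      by_cases h : ∃ j, P l j = X i
      · obtain ⟨j, hj⟩ := h
        refine ⟨(ToType.mk.symm j).1, (ToType.mk.symm j).2, fun _ => ⟨(ToType.mk.symm j).2, ?_⟩⟩
        simpa using hj
      · exact ⟨0, hpos, fun h' => absurd h' h⟩
    choose Y hY hYP using h6
    choose T hT hTY using fun l => hP' (Y l) (hY l)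
    refine ⟨⋃ l : S, Prod.mk l.1 '' T l.1, mk_iUnion_lt_of_isRegular hσ ?_ _
      fun l => mk_image_le.trans_lt (hT _), fun i => ?_⟩
    · refine hS.trans_le ?_
      rw [← succ_aleph0]
      exact succ_le_of_lt hσ'
    · obtain ⟨l, hl, hj⟩ := h4 i
      obtain ⟨h7, h8⟩ := hYP l i hj
      obtain ⟨m, hm, j, hmj⟩ := hTY l i
      refine ⟨(l, m), mem_iUnion.2 ⟨⟨l, hl⟩, m, hm, rfl⟩, j, ?_⟩
      have h9 : P' m j < θ'.ord := by rw [hmj]; exact h7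
      simp only [dif_pos h9]
      simp only [hmj]
      exact h8

theorem hasCover_of_le (hlam : ℵ₀ ≤ lam) (hσ : σ.IsRegular) (hσ' : ℵ₀ < σ)
    (hθ0 : ℵ₀ ≤ θ)
    (h : ∀ δ : Ordinal.{0}, IsSuccLimit δ → ℵ_ δ ≤ lam → σ ≤ δ.cof → δ.card < ℵ_ δ ∧
      ∀ c < ℵ_ δ, ℵ_ (δ + c.ord) ≤ lam) :
    ∀ x ≤ lam.ord, HasCover lam θ σ x := by
  intro x
  induction x using WellFoundedLT.induction with
  | ind x ih =>
  intro hx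
  have hxc : x.card ≤ lam := by simpa using card_le_card hx
  have ih' : ∀ y < x, HasCover lam θ σ y := fun y hy => ih y hy (hy.le.trans hx)
  rcases le_or_gt x.card θ with h1 | h1
  · exact hasCover_of_card_le hlam hσ.aleph0_le h1
  rcases (ord_card_le x).lt_or_eq with h2 | h2
  · exact (ih' _ h2).of_card_le (by rw [card_ord])
  have hxl : IsSuccLimit x := by rw [← h2]; exact isSuccLimit_ord (hθ0.trans h1.le)
  rcases lt_or_ge θ x.cof with h3 | h3
  · exact hasCover_of_lt_cof hlam hθ0 hxc h3 ih'
  rcases lt_or_ge x.cof σ with h4 | h4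
  · exact hasCover_of_cof_lt hlam hxc hσ h4 hxl ih'
  obtain ⟨δ, hδ⟩ := exists_aleph_eq (hθ0.trans h1.le)
  rw [← hδ] at h1 h2 hxc
  have hδl : IsSuccLimit δ := by
    rcases zero_or_succ_or_isSuccLimit δ with h5 | ⟨a, h5⟩ | h5
    · subst h5
      simp at h1
      exact absurd (hθ0.trans_lt h1) (lt_irrefl _)
    · have h6 : (ℵ_ δ).IsRegular := by
        rw [← h5]; exact isRegular_aleph_add_one a
      rw [← h2, h6.cof_ord] at h3
      exact absurd h3 (not_le.2 h1)
    · exact h5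
  have h5 : σ ≤ δ.cof := by
    rwa [← h2, ord_aleph, cof_omega hδl] at h4
  obtain ⟨h6, h7⟩ := h δ hδl hxc h5
  have h8 : max δ.card θ < ℵ_ δ := max_lt h6 h1
  have h9 := hasCover_aleph (hθ0.trans (le_max_right δ.card θ)) hδl (le_max_left _ _) h8
  rw [h2] at h9
  refine HasCover.comp hlam hσ hσ' ?_ hθ0 (h7 _ ?_) h9 (ih' _ ?_)
  · iterate 10 refine le_trans ?_ (le_succ _)
    exact le_max_right _ _
  · iterate 4 refine succ_lt_aleph hδl ?_
    exact h8
  · rw [← h2]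
    refine ord_lt_ord.2 ?_
    iterate 10 refine succ_lt_aleph hδl ?_
    exact h8

end Cover

theorem nfp_omega_lt {o : Ordinal.{0}} (ho : ω_ o = o) (hcof : ℵ₀ < o.cof) {a : Ordinal.{0}}
    (ha : a < o) : nfp Ordinal.omega a < o := by
  have h1 : ∀ n : ℕ, Ordinal.omega^[n] a < o := by
    intro n
    induction n with
    | zero => exact ha
    | succ n ih =>
      rw [Function.iterate_succ_apply', ← ho]
      exact omega_lt_omega.2 ih
  obtain ⟨b, hb, h⟩ := exists_bound_of_lt_cof (K := ℕ) (by simpa using hcof) _ h1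
  exact (nfp_le h).trans_lt hb

theorem card_lt_aleph_of_fixedPoints {lam σ : Cardinal.{0}} {K : Type} {v : K → Cardinal.{0}}
    (hσ : ℵ₀ < σ) (hK : #K < σ) (hv : ∀ μ < lam, ℵ_ μ.ord = μ → ∃ k, v k = μ)
    (hcof : lam.ord.cof < σ) {δ : Ordinal.{0}} (hδ : IsSuccLimit δ) (hδlam : ℵ_ δ ≤ lam)
    (hδσ : σ ≤ δ.cof) : δ.card < ℵ_ δ := by
  by_contra! hcon
  have h1 : ω_ δ = δ := by
    refine le_antisymm ?_ (le_omega_self δ)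
    rw [← ord_aleph]
    exact (ord_le_ord.2 hcon).trans (ord_card_le δ)
  rcases hδlam.eq_or_lt with h2 | h2
  · rw [← h2, ord_aleph, cof_omega hδ] at hcof
    exact absurd hcof (not_lt.2 hδσ)
  · classical
    obtain ⟨b, hb, h3⟩ := exists_bound_of_lt_cof (hK.trans_le hδσ)
      (fun k => if (v k).ord < δ then (v k).ord else 0) fun k => by
        split_ifs with h
        · exact h
        · exact hδ.bot_lt
    have h4 := nfp_omega_lt h1 (hσ.trans_le hδσ) (hδ.succ_lt hb)
    have h5 : ω_ (nfp Ordinal.omega (succ b)) = nfp Ordinal.omega (succ b) :=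
      nfp_fp isNormal_omega _
    have h6 : b < nfp Ordinal.omega (succ b) := (lt_succ b).trans_le (le_nfp _ _)
    obtain ⟨k, hk⟩ := hv (ℵ_ (nfp Ordinal.omega (succ b)))
      ((aleph_lt_aleph.2 h4).trans h2) (by rw [ord_aleph, h5])
    have h7 := h3 k
    rw [hk, ord_aleph, h5, if_pos h4] at h7
    exact absurd h6 (not_lt.2 h7)

theorem exists_regular_of_cases {lam : Cardinal.{0}} (hinf : ℵ₀ ≤ lam) (hsing : lam.ord.cof < lam)
    (hnsl : ∃ μ < lam, lam ≤ 2 ^ μ)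
    (hcase : lam < ℵ_ lam.ord ∨ (ℵ_ lam.ord = lam ∧
      #↥{μ : Cardinal.{0} | μ < lam ∧ ℵ_ μ.ord = μ} < Cardinal.lift.{1} lam)) :
    ∃ σ : Cardinal.{0}, σ.IsRegular ∧ ℵ₀ < σ ∧ succ (succ (succ σ)) < lam ∧ lam < 2 ^ σ ∧
      ∀ δ : Ordinal.{0}, IsSuccLimit δ → ℵ_ δ ≤ lam → σ ≤ δ.cof → δ.card < ℵ_ δ ∧
        ∀ c < ℵ_ δ, ℵ_ (δ + c.ord) ≤ lam := by
  have hS : lam.IsSingular := ⟨hinf, hsing.ne⟩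
  have hsucc : ∀ c < lam, succ c < lam := fun c hc => hS.isSuccLimit.succ_lt hc
  obtain ⟨μ, hμ, hμl⟩ := hnsl
  have h0 : ℵ₀ < lam := (hS.aleph0_le).lt_of_ne fun h => not_isSingular_aleph0 (h ▸ hS)
  have key : ∀ c < lam, ∃ σ : Cardinal.{0}, c < σ ∧ σ.IsRegular ∧ ℵ₀ < σ ∧
      succ (succ (succ σ)) < lam ∧ lam < 2 ^ σ ∧ lam.ord.cof < σ := by
    intro c hc
    have hm : max (max μ c) (max ℵ₀ lam.ord.cof) < lam := max_lt (max_lt hμ hc) (max_lt h0 hsing)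
    have hle : ℵ₀ ≤ max (max μ c) (max ℵ₀ lam.ord.cof) :=
      (le_max_left _ _).trans (le_max_right _ _)
    have hμ' : μ ≤ max (max μ c) (max ℵ₀ lam.ord.cof) := (le_max_left _ _).trans (le_max_left _ _)
    have hc' : c ≤ max (max μ c) (max ℵ₀ lam.ord.cof) := (le_max_right _ _).trans (le_max_left _ _)
    have hcof' : lam.ord.cof ≤ max (max μ c) (max ℵ₀ lam.ord.cof) :=
      (le_max_right _ _).trans (le_max_right _ _)
    generalize max (max μ c) (max ℵ₀ lam.ord.cof) = m at hm hle hμ' hc' hcof'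
    refine ⟨succ m, lt_succ_iff.2 hc', isRegular_succ hle, lt_succ_iff.2 hle,
      hsucc _ (hsucc _ (hsucc _ (hsucc _ hm))), ?_, lt_succ_iff.2 hcof'⟩
    have h1 : lam ≤ 2 ^ succ m :=
      hμl.trans (power_le_power_left two_ne_zero (hμ'.trans (le_succ m)))
    refine h1.lt_of_ne fun h => ?_
    have h2 := lt_power_cof_ord hinf
    nth_rewrite 2 [h] at h2
    rw [← power_mul, mul_eq_left (hle.trans (le_succ m)) (hcof'.trans (le_succ m)), ← h] at h2
    · exact lt_irrefl _ h2
    · exact fun h3 => by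
        rw [cof_eq_zero, ord_eq_zero] at h3
        exact h0.ne_bot h3
  rcases hcase with h | ⟨h, hfix⟩
  · obtain ⟨δ₀, rfl⟩ := exists_aleph_eq hinf
    have h1 : δ₀.card < ℵ_ δ₀ := lt_ord.1 (aleph_lt_aleph.1 h)
    obtain ⟨σ, hcσ, h2, h3, h4, h5, -⟩ := key _ h1
    refine ⟨σ, h2, h3, h4, h5, fun δ hδ hδl hδσ => ?_⟩
    exact absurd (hδσ.trans ((cof_le_card δ).trans (card_le_card (aleph_le_aleph.1 hδl))))
      (not_le.2 hcσ)
  · obtain ⟨c, hc, hcfix⟩ := lt_lift_iff.1 hfix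
    obtain ⟨σ, hcσ, h2, h3, h4, h5, h6⟩ := key _ hc
    have h7 : ∃ v : c.out → Cardinal.{0}, ∀ μ < lam, ℵ_ μ.ord = μ → ∃ k, v k = μ := by
      rw [← mk_out c, ← mk_uLift] at hcfix
      obtain ⟨e⟩ := Cardinal.eq.1 hcfix
      exact ⟨fun k => (e ⟨k⟩).1, fun μ h1 h2 => ⟨(e.symm ⟨μ, h1, h2⟩).down,
        congrArg Subtype.val (e.apply_symm_apply ⟨μ, h1, h2⟩)⟩⟩
    obtain ⟨v, hv⟩ := h7
    refine ⟨σ, h2, h3, h4, h5, fun δ hδ hδl hδσ => ?_⟩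
    have h8 := card_lt_aleph_of_fixedPoints h3 ((mk_out c).trans_lt hcσ) hv h6 hδ hδl hδσ
    refine ⟨h8, fun x hx => ?_⟩
    rw [← h]
    refine aleph_le_aleph.2 (isPrincipal_add_ord hinf ?_ ?_).le
    · exact lt_ord.2 (h8.trans_le hδl)
    · exact ord_lt_ord.2 (hx.trans_le hδl)

/-- A set of jumps in a linear order is no larger than any set meeting all closed intervals. -/
theorem mk_jumps_le {R : Type} [LinearOrder R] {D Γ : Set R}
    (hD : ∀ a b, a < b → ∃ d ∈ D, a ≤ d ∧ d ≤ b) :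
    #{a | a ∈ Γ ∧ ∃ b ∈ Γ, b < a ∧ ∀ c ∈ Γ, ¬ (b < c ∧ c < a)} ≤ #(D × Prop) := by
  classical
  choose b hbΓ hb hbc using fun a : {a | a ∈ Γ ∧ ∃ b ∈ Γ, b < a ∧ ∀ c ∈ Γ, ¬ (b < c ∧ c < a)} =>
    a.2.2
  choose d hdD hd1 hd2 using fun a => hD _ _ (hb a)
  refine mk_le_of_injective (f := fun a => (⟨d a, hdD a⟩, d a = a.1)) ?_
  have key : ∀ a a', a.1 < a'.1 → d a = d a' → (d a = a.1) = (d a' = a'.1) → False := by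
    intro a a' h h1 h2
    have h3 : a.1 ≤ b a' := not_lt.1 fun h3 => hbc a' a.1 a.2.1 ⟨h3, h⟩
    have h4 : d a = a.1 := le_antisymm (hd2 a) (h3.trans ((hd1 a').trans h1.ge))
    exact absurd (h4.symm.trans (h1.trans (h2 ▸ h4))) h.ne
  intro a a' h
  simp only [Prod.mk.injEq, Subtype.mk.injEq] at h
  rcases lt_trichotomy a.1 a'.1 with h1 | h1 | h1
  · exact (key a a' h1 h.1 h.2).elim
  · exact Subtype.ext h1
  · exact (key a' a h1 h.1.symm h.2.symm).elim

theorem exists_left_approximation {R : Type} [LinearOrder R] {D : Set R} {c : Cardinal.{0}}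
    (hc : ℵ₀ ≤ c) (hDc : #D < c)
    (hD : ∀ a b, a < b → ∃ d ∈ D, a ≤ d ∧ d ≤ b) (Γ : Set R) :
    ∃ G ⊆ Γ, #G < c ∧ ∀ a ∈ Γ, a ∉ G → ∀ b ∈ Γ, b < a → ∃ g ∈ G, b < g ∧ g < a := by
  classical
  let I : Type := {p : D × D // ∃ x ∈ Γ, p.1.1 ≤ x ∧ x ≤ p.2.1}
  choose y hyΓ hy1 hy2 using fun p : I => p.2
  let J := {a | a ∈ Γ ∧ ∃ b ∈ Γ, b < a ∧ ∀ c ∈ Γ, ¬ (b < c ∧ c < a)}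
  have hDD : #(D × D) < c := by
    rw [← mul_def]
    exact mul_lt_of_lt hc hDc hDc
  have hDP : #(D × Prop) < c := by
    rw [mk_prod, Cardinal.lift_id, Cardinal.lift_id]
    exact mul_lt_of_lt hc hDc ((lt_aleph0_of_finite _).trans_le hc)
  refine ⟨J ∪ range y, union_subset (fun a ha => ha.1) (range_subset_iff.2 hyΓ), ?_, ?_⟩
  · refine (mk_union_le _ _).trans_lt (add_lt_of_lt hc ((mk_jumps_le hD).trans_lt hDP) ?_)
    exact mk_range_le.trans_lt ((mk_subtype_le _).trans_lt hDD)
  · intro a ha haG b hb hba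
    have hstep : ∀ b ∈ Γ, b < a → ∃ c ∈ Γ, b < c ∧ c < a := by
      intro b hb hba
      by_contra! h
      exact haG (Or.inl ⟨ha, b, hb, hba, fun c hc h' => absurd (h c hc h'.1) (not_le.2 h'.2)⟩)
    obtain ⟨c₁, hc₁, hb1, h1a⟩ := hstep b hb hba
    obtain ⟨c₂, hc₂, h12, h2a⟩ := hstep c₁ hc₁ h1a
    obtain ⟨c₃, hc₃, h23, h3a⟩ := hstep c₂ hc₂ h2a
    obtain ⟨d, hd, hd1, hd2⟩ := hD _ _ h12
    obtain ⟨d', hd', hd3, hd4⟩ := hD _ _ h23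
    let p : I := ⟨(⟨d, hd⟩, ⟨d', hd'⟩), c₂, hc₂, hd2, hd3⟩
    exact ⟨y p, Or.inr ⟨p, rfl⟩, hb1.trans_le (hd1.trans (hy1 p)), ((hy2 p).trans hd4).trans_lt h3a⟩

theorem exists_approximation {R : Type} [LinearOrder R] {D : Set R} {c : Cardinal.{0}}
    (hc : ℵ₀ ≤ c) (hDc : #D < c)
    (hD : ∀ a b, a < b → ∃ d ∈ D, a ≤ d ∧ d ≤ b) (Γ : Set R) :
    ∃ G ⊆ Γ, #G < c ∧ ∀ a ∈ Γ, a ∉ G → ∀ b ∈ Γ, (b < a → ∃ g ∈ G, b < g ∧ g < a) ∧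
      (a < b → ∃ g ∈ G, a < g ∧ g < b) := by
  obtain ⟨G, hG, hGc, h⟩ := exists_left_approximation hc hDc hD Γ
  obtain ⟨G', hG', hGc', h'⟩ := exists_left_approximation (R := Rᵒᵈ) (D := D) hc hDc
    (fun a b hab => by
      obtain ⟨d, hd, h1, h2⟩ := hD (OrderDual.ofDual b) (OrderDual.ofDual a) hab
      exact ⟨d, hd, h2, h1⟩) Γ
  refine ⟨G ∪ G', union_subset hG hG', (mk_union_le _ _).trans_lt (add_lt_of_lt hc hGc hGc'),
    fun a ha haG b hb => ⟨fun hba => ?_, fun hab => ?_⟩⟩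
  · obtain ⟨g, hg, h1⟩ := h a ha (fun h => haG (Or.inl h)) b hb hba
    exact ⟨g, Or.inl hg, h1⟩
  · obtain ⟨g, hg, h1, h2⟩ := h' a ha (fun h => haG (Or.inr h)) b hb hab
    exact ⟨g, Or.inr hg, h2, h1⟩

/-- If a partial function `p` from ordinals to ordinals has values below a regular cardinal, its
values at arguments below `α` are bounded. -/
theorem exists_bound_of_unique {c : Cardinal.{0}} (hc : c.IsRegular) {α : Ordinal.{0}}
    (hα : α < c.ord) (p : Ordinal.{0} → Ordinal.{0} → Prop)
    (hp : ∀ η γ γ', γ < c.ord → γ' < c.ord → p η γ → p η γ' → γ = γ') :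
    ∃ β < c.ord, ∀ η < α, ∀ γ < c.ord, p η γ → γ < β := by
  have h : ∀ η, ∃ b < c.ord, ∀ γ < c.ord, p η γ → γ = b := by
    intro η
    by_cases h : ∃ γ < c.ord, p η γ
    · obtain ⟨γ, hγ, h⟩ := h
      exact ⟨γ, hγ, fun γ' hγ' h' => hp η _ _ hγ' hγ h' h⟩
    · exact ⟨0, hc.ord_pos, fun γ hγ h' => absurd ⟨γ, hγ, h'⟩ h⟩
  choose b hb h using h
  obtain ⟨β, hβ, h'⟩ := exists_bound_of_regular_ordinal hc hα b fun η _ => hb η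
  exact ⟨β, hβ, fun η hη γ hγ hpγ => h η γ hγ hpγ ▸ h' η hη⟩

theorem exists_closure_bound {R W : Type} [LinearOrder R] [LinearOrder W] {D : Set R}
    {c : Cardinal.{0}} (hc : c.IsRegular) (hDc : #D < c)
    (hD : ∀ a b, a < b → ∃ d ∈ D, a ≤ d ∧ d ≤ b) {r : Ordinal.{0} → R} (hr : InjOn r (Iio c.ord))
    (en : Ordinal.{0} → W) (Q : Set (R × W)) (hQ : ∀ q ∈ Q, ∀ q' ∈ Q, q.1 < q'.1 → q.2 < q'.2)
    (hen : ∀ q ∈ Q, ∃ η < c.ord, en η = q.2) {α : Ordinal.{0}} (hα : α < c.ord) :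
    ∃ β < c.ord, (Q.Nonempty → ∃ q ∈ Q, ∃ η < β, en η = q.2) ∧
      (∀ γ < c.ord, β ≤ γ → ∀ q₀ ∈ Q, q₀.1 = r γ → ∀ q ∈ Q,
        (q.1 < r γ → ∃ q₁ ∈ Q, q.1 < q₁.1 ∧ q₁.1 < r γ ∧ ∃ η < β, en η = q₁.2) ∧
        (r γ < q.1 → ∃ q₁ ∈ Q, r γ < q₁.1 ∧ q₁.1 < q.1 ∧ ∃ η < β, en η = q₁.2)) ∧
      ∀ η < α, ∀ γ < c.ord, ∀ q ∈ Q, q.1 = r γ →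
        ((∃ q' ∈ Q, q'.1 = r γ ∧ q.2 ≤ en η ∧ en η < q'.2) → γ < β) ∧
        (en η < q.2 → (∀ q' ∈ Q, q'.1 < r γ → q'.2 < en η) → γ < β) ∧
        (q.2 ≤ en η → (∀ q' ∈ Q, r γ < q'.1 → en η < q'.2) → γ < β) := by
  classical
  have hmono : ∀ p : Ordinal.{0} → Ordinal.{0} → Prop,
      (∀ η γ γ', p η γ → p η γ' → ¬ r γ < r γ') →
      ∃ β < c.ord, ∀ η < α, ∀ γ < c.ord, p η γ → γ < β := by
    intro p hp
    refine exists_bound_of_unique hc hα p fun η γ γ' hγ hγ' h h' => hr hγ hγ' ?_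
    exact le_antisymm (not_lt.1 (hp η γ' γ h' h)) (not_lt.1 (hp η γ γ' h h'))
  obtain ⟨β₁, hβ₁, h₁⟩ := hmono (fun η γ => ∃ q ∈ Q, q.1 = r γ ∧ ∃ q' ∈ Q, q'.1 = r γ ∧
      q.2 ≤ en η ∧ en η < q'.2) (by
    rintro η γ γ' ⟨q₁, h1, h1r, q₂, h2, h2r, h3, h4⟩ ⟨q₃, h5, h5r, q₄, h6, h6r, h7, h8⟩ h
    rw [← h2r, ← h5r] at h
    exact absurd (h4.trans (hQ _ h2 _ h5 h)) (not_lt.2 h7))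
  obtain ⟨β₂, hβ₂, h₂⟩ := hmono (fun η γ => ∃ q ∈ Q, q.1 = r γ ∧ en η < q.2 ∧
      ∀ q' ∈ Q, q'.1 < r γ → q'.2 < en η) (by
    rintro η γ γ' ⟨q, h1, h1r, h2, -⟩ ⟨-, -, -, -, h3⟩ h
    rw [← h1r] at h
    exact lt_asymm (h3 _ h1 h) h2)
  obtain ⟨β₃, hβ₃, h₃⟩ := hmono (fun η γ => ∃ q ∈ Q, q.1 = r γ ∧ q.2 ≤ en η ∧
      ∀ q' ∈ Q, r γ < q'.1 → en η < q'.2) (by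
    rintro η γ γ' ⟨-, -, -, -, h3⟩ ⟨q, h1, h1r, h2, -⟩ h
    rw [← h1r] at h
    exact absurd (h3 _ h1 h) (not_lt.2 h2))
  obtain ⟨G, hGΓ, hGc, hG⟩ := exists_approximation hc.aleph0_le hDc hD (Prod.fst '' Q)
  choose q hqQ hq using fun g : G => hGΓ g.2
  choose η hη hηq using fun g : G => hen _ (hqQ g)
  obtain ⟨β₄, hβ₄, h₄⟩ := exists_bound_of_regular hc hGc η hη
  obtain ⟨β₅, hβ₅, h₅⟩ := exists_bound_of_regular hc hGc
    (fun g => if h : ∃ γ < c.ord, r γ = g.1 then h.choose else 0) fun g => by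
      split_ifs with h
      · exact h.choose_spec.1
      · exact hc.ord_pos
  have h₆ : ∃ β₆ < c.ord, Q.Nonempty → ∃ q ∈ Q, ∃ η < β₆, en η = q.2 := by
    by_cases h : Q.Nonempty
    · obtain ⟨q, hq⟩ := h
      obtain ⟨η, hη, h⟩ := hen q hq
      exact ⟨succ η, (isSuccLimit_ord hc.aleph0_le).succ_lt hη,
        fun _ => ⟨q, hq, η, lt_succ η, h⟩⟩
    · exact ⟨0, hc.ord_pos, fun h' => absurd h' h⟩
  obtain ⟨β₆, hβ₆, h₆⟩ := h₆
  refine ⟨max (max (max β₁ β₂) β₃) (max (max β₄ β₅) β₆), by simp [*], fun h => ?_, ?_, ?_⟩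
  · obtain ⟨q, hq, η, hη, h⟩ := h₆ h
    exact ⟨q, hq, η, by simp [hη], h⟩
  · intro γ hγ hβγ q₀ hq₀ hq₀r q' hq'
    have hγG : r γ ∉ G := by
      intro h
      have h1 := h₅ ⟨_, h⟩
      have h2 : ∃ γ' < c.ord, r γ' = r γ := ⟨γ, hγ, rfl⟩
      simp only [dif_pos h2] at h1
      rw [hr h2.choose_spec.1 hγ h2.choose_spec.2] at h1
      exact absurd h1 (not_lt.2 ((le_max_right _ _).trans
        ((le_max_left _ _).trans ((le_max_right _ _).trans hβγ))))
    obtain ⟨h1, h2⟩ := hG _ ⟨q₀, hq₀, hq₀r⟩ hγG _ ⟨q', hq', rfl⟩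
    refine ⟨fun h => ?_, fun h => ?_⟩
    · obtain ⟨g, hg, h3, h4⟩ := h1 h
      exact ⟨q ⟨g, hg⟩, hqQ _, by rwa [hq], by rwa [hq], η ⟨g, hg⟩, by simp [h₄], hηq _⟩
    · obtain ⟨g, hg, h3, h4⟩ := h2 h
      exact ⟨q ⟨g, hg⟩, hqQ _, by rwa [hq], by rwa [hq], η ⟨g, hg⟩, by simp [h₄], hηq _⟩
  · intro η hη γ hγ q hq hqr
    refine ⟨fun h => ?_, fun h h' => ?_, fun h h' => ?_⟩
    · simp [h₁ η hη γ hγ ⟨q, hq, hqr, h⟩]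
    · simp [h₂ η hη γ hγ ⟨q, hq, hqr, h, h'⟩]
    · simp [h₃ η hη γ hγ ⟨q, hq, hqr, h, h'⟩]

theorem exists_isClubIn_eq {κ : Cardinal.{0}} (hκ : κ.IsRegular) (hκ' : ℵ₀ < κ)
    {f g : Ordinal.{0} → Ordinal.{0}} (hf : IsNormal f) (hg : IsNormal g)
    (h : f κ.ord = g κ.ord) :
    ∃ D, IsClubIn κ.ord D ∧ ∀ i ∈ D, IsSuccLimit i ∧ f i = g i := by
  have hlim : IsSuccLimit κ.ord := isSuccLimit_ord hκ'.le
  have hN : ∀ γ, ∃ n, γ < κ.ord → n < κ.ord ∧ γ < n ∧ f γ < g n ∧ g γ < f n := by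
    intro γ
    by_cases hγ : γ < κ.ord
    · have h1 : f γ < g κ.ord := by rw [← h]; exact hf.strictMono hγ
      have h2 : g γ < f κ.ord := by rw [h]; exact hg.strictMono hγ
      obtain ⟨a, ha, ha'⟩ := (hg.lt_iff_exists_lt hlim).1 h1
      obtain ⟨b, hb, hb'⟩ := (hf.lt_iff_exists_lt hlim).1 h2
      refine ⟨max (succ γ) (max a b), fun _ => ⟨max_lt (hlim.succ_lt hγ) (max_lt ha hb),
        (lt_succ γ).trans_le (le_max_left _ _), ?_, ?_⟩⟩
      · exact ha'.trans_le (hg.strictMono.monotone ((le_max_left _ _).trans (le_max_right _ _)))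
      · exact hb'.trans_le (hf.strictMono.monotone ((le_max_right _ _).trans (le_max_right _ _)))
    · exact ⟨0, fun h => absurd h hγ⟩
  choose N hN using hN
  refine ⟨{x | 0 < x ∧ ∀ γ < x, N γ < x} ∩ Iic κ.ord, ?_, ?_⟩
  · obtain ⟨h1, h2⟩ := isClubIn_closure hκ hκ' fun x hx => (hN x hx).1
    refine ⟨fun a ha => ?_, fun x hx h0 h => ⟨h2 x hx h0 fun a ha => ?_, hx.le⟩⟩
    · obtain ⟨c, hc, h3, h4⟩ := h1 a ha
      exact ⟨c, ⟨hc, h4.le⟩, h3, h4⟩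
    · obtain ⟨c, hc, h3⟩ := h a ha
      exact ⟨c, hc.1, h3⟩
  · rintro i ⟨⟨h0, hi⟩, hiκ⟩
    have hN' : ∀ γ < i, N γ < i ∧ γ < N γ ∧ f γ < g (N γ) ∧ g γ < f (N γ) := fun γ hγ =>
      ⟨hi γ hγ, (hN γ (hγ.trans_le hiκ)).2⟩
    have hil : IsSuccLimit i := by
      refine ⟨fun h => ?_, isSuccPrelimit_of_succ_lt fun a ha =>
        (succ_le_of_lt (hN' a ha).2.1).trans_lt (hN' a ha).1⟩
      exact absurd h0 (not_lt.2 (h (zero_le (a := i))))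
    refine ⟨hil, le_antisymm ?_ ?_⟩
    · refine le_of_forall_lt fun a ha => ?_
      obtain ⟨γ, hγ, h⟩ := (hf.lt_iff_exists_lt hil).1 ha
      exact h.trans ((hN' γ hγ).2.2.1.trans (hg.strictMono (hN' γ hγ).1))
    · refine le_of_forall_lt fun a ha => ?_
      obtain ⟨γ, hγ, h⟩ := (hg.lt_iff_exists_lt hil).1 ha
      exact h.trans ((hN' γ hγ).2.2.2.trans (hf.strictMono (hN' γ hγ).1))

open Classical in
/-- The sequence which spells out, at the places in `A`, the guessed points `g j k` of the ladder
`e ξ`. -/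
noncomputable def ladderSeq {R : Type} (r : Ordinal.{0} → R)
    (e g : Ordinal.{0} → Ordinal.{0} → Ordinal.{0})
    (A : Set Ordinal.{0}) (ξ j k : Ordinal.{0}) : R :=
  if k ∈ A then r (e ξ (g j k)) else r 0

theorem exists_ladder_invariant {R W : Type} [LinearOrder R] [LinearOrder W] {D : Set R}
    {κ s c : Cardinal.{0}} (hκ' : ℵ₀ < κ) (hκs : κ < s)
    (hs : s.IsRegular) (hsc : s < c) (hc : c.IsRegular) (hDc : #D < c)
    (hD : ∀ a b, a < b → ∃ d ∈ D, a ≤ d ∧ d ≤ b) {r : Ordinal.{0} → R} (hr : InjOn r (Iio c.ord))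
    {e g : Ordinal.{0} → Ordinal.{0} → Ordinal.{0}}
    (he : ∀ ξ < c.ord, ξ.cof = s → IsNormal (e ξ) ∧ e ξ s.ord = ξ)
    (hg : ∀ D, IsClubIn s.ord D → ∃ j < s.ord, j.cof = κ ∧
      ∀ k < κ.ord, g j k ∈ D ∧ g j k < j ∧ ∃ b < g j k, ∀ k' < k, g j k' ≤ b)
    {A : Set Ordinal.{0}} (hA : ∀ k < κ.ord, ∃ l ∈ A, k < l ∧ l < κ.ord)
    {U : Type} (hU : #U < c) (en : U → Ordinal.{0} → W) (F : Ordinal.{0} → Ordinal.{0} → W)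
    (hF : ∀ ξ < c.ord, ξ.cof = s → ∀ j < s.ord, j.cof = κ →
      ∀ ξ' < c.ord, ξ'.cof = s → ∀ j' < s.ord, j'.cof = κ → ∀ l < κ.ord,
        (∀ m < l, ladderSeq r e g A ξ j m = ladderSeq r e g A ξ' j' m) →
        ladderSeq r e g A ξ j l < ladderSeq r e g A ξ' j' l → F ξ j < F ξ' j')
    (hen : ∀ ξ < c.ord, ξ.cof = s → ∀ j < s.ord, j.cof = κ → ∃ u, ∃ η < c.ord, en u η = F ξ j) :
    ∃ u, ∃ ξ < c.ord, ξ.cof = s ∧ ∃ j < s.ord, j.cof = κ ∧ ∀ k < κ.ord,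
      (k ∈ A ↔ ∃ η < e ξ (g j (succ k)), ∀ η' < e ξ (g j k),
        (en u η' < en u η ↔ en u η' < F ξ j)) := by
  classical
  let Q : U → Ordinal.{0} → Ordinal.{0} → Ordinal.{0} → (Ordinal.{0} → Ordinal.{0}) →
      Set (R × W) := fun u j k l h => {q | ∃ ξ' < c.ord, ξ'.cof = s ∧ ∃ j' < s.ord, j'.cof = κ ∧
    (∀ m < l, ladderSeq r e g A ξ' j' m = if m < k ∧ m ∈ A then r (h (g j m)) else r 0) ∧
    (∃ η < c.ord, en u η = F ξ' j') ∧ q = (ladderSeq r e g A ξ' j' l, F ξ' j')}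
  have hQ : ∀ u j k l h, l < κ.ord → ∀ q ∈ Q u j k l h, ∀ q' ∈ Q u j k l h,
      q.1 < q'.1 → q.2 < q'.2 := by
    rintro u j k l h hl _ ⟨ξ₁, h1, h2, j₁, h3, h4, h5, -, rfl⟩
      _ ⟨ξ₂, h6, h7, j₂, h8, h9, h10, -, rfl⟩ hlt
    exact hF _ h1 h2 _ h3 h4 _ h6 h7 _ h8 h9 l hl
      (fun m hm => (h5 m hm).trans (h10 m hm).symm) hlt
  have hQen : ∀ u j k l h, ∀ q ∈ Q u j k l h, ∃ η < c.ord, en u η = q.2 := by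
    rintro u j k l h _ ⟨ξ₁, h1, h2, j₁, h3, h4, h5, h6, rfl⟩
    exact h6
  let Closed : U → Set (R × W) → Ordinal.{0} → Ordinal.{0} → Prop := fun u Q α β =>
    (Q.Nonempty → ∃ q ∈ Q, ∃ η < β, en u η = q.2) ∧
      (∀ γ < c.ord, β ≤ γ → ∀ q₀ ∈ Q, q₀.1 = r γ → ∀ q ∈ Q,
        (q.1 < r γ → ∃ q₁ ∈ Q, q.1 < q₁.1 ∧ q₁.1 < r γ ∧ ∃ η < β, en u η = q₁.2) ∧
        (r γ < q.1 → ∃ q₁ ∈ Q, r γ < q₁.1 ∧ q₁.1 < q.1 ∧ ∃ η < β, en u η = q₁.2)) ∧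
      ∀ η < α, ∀ γ < c.ord, ∀ q ∈ Q, q.1 = r γ →
        ((∃ q' ∈ Q, q'.1 = r γ ∧ q.2 ≤ en u η ∧ en u η < q'.2) → γ < β) ∧
        (en u η < q.2 → (∀ q' ∈ Q, q'.1 < r γ → q'.2 < en u η) → γ < β) ∧
        (q.2 ≤ en u η → (∀ q' ∈ Q, r γ < q'.1 → en u η < q'.2) → γ < β)
  have hβ : ∀ u j k l h α, ∃ β, l < κ.ord → α < c.ord →
      β < c.ord ∧ Closed u (Q u j k l h) α β := by
    intro u j k l h α
    by_cases hl : l < κ.ord ∧ α < c.ord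
    · obtain ⟨β, h1, h2⟩ := exists_closure_bound hc hDc hD hr (en u) (Q u j k l h)
        (hQ u j k l h hl.1) (hQen u j k l h) hl.2
      exact ⟨β, fun _ _ => ⟨h1, h2⟩⟩
    · exact ⟨0, fun h1 h2 => absurd ⟨h1, h2⟩ hl⟩
  choose β hβ using hβ
  have hstep : ∀ i h, ∃ b, h i < c.ord → b < c.ord ∧ ∀ u, ∀ j < s.ord, ∀ k < κ.ord, ∀ l < κ.ord,
      β u j k l h (h i) < b := by
    intro i h
    by_cases hi : h i < c.ord
    · have hT : #(U × s.ord.ToType × κ.ord.ToType × κ.ord.ToType) < c := by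
        rw [← mul_def, ← mul_def, ← mul_def, mk_toType', mk_toType', card_ord, card_ord]
        have h1 := hκs.trans hsc
        exact mul_lt_of_lt hc.aleph0_le hU (mul_lt_of_lt hc.aleph0_le hsc
          (mul_lt_of_lt hc.aleph0_le h1 h1))
      obtain ⟨b, hb, h1⟩ := exists_bound_of_regular hc hT
        (fun t => β t.1 (ToType.mk.symm t.2.1).1 (ToType.mk.symm t.2.2.1).1
          (ToType.mk.symm t.2.2.2).1 h (h i))
        fun t => (hβ _ _ _ _ _ _ (ToType.mk.symm t.2.2.2).2 hi).1
      refine ⟨b, fun _ => ⟨hb, fun u j hj k hk l hl => ?_⟩⟩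
      simpa using h1 (u, ToType.mk ⟨j, hj⟩, ToType.mk ⟨k, hk⟩, ToType.mk ⟨l, hl⟩)
    · exact ⟨0, fun h => absurd h hi⟩
  choose step hstep using hstep
  obtain ⟨ξ, hξ, -, hξstep, hξlt⟩ := exists_normal_of_step 0 step
  have hsclim : IsSuccLimit c.ord := isSuccLimit_ord hc.aleph0_le
  have hslim : IsSuccLimit s.ord := isSuccLimit_ord hs.aleph0_le
  have hξc : ∀ i ≤ s.ord, ξ i < c.ord := by
    intro i hi
    refine hξlt (succ s.ord) c.ord ?_ hc.ord_pos (fun i _ h => ?_) i (lt_succ_iff.2 hi)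
    · rw [hc.cof_ord]
      exact succ_le_of_lt (ord_lt_ord.2 hsc)
    · refine (hstep i _ ?_).1
      simpa [upTo] using h i le_rfl
  have hξs : (ξ s.ord).cof = s := by
    rw [cof_map_of_isNormal hξ hslim, hs.cof_ord]
  obtain ⟨hen', hes⟩ := he _ (hξc _ le_rfl) hξs
  obtain ⟨E, hE, hEeq⟩ := exists_isClubIn_eq hs (hκ'.trans hκs) hξ hen' hes.symm
  obtain ⟨j, hj, hjκ, hgj⟩ := hg E hE
  have hclosed : ∀ u, ∀ k < κ.ord, ∀ l < κ.ord, ∀ i < s.ord, (∀ m < k, g j m ≤ i) →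
      ∃ β < ξ (succ i), Closed u (Q u j k l ξ) (ξ i) β := by
    intro u k hk l hl i hi hgi
    have h1 : upTo ξ i i = ξ i := by simp [upTo]
    have h2 : upTo ξ i i < c.ord := by rw [h1]; exact hξc i hi.le
    have h3 : Q u j k l (upTo ξ i) = Q u j k l ξ := by
      have h4 : ∀ m, (if m < k ∧ m ∈ A then r (upTo ξ i (g j m)) else r 0) =
          if m < k ∧ m ∈ A then r (ξ (g j m)) else r 0 := by
        intro m
        by_cases hm : m < k ∧ m ∈ A
        · rw [if_pos hm, if_pos hm]
          simp [upTo, hgi m hm.1]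
        · rw [if_neg hm, if_neg hm]
      simp only [Q, h4]
    have h5 := (hβ u j k l (upTo ξ i) (upTo ξ i i) hl h2).2
    refine ⟨β u j k l (upTo ξ i) (upTo ξ i i),
      ((hstep i _ h2).2 u j hj k hk l hl).trans (hξstep _ _ (lt_succ i)), ?_⟩
    have h6 : ∀ P, Closed u (Q u j k l (upTo ξ i)) (upTo ξ i i) P →
        Closed u (Q u j k l ξ) (ξ i) P := by
      intro P hP
      rwa [h3, h1] at hP
    exact h6 _ h5
  obtain ⟨u, hu⟩ := hen _ (hξc _ le_rfl) hξs j hj hjκ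
  have hgs : ∀ k < κ.ord, g j k < s.ord := fun k hk => (hgj k hk).2.1.trans hj
  have hcE : ∀ k < κ.ord, e (ξ s.ord) (g j k) = ξ (g j k) := fun k hk =>
    (hEeq _ (hgj k hk).1).2.symm
  have hglim : ∀ k < κ.ord, IsSuccLimit (g j k) := fun k hk => (hEeq _ (hgj k hk).1).1
  have hS : ∀ m < κ.ord, ladderSeq r e g A (ξ s.ord) j m =
      if m ∈ A then r (ξ (g j m)) else r 0 := by
    intro m hm
    by_cases h : m ∈ A
    · rw [if_pos h, ladderSeq, if_pos h, hcE m hm]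
    · rw [if_neg h, ladderSeq, if_neg h]
  have hκlim : IsSuccLimit κ.ord := isSuccLimit_ord hκ'.le
  have hstage : ∀ k < κ.ord, ∀ η < ξ (g j k), ∃ i < g j k, η < ξ i ∧ ∀ m < k, g j m ≤ i := by
    intro k hk η hη
    obtain ⟨b, hb, hb'⟩ := (hgj k hk).2.2
    obtain ⟨i, hi, hi'⟩ := (hξ.lt_iff_exists_lt (hglim k hk)).1 hη
    exact ⟨max b i, max_lt hb hi, hi'.trans_le (hξ.strictMono.monotone (le_max_right _ _)),
      fun m hm => (hb' m hm).trans (le_max_left _ _)⟩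
  have hclosed' : ∀ k < κ.ord, ∀ η < ξ (g j k), ∀ k' ≤ k, ∀ l < κ.ord,
      ∃ β < ξ (g j k), ∃ α, η < α ∧ Closed u (Q u j k' l ξ) α β := by
    intro k hk η hη k' hk' l hl
    obtain ⟨i, hi, hηi, him⟩ := hstage k hk η hη
    obtain ⟨b, hb, h⟩ := hclosed u k' (hk'.trans_lt hk) l hl i (hi.trans (hgs k hk))
      fun m hm => him m (hm.trans_le hk')
    exact ⟨b, hb.trans (hξ.strictMono ((hglim k hk).succ_lt hi)), ξ i, hηi, h⟩
  have hpos : ∀ k < κ.ord, 0 < ξ (g j k) := fun k hk =>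
    (zero_le (a := ξ 0)).trans_lt (hξ.strictMono
      ((zero_le (a := _)).lt_of_ne fun h => (hglim k hk).1 (h ▸ isMin_bot)))
  have hcc : ∀ k < κ.ord, ξ (g j k) < c.ord := fun k hk => hξc _ (hgs k hk).le
  have hmono : ∀ k < κ.ord, ∀ m < k, ξ (g j m) < ξ (g j k) := by
    intro k hk m hm
    obtain ⟨b, hb, hb'⟩ := (hgj k hk).2.2
    exact hξ.strictMono ((hb' m hm).trans_lt hb)
  refine ⟨u, ξ s.ord, hξc _ le_rfl, hξs, j, hj, hjκ, fun k hk => ?_⟩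
  have hk1 : succ k < κ.ord := hκlim.succ_lt hk
  rw [hcE k hk, hcE _ hk1]
  constructor
  · intro hkA
    obtain ⟨b, hb, α, -, h⟩ := hclosed' (succ k) hk1 0 (hpos _ hk1) (succ k) le_rfl (succ k) hk1
    have hSQ : (Q u j (succ k) (succ k) ξ).Nonempty := by
      refine ⟨_, ξ s.ord, hξc _ le_rfl, hξs, j, hj, hjκ, fun m hm => ?_, hu, rfl⟩
      rw [hS m (hm.trans hk1)]
      simp only [hm, true_and]
    obtain ⟨_, ⟨ξ', hξ', hξ's, j', hj', hj'κ, hm', hen'', rfl⟩, η, hη, hηq⟩ := h.1 hSQ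
    refine ⟨η, hη.trans hb, fun η' hη' => ?_⟩
    obtain ⟨b', hb', α, hα, -, -, h'⟩ := hclosed' k hk η' hη' k le_rfl k hk
    have hS1 : (r (ξ (g j k)), F (ξ s.ord) j) ∈ Q u j k k ξ := by
      refine ⟨ξ s.ord, hξc _ le_rfl, hξs, j, hj, hjκ, fun m hm => ?_, hu, ?_⟩
      · rw [hS m (hm.trans hk)]
        simp [hm]
      · rw [hS k hk, if_pos hkA]
    have hS2 : (r (ξ (g j k)), F ξ' j') ∈ Q u j k k ξ := by
      refine ⟨ξ', hξ', hξ's, j', hj', hj'κ, fun m hm => ?_, hen'', ?_⟩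
      · rw [hm' m (hm.trans (lt_succ k))]
        simp [hm, hm.le]
      · rw [hm' k (lt_succ k), if_pos ⟨lt_succ k, hkA⟩]
    rw [hηq]
    constructor
    · intro h1
      by_contra h2
      exact absurd (((h' η' hα _ (hcc k hk) _ hS1 rfl).1 ⟨_, hS2, rfl, not_lt.1 h2, h1⟩).trans hb')
        (lt_irrefl _)
    · intro h1
      by_contra h2
      exact absurd (((h' η' hα _ (hcc k hk) _ hS2 rfl).1 ⟨_, hS1, rfl, not_lt.1 h2, h1⟩).trans hb')
        (lt_irrefl _)
  · rintro ⟨η, hη, hηF⟩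
    by_contra hkA
    obtain ⟨l, ⟨hlA, hkl, hlκ⟩, hlmin⟩ := WellFounded.has_min (wellFounded_lt (α := Ordinal.{0}))
      {l | l ∈ A ∧ k < l ∧ l < κ.ord} (hA k hk)
    have hSQ : (r (ξ (g j l)), F (ξ s.ord) j) ∈ Q u j k l ξ := by
      refine ⟨ξ s.ord, hξc _ le_rfl, hξs, j, hj, hjκ, fun m hm => ?_, hu, ?_⟩
      · rw [hS m (hm.trans hlκ)]
        by_cases hmA : m ∈ A
        · have hmk : m < k := by
            refine lt_of_le_of_ne (not_lt.1 fun h => hlmin m ⟨hmA, h, hm.trans hlκ⟩ hm) ?_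
            rintro rfl
            exact hkA hmA
          rw [if_pos hmA, if_pos ⟨hmk, hmA⟩]
        · rw [if_neg hmA, if_neg fun h => hmA h.2]
      · rw [hS l hlκ, if_pos hlA]
    obtain ⟨b₁, hb₁, α₁, -, -, h1, -⟩ := hclosed' k hk 0 (hpos k hk) k le_rfl l hlκ
    obtain ⟨b₂, hb₂, α, hα, -, -, h2⟩ := hclosed' (succ k) hk1 η hη k (le_succ k) l hlκ
    have hb₂' : b₂ < ξ (g j l) :=
      hb₂.trans_le (hξ.strictMono.monotone (by
        rcases (succ_le_of_lt hkl).eq_or_lt with h | h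
        · rw [h]
        · exact (hξ.strictMono.lt_iff_lt.1 (hmono l hlκ _ h)).le))
    have h1' := h1 _ (hcc l hlκ) (hb₁.trans (hmono l hlκ k hkl)).le _ hSQ rfl
    obtain ⟨-, h3, h4⟩ := h2 η hα _ (hcc l hlκ) _ hSQ rfl
    rcases lt_or_ge (en u η) (F (ξ s.ord) j) with hlt | hge
    · refine absurd ((h3 hlt fun q hq hqr => ?_).trans hb₂') (lt_irrefl _)
      obtain ⟨q₁, hq₁, h5, h6, η₁, hη₁, h7⟩ := (h1' q hq).1 hqr
      have h8 : q₁.2 < F (ξ s.ord) j := hQ u j k l ξ hlκ _ hq₁ _ hSQ h6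
      refine (hQ u j k l ξ hlκ _ hq _ hq₁ h5).trans ?_
      rw [← h7] at h8 ⊢
      exact (hηF η₁ (hη₁.trans hb₁)).2 h8
    · refine absurd ((h4 hge fun q hq hqr => ?_).trans hb₂') (lt_irrefl _)
      obtain ⟨q₁, hq₁, h5, h6, η₁, hη₁, h7⟩ := (h1' q hq).2 hqr
      have h8 : F (ξ s.ord) j < q₁.2 := hQ u j k l ξ hlκ _ hSQ _ hq₁ h5
      refine lt_of_le_of_lt ?_ (hQ u j k l ξ hlκ _ hq₁ _ hq h6)
      rw [← h7] at h8 ⊢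
      exact not_lt.1 fun h => (h8.trans ((hηF η₁ (hη₁.trans hb₁)).1 h)).false

theorem exists_separated_linearOrder {s : Cardinal.{0}} (hs : ℵ₀ ≤ s) :
    ∃ (R : Type) (_ : LinearOrder R) (D : Set R) (r : Ordinal.{0} → R), #D < succ s ∧
      (∀ a b, a < b → ∃ d ∈ D, a ≤ d ∧ d ≤ b) ∧ InjOn r (Iio (succ s).ord) := by
  classical
  have hne : succ s ≤ 2 ^ s := succ_le_of_lt (cantor s)
  let κ : Cardinal.{0} := sInf {κ | succ s ≤ 2 ^ κ}
  have hκs : κ ≤ s := csInf_le' hne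
  have hκ : succ s ≤ 2 ^ κ := csInf_mem (s := {κ | succ s ≤ 2 ^ κ}) ⟨s, hne⟩
  have hlt : ∀ μ < κ, 2 ^ μ ≤ s := fun μ hμ =>
    lt_succ_iff.1 (not_le.1 fun h => absurd (csInf_le' h : κ ≤ μ) (not_le.2 hμ))
  let I : Type := κ.ord.ToType
  have hI : #I = κ := by rw [mk_toType', card_ord]
  let node : (Σ a : I, Iio a → Bool) → Lex (I → Bool) := fun p =>
    toLex fun i => if h : i < p.1 then p.2 ⟨i, h⟩ else decide (i = p.1)
  have hR : succ s ≤ #(Lex (I → Bool)) := by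
    have h : #(Lex (I → Bool)) = 2 ^ κ := by
      rw [← hI]
      exact (Cardinal.power_def Bool I).symm.trans (by rw [mk_bool])
    rwa [h]
  obtain ⟨f⟩ : Nonempty ((succ s).ord.ToType ↪ Lex (I → Bool)) := by
    rw [← Cardinal.le_def, mk_toType', card_ord]
    exact hR
  refine ⟨Lex (I → Bool), inferInstance, range node,
    fun o => if h : o < (succ s).ord then f (ToType.mk ⟨o, h⟩) else toLex fun _ => false,
    ?_, fun a b hab => ?_, fun a ha b hb hab => ?_⟩
  · refine lt_succ_iff.2 (mk_range_le.trans ?_)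
    rw [mk_sigma]
    refine (sum_le_sum _ (fun _ => s) fun a => ?_).trans ?_
    · rw [← Cardinal.power_def, mk_bool]
      exact hlt _ (by simpa [I] using mk_Iio_lt a)
    · rw [sum_const', hI]
      exact (mul_le_mul_left hκs s).trans (mul_eq_self hs).le
  · obtain ⟨i, hi, hi'⟩ := hab
    have hai : a i = false ∧ b i = true := Bool.lt_iff.1 hi'
    refine ⟨node ⟨i, fun j => a j⟩, mem_range_self _, le_of_lt ⟨i, fun j hj => ?_, ?_⟩, ?_⟩
    · simp [node, hj]
    · simp [node, hai.1]
    · by_contra hlt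
      obtain ⟨j, hj, hj'⟩ := not_le.1 hlt
      have hj' : b j < node ⟨i, fun j => a j⟩ j := hj'
      rcases lt_trichotomy j i with h | rfl | h
      · have h1 : a j = b j := hi j h
        simp [node, h, h1] at hj'
      · rw [hai.2] at hj'
        exact absurd hj' (not_lt.2 le_top)
      · have h1 : node ⟨i, fun j => a j⟩ j = false := by simp [node, h.not_gt, h.ne']
        rw [h1] at hj'
        exact absurd hj' (not_lt.2 bot_le)
  · simp only [mem_Iio] at ha hb
    simp only [ha, hb, dif_pos] at hab
    exact congrArg Subtype.val (ToType.mk.injective (f.injective hab))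

theorem HasCover.exists_enumerations {lam θ σ : Cardinal.{0}} {W : Type} [Nonempty W]
    (hW : #W = lam) (h : HasCover lam θ σ lam.ord) :
    ∃ (L : Type) (en : L → Ordinal.{0} → W), #L ≤ lam ∧
      ∀ X : θ.ord.ToType → W, ∃ S : Set L, #S < σ ∧
        ∀ i, ∃ l ∈ S, ∃ η < θ.ord, en l η = X i := by
  classical
  obtain ⟨L, P, hL, hP⟩ := h
  obtain ⟨e⟩ : Nonempty (W ≃ lam.ord.ToType) := by
    rw [← Cardinal.eq, mk_toType', card_ord, hW]
  let w : Ordinal.{0} → W := fun v =>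
    if h : v < lam.ord then e.symm (ToType.mk ⟨v, h⟩) else Classical.arbitrary W
  refine ⟨L, fun l η => w (if h : η < θ.ord then P l (ToType.mk ⟨η, h⟩) else 0), hL, fun X => ?_⟩
  obtain ⟨S, hS, h⟩ := hP (fun i => (ToType.mk.symm (e (X i))).1) fun i =>
    (ToType.mk.symm (e (X i))).2
  refine ⟨S, hS, fun i => ?_⟩
  obtain ⟨l, hl, j, hj⟩ := h i
  have hj' : (ToType.mk.symm j).1 < θ.ord := (ToType.mk.symm j).2
  have hX : (ToType.mk.symm (e (X i))).1 < lam.ord := (ToType.mk.symm (e (X i))).2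
  have hw : w (P l j) = X i := by
    rw [hj]
    simp only [w, dif_pos hX]
    exact (congrArg e.symm (ToType.mk.apply_symm_apply _)).trans (e.symm_apply_apply _)
  refine ⟨l, hl, (ToType.mk.symm j).1, hj', ?_⟩
  rw [← hw]
  simp only [dif_pos hj']
  exact congrArg (fun j => w (P l j)) (ToType.mk.apply_symm_apply j)

theorem exists_unbounded_ne {κ lam : Cardinal.{0}} (hκ : ℵ₀ ≤ κ) (hlam : ℵ₀ ≤ lam)
    (hlt : lam < 2 ^ κ) {T : Type} (hT : #T ≤ lam) (p : T → Ordinal.{0} → Prop) :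
    ∃ A : Set Ordinal.{0}, (∀ k < κ.ord, ∃ l ∈ A, k < l ∧ l < κ.ord) ∧
      ∀ t, ¬ ∀ k < κ.ord, (k ∈ A ↔ p t k) := by
  let q : T → Set κ.ord.ToType := fun t => {k | p t (ToType.mk.symm k).1}
  obtain ⟨B, hB⟩ : ∃ B, B ∉ range (Sum.elim q fun t => (q t)ᶜ) := by
    by_contra! h
    have h1 : #(Set κ.ord.ToType) ≤ #(T ⊕ T) := mk_le_of_surjective h
    rw [mk_set, mk_toType', card_ord, mk_sum] at h1
    simp only [Cardinal.lift_id] at h1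
    exact absurd (h1.trans ((add_le_add hT hT).trans (add_eq_self hlam).le)) hlt.not_ge
  have hBq : ∀ t, B ≠ q t ∧ Bᶜ ≠ q t := fun t =>
    ⟨fun h => hB ⟨Sum.inl t, h.symm⟩, fun h => hB ⟨Sum.inr t, by
      rw [Sum.elim_inr, ← h, compl_compl]⟩⟩
  let tr : Set κ.ord.ToType → Set Ordinal.{0} := fun B =>
    {k | ∃ h : k < κ.ord, ToType.mk ⟨k, h⟩ ∈ B}
  have hne : ∀ B t, B ≠ q t → ¬ ∀ k < κ.ord, (k ∈ tr B ↔ p t k) := by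
    intro B t hBt h
    refine hBt (Set.ext fun k => ?_)
    have h1 := h (ToType.mk.symm k).1 (ToType.mk.symm k).2
    refine Iff.trans ?_ h1
    constructor
    · exact fun h2 => ⟨(ToType.mk.symm k).2, by simpa using h2⟩
    · rintro ⟨h2, h3⟩
      have h4 : ToType.mk ⟨_, h2⟩ = k := ToType.mk.apply_symm_apply k
      exact (congrArg (· ∈ B) h4).mp h3
  by_cases hub : ∀ k < κ.ord, ∃ l ∈ tr B, k < l ∧ l < κ.ord
  · exact ⟨tr B, hub, fun t => hne B t (hBq t).1⟩
  · push Not at hub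
    obtain ⟨k₀, hk₀, h⟩ := hub
    refine ⟨tr Bᶜ, fun k hk => ?_, fun t => hne _ t (hBq t).2⟩
    have h1 : succ (max k k₀) < κ.ord := (isSuccLimit_ord hκ).succ_lt (max_lt hk hk₀)
    refine ⟨succ (max k k₀), ⟨h1, fun h2 => ?_⟩, lt_succ_iff.2 (le_max_left _ _), h1⟩
    exact absurd h1 (h _ ⟨h1, h2⟩ (lt_succ_iff.2 (le_max_right _ _))).not_gt

theorem exists_linearOrder_not_embeddable {lam κ : Cardinal.{0}} {W : Type} [LinearOrder W]
    (hW : #W = lam) (hlam : ℵ₀ ≤ lam) (hκ : κ.IsRegular) (hκ' : ℵ₀ < κ)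
    (h1 : succ (succ (succ κ)) ≤ lam) (h2 : lam < 2 ^ κ)
    (hcov : HasCover lam (succ (succ (succ κ))) κ lam.ord) :
    ∃ (V : Type) (_ : LinearOrder V), #V = lam ∧ ∀ f : V → W, ¬ StrictMono f := by
  classical
  set s := succ (succ κ) with hs_def
  set c := succ s with hc_def
  have hs : s.IsRegular := isRegular_succ (hκ.aleph0_le.trans (le_succ κ))
  have hc : c.IsRegular := isRegular_succ hs.aleph0_le
  have hκs : κ < s := (lt_succ κ).trans (lt_succ _)
  have hsc : s < c := lt_succ s
  have hWne : Nonempty W := mk_ne_zero_iff.1 (hW ▸ (aleph0_pos.trans_le hlam).ne')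
  obtain ⟨L, en, hL, hcov⟩ := hcov.exists_enumerations hW
  obtain ⟨R, _, D, r, hDc, hD, hr⟩ := exists_separated_linearOrder hs.aleph0_le
  have he : ∀ ξ : Ordinal.{0}, ∃ e : Ordinal.{0} → Ordinal.{0},
      ξ.cof = s → IsNormal e ∧ e s.ord = ξ := by
    intro ξ
    by_cases hξ : ξ.cof = s
    · obtain ⟨e, h1, -, h2, -⟩ := exists_small_club (o := ξ) (hξ ▸ hs.aleph0_le)
      exact ⟨e, fun _ => ⟨h1, hξ ▸ h2⟩⟩
    · exact ⟨id, fun h => absurd h hξ⟩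
  choose e he using he
  obtain ⟨g, hg⟩ := club_guessing hs hκ (lt_succ (succ κ))
  have hcard : ∀ {a : Cardinal.{0}}, a ≤ lam → #a.ord.ToType ≤ lam := fun h => by
    rwa [mk_toType', card_ord]
  obtain ⟨A, hA, hAne⟩ := exists_unbounded_ne hκ.aleph0_le hlam h2
    (T := L × c.ord.ToType × s.ord.ToType × W) (by
      rw [← mul_def, ← mul_def, ← mul_def]
      have h3 : ∀ {a b : Cardinal.{0}}, a ≤ lam → b ≤ lam → a * b ≤ lam := fun ha hb =>
        (mul_le_mul' ha hb).trans (mul_eq_self hlam).le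
      exact h3 hL (h3 (hcard h1) (h3 (hcard (hsc.le.trans h1)) hW.le)))
    (fun t k => ∃ η < e (ToType.mk.symm t.2.1).1 (g (ToType.mk.symm t.2.2.1).1 (succ k)),
      ∀ η' < e (ToType.mk.symm t.2.1).1 (g (ToType.mk.symm t.2.2.1).1 k),
        (en t.1 η' < en t.1 η ↔ en t.1 η' < t.2.2.2))
  let x : Ordinal.{0} → Ordinal.{0} → Lex (κ.ord.ToType → R) := fun ξ j =>
    toLex fun k => ladderSeq r e g A ξ j (ToType.mk.symm k).1
  let V₀ : Set (Lex (κ.ord.ToType → R)) :=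
    range fun p : c.ord.ToType × s.ord.ToType => x (ToType.mk.symm p.1).1 (ToType.mk.symm p.2).1
  have hV₀ : ∀ ξ < c.ord, ∀ j < s.ord, x ξ j ∈ V₀ := fun ξ hξ j hj =>
    ⟨(ToType.mk ⟨ξ, hξ⟩, ToType.mk ⟨j, hj⟩), by simp⟩
  refine ⟨V₀ ⊕ₗ lam.ord.ToType, inferInstance, ?_, fun f hf => ?_⟩
  · have h3 : #(V₀ ⊕ₗ lam.ord.ToType) = #V₀ + lam := by
      have h4 : #(V₀ ⊕ lam.ord.ToType) = #V₀ + lam := by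
        rw [mk_sum, Cardinal.lift_id, Cardinal.lift_id, mk_toType', card_ord]
      exact h4
    rw [h3]
    refine add_eq_right hlam (mk_range_le.trans ?_)
    rw [← mul_def]
    exact (mul_le_mul' (hcard h1) (hcard (hsc.le.trans h1))).trans (mul_eq_self hlam).le
  · let F : Ordinal.{0} → Ordinal.{0} → W := fun ξ j =>
      if h : ξ < c.ord ∧ j < s.ord then f (toLex (Sum.inl ⟨x ξ j, hV₀ ξ h.1 j h.2⟩))
      else Classical.arbitrary W
    obtain ⟨K⟩ : Nonempty (c.ord.ToType ≃ c.ord.ToType × s.ord.ToType) := by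
      rw [← Cardinal.eq, ← mul_def, mk_toType', mk_toType', card_ord, card_ord]
      exact (mul_eq_left hc.aleph0_le hsc.le (aleph0_pos.trans_le hs.aleph0_le).ne').symm
    obtain ⟨S, hS, hcovS⟩ := hcov fun i => F (ToType.mk.symm (K i).1).1 (ToType.mk.symm (K i).2).1
    obtain ⟨u, ξ, hξ, -, j, hj, -, h⟩ := exists_ladder_invariant hκ' hκs hs hsc hc hDc hD hr
      (fun ξ _ => he ξ)
      (fun D hD => by
        obtain ⟨j, hj, hjκ, h, -⟩ := hg D hD
        exact ⟨j, hj, hjκ, h⟩) hA (U := S) (hS.trans (hκs.trans hsc)) (fun u => en u.1) F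
      (fun ξ hξ _ j hj _ ξ' hξ' _ j' hj' _ l hl hagree hlt => by
        simp only [F, dif_pos (And.intro hξ hj), dif_pos (And.intro hξ' hj')]
        refine hf (Sum.Lex.inl_lt_inl_iff.2 ?_)
        refine ⟨ToType.mk ⟨l, hl⟩, fun m hm => ?_, ?_⟩
        · refine hagree _ ?_
          have h3 : ToType.mk.symm m < ⟨l, hl⟩ := by
            rwa [← ToType.mk.lt_iff_lt, OrderIso.apply_symm_apply]
          exact h3
        · simpa [x] using hlt)
      (fun ξ hξ _ j hj _ => by
        obtain ⟨l, hl, η, hη, h⟩ := hcovS (K.symm (ToType.mk ⟨ξ, hξ⟩, ToType.mk ⟨j, hj⟩))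
        exact ⟨⟨l, hl⟩, η, hη, by simpa using h⟩)
    refine hAne (u.1, ToType.mk ⟨ξ, hξ⟩, ToType.mk ⟨j, hj⟩, F ξ j) fun k hk => ?_
    simpa using h k hk

end

/-- Kojman–Shelah: if `lam` is a singular cardinal which is not a strong
limit, and either (a) `lam < ℵ_lam`, or (b) `lam = ℵ_lam` but the set of fixed points of
the aleph function below `lam` has cardinality `< lam` and in addition `cf(lam) = ℵ₀` or
`2^{<cf(lam)} < lam`, then there is no universal linear order of cardinality `lam`. -/
theorem stmt_6 (lam : Cardinal.{0}) (hinf : Cardinal.aleph0 ≤ lam)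
    (hsing : lam.ord.cof < lam)
    (hnsl : ∃ μ < lam, lam ≤ 2 ^ μ)
    (hcase : lam < Cardinal.aleph lam.ord ∨
      (Cardinal.aleph lam.ord = lam ∧
        Cardinal.mk ↥{μ : Cardinal.{0} | μ < lam ∧ Cardinal.aleph μ.ord = μ} <
          Cardinal.lift.{1} lam ∧
        (lam.ord.cof = Cardinal.aleph0 ∨ Cardinal.powerlt 2 lam.ord.cof < lam))) :
    ∀ (W : Type) (rW : W → W → Prop), IsStrictTotalOrder W rW → Cardinal.mk W = lam →
      ∃ (V : Type) (rV : V → V → Prop), IsStrictTotalOrder V rV ∧ Cardinal.mk V = lam ∧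
        ¬ ∃ f : V → W, Function.Injective f ∧ ∀ x y : V, rV x y → rW (f x) (f y) := by
  classical
  intro W rW hrW hW
  obtain ⟨κ, hκ, hκ', h1, h2, h⟩ := exists_regular_of_cases hinf hsing hnsl
    (hcase.imp id fun h => ⟨h.1, h.2.1⟩)
  let _ : LinearOrder W := linearOrderOfSTO rW
  obtain ⟨V, _, hV, hf⟩ := exists_linearOrder_not_embeddable hW hinf hκ hκ' h1.le h2
    (hasCover_of_le hinf hκ hκ' (hκ.aleph0_le.trans ((Order.le_succ κ).trans
      ((Order.le_succ _).trans (Order.le_succ _)))) h lam.ord le_rfl)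
  exact ⟨V, (· < ·), inferInstance, hV, fun ⟨f, _, hf'⟩ => hf f fun x y => hf' x y⟩
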